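/- Let q ≥ 2. Assume the generalized Riemann hypothesis for all Dirichlet L-functions modulo q, assume all nonreal zeros of these L-functions are simple and that there exists θ with 1 ≤ θ < 3 − √3 such that ∑_{χ mod q} ∑_{0<|Im(ρ_χ)|≤T, L(ρ_χ,χ)=0} |L′(ρ_χ,χ)|^{−2} ≪_q T^θ, and assume the multiset of nonnegative imaginary parts of the nontrivial zeros of the Dirichlet L-functions modulo q is linearly independent over ℚ. Let M(x;q,a) = ∑_{n≤x, n≡a (mod q)} μ(n). Then: (1) for any two distinct reduced residues a_1, a_2 modulo q, the set {x > 0 : M(x;q,a_1) > M(x;q,a_2)} has logarithmic density 1/2; and (2) if a_1, a_2, a_3 are reduced residues modulo q and there is ρ ≢ 1 (mod q) with ρ³ ≡ 1, a_2 ≡ a_1ρ, and a_3 ≡ a_1ρ² (mod q), then the set {x > 0 : M(x;q,a_1) > M(x;q,a_2) > M(x;q,a_3)} has logarithmic density 1/(3!) = 1/6. -/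

import Mathlib

open MeasureTheory Filter Topology

/-- `P ⊆ [0,∞)` has logarithmic density `d`:
`(1/log X) ∫_{t ∈ P ∩ [2,X]} dt/t → d` as `X → ∞`. -/
def HasLogDensity (P : Set ℝ) (d : ℝ) : Prop :=
  Tendsto (fun X : ℝ => (1 / Real.log X) * ∫ t in P ∩ Set.Icc 2 X, 1 / t) atTop (𝓝 d)

/-- `M(x; q, a) = ∑_{n ≤ x, n ≡ a (mod q)} μ(n)`. -/
noncomputable def Mprog (q : ℕ) (a : ZMod q) (x : ℝ) : ℝ :=
  ∑ n ∈ (Finset.Icc 1 ⌊x⌋₊).filter (fun n => (Nat.cast n : ZMod q) = a),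
    (ArithmeticFunction.moebius n : ℝ)

/-- A function holomorphic on an open set is divisible by the nodal polynomial of its zeros. -/
theorem exists_eq_prod_sub_mul {U : Set ℂ} (hU : IsOpen U) (S : Finset ℂ) :
    ∀ f : ℂ → ℂ, DifferentiableOn ℂ f U → (↑S ⊆ U) → (∀ ρ ∈ S, f ρ = 0) →
    ∃ l : ℂ → ℂ, DifferentiableOn ℂ l U ∧ ∀ s, f s = (∏ ρ ∈ S, (s - ρ)) * l s := by
  induction S using Finset.induction_on with
  | empty => intro f hf _ _; exact ⟨f, hf, by simp⟩
  | insert a S ha ih =>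
    intro f hf hS h0
    have haU : a ∈ U := hS (by simp)
    have hd : DifferentiableOn ℂ (dslope f a) U :=
      (Complex.differentiableOn_dslope (hU.mem_nhds haU)).2 hf
    have hfa : ∀ s, f s = (s - a) * dslope f a s := by
      intro s
      have := sub_smul_dslope f a s
      rw [h0 a (by simp)] at this
      simpa using this.symm
    obtain ⟨l, hl, hfl⟩ := ih (dslope f a) hd (fun x hx => hS (by simp [Finset.mem_coe.1 hx])) (by
      intro ρ hρ
      have h1 := h0 ρ (by simp [hρ])
      rw [hfa] at h1
      rcases mul_eq_zero.1 h1 with h | h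
      · exact absurd (sub_eq_zero.1 h ▸ hρ) ha
      · exact h)
    exact ⟨l, hl, fun s => by rw [Finset.prod_insert ha, hfa, hfl]; ring⟩

theorem deriv_prod_sub_mul {S : Finset ℂ} {f l : ℂ → ℂ} {a : ℂ} (ha : a ∈ S)
    (hl : DifferentiableAt ℂ l a) (hf : ∀ s, f s = (∏ ρ ∈ S, (s - ρ)) * l s) :
    deriv f a = (∏ ρ ∈ S.erase a, (a - ρ)) * l a := by
  have h1 : f = fun s => (s - a) * ((∏ ρ ∈ S.erase a, (s - ρ)) * l s) := by
    ext s
    rw [hf, ← Finset.mul_prod_erase S _ ha]; ring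
  have hk : DifferentiableAt ℂ (fun s => (∏ ρ ∈ S.erase a, (s - ρ)) * l s) a := by
    fun_prop
  rw [h1]
  have := ((hasDerivAt_id a).sub_const a).mul hk.hasDerivAt
  have h2 := this.deriv
  simp only [id, sub_self, one_mul, zero_mul, add_zero] at h2
  exact h2

theorem Complex.log_sub_log_neg_of_im_pos {z : ℂ} (hz : 0 < z.im) :
    Complex.log z - Complex.log (-z) = Real.pi * Complex.I := by
  simp only [Complex.log, norm_neg, Complex.arg_neg_eq_arg_sub_pi_of_im_pos hz]
  push_cast; ring

theorem Complex.log_sub_log_neg_of_im_neg {z : ℂ} (hz : z.im < 0) :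
    Complex.log z - Complex.log (-z) = -(Real.pi * Complex.I) := by
  simp only [Complex.log, norm_neg, Complex.arg_neg_eq_arg_add_pi_of_im_neg hz]
  push_cast; ring

/-- The integral of `f` over the positively oriented boundary of a rectangle. -/
noncomputable def rectIntegral (f : ℂ → ℂ) (a b c d : ℝ) : ℂ :=
  (∫ x in a..b, f (x + c * Complex.I)) - (∫ x in a..b, f (x + d * Complex.I))
    + Complex.I * (∫ y in c..d, f (b + y * Complex.I))
    - Complex.I * (∫ y in c..d, f (a + y * Complex.I))

theorem integral_horizontal_inv {a b : ℝ} {w : ℂ} (h : w.im ≠ 0) :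
    ∫ x in a..b, ((x : ℂ) + w)⁻¹ = Complex.log (b + w) - Complex.log (a + w) := by
  have hs : ∀ x : ℝ, (x : ℂ) + w ∈ Complex.slitPlane := fun x =>
    Complex.mem_slitPlane_iff.2 (Or.inr (by simpa using h))
  apply intervalIntegral.integral_eq_sub_of_hasDerivAt (f := fun x : ℝ => Complex.log (x + w))
  · intro x _
    have h1 : HasDerivAt (fun x : ℝ => (x : ℂ) + w) 1 x :=
      (Complex.ofRealCLM.hasDerivAt).add_const w
    simpa using h1.clog_real (hs x)
  · apply Continuous.intervalIntegrable
    exact Continuous.inv₀ (by fun_prop) fun x => Complex.slitPlane_ne_zero (hs x)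

theorem integral_vertical_inv {a b : ℝ} {w : ℂ} (h : 0 < w.re) :
    Complex.I * ∫ y in a..b, ((y : ℂ) * Complex.I + w)⁻¹ =
      Complex.log (b * Complex.I + w) - Complex.log (a * Complex.I + w) := by
  have hs : ∀ x : ℝ, (x : ℂ) * Complex.I + w ∈ Complex.slitPlane := fun x =>
    Complex.mem_slitPlane_iff.2 (Or.inl (by simpa using h))
  rw [← intervalIntegral.integral_const_mul]
  apply intervalIntegral.integral_eq_sub_of_hasDerivAt
    (f := fun x : ℝ => Complex.log (x * Complex.I + w))
  · intro x _
    have h1 : HasDerivAt (fun x : ℝ => (x : ℂ) * Complex.I + w) Complex.I x := by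
      simpa using ((Complex.ofRealCLM.hasDerivAt (x := x)).mul_const Complex.I).add_const w
    simpa [div_eq_mul_inv] using h1.clog_real (hs x)
  · apply Continuous.intervalIntegrable
    exact Continuous.mul continuous_const (Continuous.inv₀ (by fun_prop)
      fun x => Complex.slitPlane_ne_zero (hs x))

theorem rectIntegral_inv_sub {a b c d : ℝ} {ρ : ℂ} (ha : a < ρ.re) (hb : ρ.re < b)
    (hc : c < ρ.im) (hd : ρ.im < d) :
    rectIntegral (fun s => (s - ρ)⁻¹) a b c d = 2 * Real.pi * Complex.I := by
  unfold rectIntegral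
  have e1 : ∫ x in a..b, ((x : ℂ) + c * Complex.I - ρ)⁻¹ =
      Complex.log (b + (c * Complex.I - ρ)) - Complex.log (a + (c * Complex.I - ρ)) := by
    rw [← integral_horizontal_inv (by simp; linarith)]
    simp only [add_sub_assoc]
  have e2 : ∫ x in a..b, ((x : ℂ) + d * Complex.I - ρ)⁻¹ =
      Complex.log (b + (d * Complex.I - ρ)) - Complex.log (a + (d * Complex.I - ρ)) := by
    rw [← integral_horizontal_inv (by simp; linarith)]
    simp only [add_sub_assoc]
  have e3 : Complex.I * ∫ y in c..d, ((b : ℂ) + y * Complex.I - ρ)⁻¹ =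
      Complex.log (d * Complex.I + (b - ρ)) - Complex.log (c * Complex.I + (b - ρ)) := by
    rw [← integral_vertical_inv (by simp; linarith)]
    congr 2; ext y; ring_nf
  have e4 : Complex.I * ∫ y in c..d, ((a : ℂ) + y * Complex.I - ρ)⁻¹ =
      Complex.log (-(a + (d * Complex.I - ρ))) - Complex.log (-(a + (c * Complex.I - ρ))) := by
    have := integral_vertical_inv (a := -d) (b := -c) (w := ρ - a) (by simp; linarith)
    rw [← intervalIntegral.integral_comp_neg] at this
    have h : ∀ y : ℝ, ((a : ℂ) + y * Complex.I - ρ)⁻¹ =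
        -(((-y : ℝ) : ℂ) * Complex.I + (ρ - a))⁻¹ := by
      intro y; rw [← inv_neg]; congr 1; push_cast; ring
    simp only [h]
    rw [intervalIntegral.integral_neg, mul_neg, this]
    push_cast
    ring_nf
  rw [e1, e2, e3, e4]
  have t1 := Complex.log_sub_log_neg_of_im_pos (z := a + (d * Complex.I - ρ)) (by simp; linarith)
  have t2 := Complex.log_sub_log_neg_of_im_neg (z := a + (c * Complex.I - ρ)) (by simp; linarith)
  have r1 : (d * Complex.I + (b - ρ)) = (b + (d * Complex.I - ρ)) := by ring
  have r2 : (c * Complex.I + (b - ρ)) = (b + (c * Complex.I - ρ)) := by ring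
  rw [r1, r2]
  linear_combination t1 - t2

theorem rectIntegral_eq_zero {f : ℂ → ℂ} {a b c d : ℝ} (hab : a ≤ b) (hcd : c ≤ d)
    (hf : DifferentiableOn ℂ f (Set.Icc a b ×ℂ Set.Icc c d)) : rectIntegral f a b c d = 0 := by
  have := Complex.integral_boundary_rect_eq_zero_of_differentiableOn f (⟨a, c⟩ : ℂ) ⟨b, d⟩
    (by simpa [Set.uIcc_of_le hab, Set.uIcc_of_le hcd] using hf)
  simpa [rectIntegral] using this

theorem rectIntegral_congr {f g : ℂ → ℂ} {a b c d : ℝ} (hab : a ≤ b) (hcd : c ≤ d)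
    (h : ∀ s : ℂ, (s.re = a ∨ s.re = b ∨ s.im = c ∨ s.im = d) → s ∈ Set.Icc a b ×ℂ Set.Icc c d →
      f s = g s) : rectIntegral f a b c d = rectIntegral g a b c d := by
  unfold rectIntegral
  congr 1
  · congr 1
    · congr 1 <;>
      · refine intervalIntegral.integral_congr fun x hx => h _ (by simp) ?_
        rw [Set.uIcc_of_le hab] at hx
        simpa [Complex.mem_reProdIm, hcd] using hx
    · congr 1
      refine intervalIntegral.integral_congr fun x hx => h _ (by simp) ?_
      rw [Set.uIcc_of_le hcd] at hx
      simpa [Complex.mem_reProdIm, hab] using hx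
  · congr 1
    refine intervalIntegral.integral_congr fun x hx => h _ (by simp) ?_
    rw [Set.uIcc_of_le hcd] at hx
    simpa [Complex.mem_reProdIm, hab] using hx

/-- The boundary of a rectangle. -/
def rectBoundary (a b c d : ℝ) : Set ℂ :=
  {s | (s.re = a ∨ s.re = b ∨ s.im = c ∨ s.im = d) ∧ s ∈ Set.Icc a b ×ℂ Set.Icc c d}

theorem intervalIntegrable_of_continuousOn_rectBoundary {f : ℂ → ℂ} {a b c d : ℝ} (hab : a ≤ b)
    (hcd : c ≤ d) (hf : ContinuousOn f (rectBoundary a b c d)) :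
    IntervalIntegrable (fun x : ℝ => f (x + c * Complex.I)) volume a b ∧
    IntervalIntegrable (fun x : ℝ => f (x + d * Complex.I)) volume a b ∧
    IntervalIntegrable (fun y : ℝ => f (b + y * Complex.I)) volume c d ∧
    IntervalIntegrable (fun y : ℝ => f (a + y * Complex.I)) volume c d := by
  refine ⟨?_, ?_, ?_, ?_⟩ <;>
  · apply ContinuousOn.intervalIntegrable
    refine hf.comp (by fun_prop) fun x hx => ?_
    first
    | rw [Set.uIcc_of_le hab] at hx
      simpa [rectBoundary, Complex.mem_reProdIm, hcd] using hx
    | rw [Set.uIcc_of_le hcd] at hx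
      simpa [rectBoundary, Complex.mem_reProdIm, hab] using hx

theorem rectIntegral_add {f g : ℂ → ℂ} {a b c d : ℝ} (hab : a ≤ b) (hcd : c ≤ d)
    (hf : ContinuousOn f (rectBoundary a b c d)) (hg : ContinuousOn g (rectBoundary a b c d)) :
    rectIntegral (fun s => f s + g s) a b c d =
      rectIntegral f a b c d + rectIntegral g a b c d := by
  obtain ⟨f1, f2, f3, f4⟩ := intervalIntegrable_of_continuousOn_rectBoundary hab hcd hf
  obtain ⟨g1, g2, g3, g4⟩ := intervalIntegrable_of_continuousOn_rectBoundary hab hcd hg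
  simp only [rectIntegral, intervalIntegral.integral_add f1 g1,
    intervalIntegral.integral_add f2 g2, intervalIntegral.integral_add f3 g3,
    intervalIntegral.integral_add f4 g4]
  ring

theorem rectIntegral_const_mul (z : ℂ) (f : ℂ → ℂ) (a b c d : ℝ) :
    rectIntegral (fun s => z * f s) a b c d = z * rectIntegral f a b c d := by
  simp only [rectIntegral, intervalIntegral.integral_const_mul]
  ring

theorem rectIntegral_sum {a b c d : ℝ} (hab : a ≤ b) (hcd : c ≤ d) (S : Finset ℂ)
    (f : ℂ → ℂ → ℂ) (hf : ∀ ρ ∈ S, ContinuousOn (f ρ) (rectBoundary a b c d)) :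
    rectIntegral (fun s => ∑ ρ ∈ S, f ρ s) a b c d = ∑ ρ ∈ S, rectIntegral (f ρ) a b c d := by
  induction S using Finset.induction_on with
  | empty => simp [rectIntegral]
  | insert x S hx ih =>
    simp only [Finset.sum_insert hx]
    rw [rectIntegral_add hab hcd (hf x (by simp))
      (continuousOn_finsetSum _ fun i hi => hf i (by simp [hi])),
      ih fun i hi => hf i (by simp [hi])]

theorem rectIntegral_div {U : Set ℂ} (hU : IsOpen U) {m f : ℂ → ℂ} {a b c d : ℝ}
    (hab : a ≤ b) (hcd : c ≤ d) (hR : Set.Icc a b ×ℂ Set.Icc c d ⊆ U)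
    (hm : DifferentiableOn ℂ m U) (hf : DifferentiableOn ℂ f U) (S : Finset ℂ)
    (hS : ∀ ρ, ρ ∈ S ↔ (ρ ∈ Set.Icc a b ×ℂ Set.Icc c d ∧ f ρ = 0))
    (hSi : ∀ ρ ∈ S, a < ρ.re ∧ ρ.re < b ∧ c < ρ.im ∧ ρ.im < d)
    (hd : ∀ ρ ∈ S, deriv f ρ ≠ 0) :
    rectIntegral (fun s => m s / f s) a b c d =
      2 * Real.pi * Complex.I * ∑ ρ ∈ S, m ρ / deriv f ρ := by
  classical
  have hSU : (↑S : Set ℂ) ⊆ U := fun ρ hρ => hR ((hS ρ).1 hρ).1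
  obtain ⟨l, hl, hfl⟩ := exists_eq_prod_sub_mul hU S f hf hSU fun ρ hρ => ((hS ρ).1 hρ).2
  have hder : ∀ ρ ∈ S, deriv f ρ = (∏ σ ∈ S.erase ρ, (ρ - σ)) * l ρ := fun ρ hρ =>
    deriv_prod_sub_mul hρ (hl.differentiableAt (hU.mem_nhds (hSU hρ))) hfl
  have hprod : ∀ ρ ∈ S, (∏ σ ∈ S.erase ρ, (ρ - σ)) ≠ 0 := fun ρ hρ h => hd ρ hρ (by
    rw [hder ρ hρ, h, zero_mul])
  have hl0 : ∀ s ∈ Set.Icc a b ×ℂ Set.Icc c d, l s ≠ 0 := by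
    intro s hs h
    by_cases hsS : s ∈ S
    · exact hd s hsS (by rw [hder s hsS, h, mul_zero])
    · exact hsS ((hS s).2 ⟨hs, by rw [hfl, h, mul_zero]⟩)
  -- Lagrange interpolation of `m - f * (interpolating part)`
  set w : ℂ → ℂ := fun ρ => m ρ / deriv f ρ with hw
  set H : ℂ → ℂ := fun s => m s - l s * ∑ ρ ∈ S, w ρ * ∏ σ ∈ S.erase ρ, (s - σ) with hH
  have hHd : DifferentiableOn ℂ H U := by
    refine hm.sub (hl.mul ?_)
    apply Differentiable.differentiableOn
    fun_prop
  have hH0 : ∀ ρ ∈ S, H ρ = 0 := by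
    intro ρ hρ
    simp only [hH]
    rw [Finset.sum_eq_single ρ]
    · have := hprod ρ hρ
      have h2 : l ρ ≠ 0 := hl0 ρ ((hS ρ).1 hρ).1
      rw [hw]; simp only [hder ρ hρ]; field_simp; ring
    · intro τ hτ hne
      rw [Finset.prod_eq_zero (i := ρ) (Finset.mem_erase.2 ⟨hne.symm, hρ⟩) (sub_self _), mul_zero]
    · exact fun h => absurd hρ h
  obtain ⟨h, hh, hHh⟩ := exists_eq_prod_sub_mul hU S H hHd hSU hH0
  have hbR : rectBoundary a b c d ⊆ Set.Icc a b ×ℂ Set.Icc c d := fun s hs => hs.2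
  have hbS : ∀ s ∈ rectBoundary a b c d, ∀ ρ ∈ S, s - ρ ≠ 0 := by
    intro s hs ρ hρ he
    have := hSi ρ hρ
    rw [sub_eq_zero] at he
    subst he
    rcases hs.1 with h | h | h | h <;> linarith [this.1, this.2.1, this.2.2.1, this.2.2.2]
  have hdiv : DifferentiableOn ℂ (fun s => h s / l s) (Set.Icc a b ×ℂ Set.Icc c d) :=
    (hh.mono hR).div (hl.mono hR) hl0
  have hc : ∀ ρ ∈ S, ContinuousOn (fun s => w ρ * (s - ρ)⁻¹) (rectBoundary a b c d) :=
    fun ρ hρ => continuousOn_const.mul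
      (ContinuousOn.inv₀ (by fun_prop) fun s hs => hbS s hs ρ hρ)
  have key : rectIntegral (fun s => m s / f s) a b c d =
      rectIntegral (fun s => h s / l s + ∑ ρ ∈ S, w ρ * (s - ρ)⁻¹) a b c d := by
    refine rectIntegral_congr hab hcd fun s hs hsR => ?_
    have hsb : s ∈ rectBoundary a b c d := ⟨hs, hsR⟩
    have hl0' := hl0 s hsR
    have hP : (∏ ρ ∈ S, (s - ρ)) ≠ 0 := Finset.prod_ne_zero_iff.2 (hbS s hsb)
    have hms : m s = (∏ ρ ∈ S, (s - ρ)) * h s +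
        l s * ∑ ρ ∈ S, w ρ * ∏ σ ∈ S.erase ρ, (s - σ) := by
      rw [← hHh]; simp [hH]
    have hsum : ∑ ρ ∈ S, w ρ * ∏ σ ∈ S.erase ρ, (s - σ) =
        (∏ ρ ∈ S, (s - ρ)) * ∑ ρ ∈ S, w ρ * (s - ρ)⁻¹ := by
      rw [Finset.mul_sum]
      refine Finset.sum_congr rfl fun ρ hρ => ?_
      rw [← Finset.mul_prod_erase S _ hρ]
      have := hbS s hsb ρ hρ
      field_simp
    rw [hfl, hms, hsum]
    field_simp
  rw [key, rectIntegral_add hab hcd (hdiv.continuousOn.mono hbR)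
    (continuousOn_finsetSum _ hc), rectIntegral_eq_zero hab hcd hdiv, zero_add,
    rectIntegral_sum hab hcd S _ hc, Finset.mul_sum]
  refine Finset.sum_congr rfl fun ρ hρ => ?_
  obtain ⟨h1, h2, h3, h4⟩ := hSi ρ hρ
  rw [rectIntegral_const_mul, rectIntegral_inv_sub h1 h2 h3 h4]
  ring

theorem exists_log_on_ball {h : ℂ → ℂ} {c : ℂ} {R : ℝ} (hR : 0 < R)
    (hd : DifferentiableOn ℂ h (Metric.ball c R)) (h0 : ∀ z ∈ Metric.ball c R, h z ≠ 0) :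
    ∃ g : ℂ → ℂ, DifferentiableOn ℂ g (Metric.ball c R) ∧ g c = 0 ∧
      ∀ z ∈ Metric.ball c R, h z = h c * Complex.exp (g z) := by
  have hcm : c ∈ Metric.ball c R := Metric.mem_ball_self hR
  have hd' : DifferentiableOn ℂ (deriv h) (Metric.ball c R) := hd.deriv Metric.isOpen_ball
  obtain ⟨g, hg⟩ := (hd'.div hd h0).isExactOn_ball
  refine ⟨fun z => g z - g c, fun z hz =>
    ((hg z hz).differentiableAt.sub_const _).differentiableWithinAt, by simp, fun z hz => ?_⟩
  have hconst : ∀ z ∈ Metric.ball c R,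
      HasDerivAt (fun z => h z * Complex.exp (-(g z - g c))) 0 z := by
    intro z hz
    have h1 := (hd.differentiableAt (Metric.isOpen_ball.mem_nhds hz)).hasDerivAt
    have h2 := ((hg z hz).sub_const (g c)).neg.cexp
    refine HasDerivAt.congr_deriv (h1.mul h2) ?_
    have := h0 z hz
    simp only [Pi.div_apply, Pi.neg_apply]
    field_simp
    ring
  have hd2 : DifferentiableOn ℂ (fun z => h z * Complex.exp (-(g z - g c)))
      (Metric.ball c R) := fun z hz => (hconst z hz).differentiableAt.differentiableWithinAt
  have := Metric.isOpen_ball.is_const_of_deriv_eq_zero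
    (convex_ball c R).isPreconnected hd2 (fun z hz => (hconst z hz).deriv) hz hcm
  simp only [sub_self, neg_zero, Complex.exp_zero, mul_one] at this
  rw [← this, mul_assoc, ← Complex.exp_add]
  simp

/-- A lower bound for a nonvanishing holomorphic function on a disc, from Borel-Carathéodory. -/
theorem norm_ge_of_forall_ne_zero {h : ℂ → ℂ} {c : ℂ} {R₀ R Λ : ℝ} (h0R : R₀ < R)
    (hR0 : 0 < R₀) (hΛ : 0 < Λ)
    (hd : DifferentiableOn ℂ h (Metric.ball c R)) (h0 : ∀ z ∈ Metric.ball c R, h z ≠ 0)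
    (hle : ∀ z ∈ Metric.ball c R, ‖h z‖ ≤ ‖h c‖ * Real.exp Λ)
    {s : ℂ} (hs : s ∈ Metric.closedBall c R₀) :
    ‖h c‖ * Real.exp (-(2 * R₀ / (R - R₀) * Λ)) ≤ ‖h s‖ := by
  have hR : 0 < R := hR0.trans h0R
  obtain ⟨g, hg, hgc, hhg⟩ := exists_log_on_ball hR hd h0
  have hsb : ∀ z, z ∈ Metric.ball (0 : ℂ) R → c + z ∈ Metric.ball c R := by
    intro z hz; simpa using hz
  have hre : Set.MapsTo (fun z => g (c + z)) (Metric.ball 0 R) {z | z.re ≤ Λ} := by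
    intro z hz
    have hz' := hsb z hz
    have h1 := hle _ hz'
    rw [hhg _ hz', norm_mul, Complex.norm_exp] at h1
    have hc0 : 0 < ‖h c‖ := norm_pos_iff.2 (h0 c (Metric.mem_ball_self hR))
    exact Real.exp_le_exp.1 (le_of_mul_le_mul_left h1 hc0)
  have hz0 : ‖s - c‖ ≤ R₀ := by simpa [dist_eq_norm] using hs
  have hbc := Complex.borelCaratheodory_zero (f := fun z => g (c + z)) (z := s - c) hΛ
    (hg.comp (by fun_prop) hsb) hre hR (by simpa using hz0.trans_lt h0R) (by simpa using hgc)
  simp only [add_sub_cancel] at hbc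
  rw [hhg s (by simpa [dist_eq_norm] using hz0.trans_lt h0R), norm_mul, Complex.norm_exp]
  refine mul_le_mul_of_nonneg_left (Real.exp_le_exp.2 ?_) (norm_nonneg _)
  have h2 : 2 * Λ * ‖s - c‖ / (R - ‖s - c‖) ≤ 2 * R₀ / (R - R₀) * Λ := by
    rw [div_mul_eq_mul_div, show 2 * R₀ * Λ = 2 * Λ * R₀ by ring]
    have : 0 < R - R₀ := by linarith
    gcongr
  have h3 := Complex.abs_re_le_norm (g s)
  have h4 := neg_abs_le (g s).re
  linarith

theorem norm_sq_sub_conj_mul {R : ℝ} {w a : ℂ} (hw : ‖w‖ = R) :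
    ‖(R : ℂ) ^ 2 - (starRingEnd ℂ) a * w‖ = R * ‖w - a‖ := by
  have : (R : ℂ) ^ 2 = (starRingEnd ℂ) w * w := by
    rw [mul_comm, Complex.mul_conj, Complex.normSq_eq_norm_sq, hw]; push_cast; ring
  rw [this, ← sub_mul, ← map_sub, norm_mul, RCLike.norm_conj, hw, mul_comm]

/-- Counting zeros in a disc, and a lower bound for `‖f‖` in terms of the zeros nearby. -/
theorem disc_estimate {f : ℂ → ℂ} (hf : Differentiable ℂ f) {c : ℂ} {R₀ R₁ R Λ : ℝ}
    (h01 : R₀ < R₁) (hR0 : 0 < R₀) (h1R : R₁ < R) (hΛ : 0 < Λ) (hfc : f c ≠ 0)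
    (hle : ∀ z ∈ Metric.closedBall c R, ‖f z‖ ≤ ‖f c‖ * Real.exp Λ)
    {S : Finset ℂ} (hS : ∀ ρ ∈ S, ρ ∈ Metric.closedBall c R₁ ∧ f ρ = 0) :
    S.card * Real.log (R / R₁) ≤ Λ ∧
    ((∀ ρ ∈ Metric.closedBall c R₁, f ρ = 0 → ρ ∈ S) → (∀ ρ ∈ S, deriv f ρ ≠ 0) →
      ∀ s ∈ Metric.closedBall c R₀,
        ‖f c‖ * Real.exp (-(2 * R₀ / (R₁ - R₀) * Λ)) * ∏ ρ ∈ S, (‖s - ρ‖ / (2 * R)) ≤ ‖f s‖) := by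
  have hR1 : 0 < R₁ := hR0.trans h01
  have hR : 0 < R := hR1.trans h1R
  obtain ⟨l, hl, hfl⟩ := exists_eq_prod_sub_mul isOpen_univ S f hf.differentiableOn
    (Set.subset_univ _) fun ρ hρ => (hS ρ hρ).2
  rw [differentiableOn_univ] at hl
  set B : ℂ → ℂ → ℂ := fun ρ s => ((R : ℂ) ^ 2 - (starRingEnd ℂ) (ρ - c) * (s - c)) / R with hB
  set h : ℂ → ℂ := fun s => l s * ∏ ρ ∈ S, B ρ s with hh
  have hhd : Differentiable ℂ h := by
    refine hl.mul ?_
    simp only [hB]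
    fun_prop
  have hR0' : (R : ℂ) ≠ 0 := by exact_mod_cast hR.ne'
  have hnormR : ‖(R : ℂ)‖ = R := by simp [abs_of_pos hR]
  -- on the circle the norms agree
  have hcirc : ∀ s ∈ Metric.sphere c R, ‖h s‖ = ‖f s‖ := by
    intro s hs
    have hs' : ‖s - c‖ = R := by simpa [dist_eq_norm] using hs
    rw [hfl, hh]
    simp only [norm_mul, norm_prod]
    rw [mul_comm]
    congr 1
    refine Finset.prod_congr rfl fun ρ _ => ?_
    rw [hB]; simp only [norm_div, norm_sq_sub_conj_mul hs', hnormR]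
    rw [mul_div_cancel_left₀ _ hR.ne']
    congr 1; ring
  have hmax : ∀ s ∈ Metric.closedBall c R, ‖h s‖ ≤ ‖f c‖ * Real.exp Λ := by
    intro s hs
    refine Complex.norm_le_of_forall_mem_frontier_norm_le (U := Metric.ball c R)
      Metric.isBounded_ball hhd.diffContOnCl (fun z hz => ?_) (by rwa [closure_ball c hR.ne'])
    rw [frontier_ball c hR.ne'] at hz
    rw [hcirc z hz]
    exact hle z (Metric.sphere_subset_closedBall hz)
  have hρc : ∀ ρ ∈ S, 0 < ‖c - ρ‖ ∧ ‖c - ρ‖ ≤ R₁ := by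
    intro ρ hρ
    have h1 := (hS ρ hρ).1
    refine ⟨norm_pos_iff.2 fun h => hfc ?_, by rw [← dist_eq_norm, dist_comm]; exact h1⟩
    rw [sub_eq_zero.1 h]; exact (hS ρ hρ).2
  have hhc : ‖f c‖ * (R / R₁) ^ S.card ≤ ‖h c‖ := by
    rw [hfl, hh]
    simp only [norm_mul, norm_prod]
    rw [mul_comm _ ‖l c‖, mul_assoc]
    refine mul_le_mul_of_nonneg_left ?_ (norm_nonneg _)
    rw [← Finset.prod_const, ← Finset.prod_mul_distrib]
    refine Finset.prod_le_prod (fun ρ _ => by positivity) fun ρ hρ => ?_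
    rw [hB]
    simp only [sub_self, mul_zero, sub_zero, norm_div, norm_pow, hnormR]
    rw [sq, mul_div_assoc, div_self hR.ne', mul_one, mul_div_assoc', div_le_iff₀ hR1]
    nlinarith [(hρc ρ hρ).2]
  have hfc0 : 0 < ‖f c‖ := norm_pos_iff.2 hfc
  have hratio : 1 < R / R₁ := (one_lt_div hR1).2 h1R
  have hhc' : ‖f c‖ ≤ ‖h c‖ := by
    refine le_trans ?_ hhc
    exact le_mul_of_one_le_right hfc0.le (one_le_pow₀ hratio.le)
  refine ⟨?_, fun hall hsimple s hs => ?_⟩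
  · have h1 : (R / R₁) ^ S.card ≤ Real.exp Λ :=
      le_of_mul_le_mul_left (hhc.trans (hmax c (Metric.mem_closedBall_self hR.le))) hfc0
    rw [← Real.log_pow]
    calc _ ≤ Real.log (Real.exp Λ) := Real.log_le_log (by positivity) h1
      _ = Λ := Real.log_exp _
  · have hB0 : ∀ ρ ∈ S, ∀ z ∈ Metric.closedBall c R₁, B ρ z ≠ 0 := by
      intro ρ hρ z hz h0
      rw [hB] at h0
      simp only [div_eq_zero_iff, hR0', or_false, sub_eq_zero] at h0
      have h1 : ‖(R : ℂ) ^ 2‖ = ‖ρ - c‖ * ‖z - c‖ := by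
        rw [h0, norm_mul, RCLike.norm_conj]
      rw [norm_pow, hnormR] at h1
      have h2 := (hρc ρ hρ).2
      rw [norm_sub_rev] at h2
      have h3 : ‖z - c‖ ≤ R₁ := by simpa [dist_eq_norm] using hz
      nlinarith [norm_nonneg (z - c), norm_nonneg (ρ - c)]
    have hh0 : ∀ z ∈ Metric.ball c R₁, h z ≠ 0 := by
      intro z hz
      have hz' := Metric.ball_subset_closedBall hz
      refine mul_ne_zero (fun hl0 => ?_) (Finset.prod_ne_zero_iff.2 fun ρ hρ => hB0 ρ hρ z hz')
      have hzS : z ∈ S := hall z hz' (by rw [hfl, hl0, mul_zero])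
      exact hsimple z hzS (by
        rw [deriv_prod_sub_mul hzS hl.differentiableAt hfl, hl0, mul_zero])
    have hlow := norm_ge_of_forall_ne_zero h01 hR0 hΛ hhd.differentiableOn hh0 (fun z hz =>
      (hmax z (Metric.ball_subset_closedBall.trans
        (Metric.closedBall_subset_closedBall h1R.le) hz)).trans
        (mul_le_mul_of_nonneg_right hhc' (Real.exp_pos _).le)) hs
    have hs1 : s ∈ Metric.closedBall c R₁ := Metric.closedBall_subset_closedBall h01.le hs
    have hlow' : ‖f c‖ * Real.exp (-(2 * R₀ / (R₁ - R₀) * Λ)) ≤ ‖h s‖ :=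
      (mul_le_mul_of_nonneg_right hhc' (Real.exp_pos _).le).trans hlow
    have hfs : ‖h s‖ * ∏ ρ ∈ S, (‖s - ρ‖ / (2 * R)) ≤ ‖f s‖ := by
      rw [hfl s, hh]
      simp only [norm_mul, norm_prod]
      rw [mul_assoc, mul_comm (∏ ρ ∈ S, ‖s - ρ‖)]
      refine mul_le_mul_of_nonneg_left ?_ (norm_nonneg _)
      rw [← Finset.prod_mul_distrib]
      refine Finset.prod_le_prod (fun ρ _ => by positivity) fun ρ hρ => ?_
      have hBle : ‖B ρ s‖ ≤ 2 * R := by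
        rw [hB]
        simp only [norm_div, hnormR]
        rw [div_le_iff₀ hR]
        refine (norm_sub_le _ _).trans ?_
        rw [norm_mul, RCLike.norm_conj, norm_pow, hnormR]
        have h2 := (hρc ρ hρ).2
        rw [norm_sub_rev] at h2
        have h3 : ‖s - c‖ ≤ R₁ := by simpa [dist_eq_norm] using hs1
        nlinarith [norm_nonneg (s - c), norm_nonneg (ρ - c)]
      calc ‖B ρ s‖ * (‖s - ρ‖ / (2 * R)) ≤ (2 * R) * (‖s - ρ‖ / (2 * R)) := by gcongr
        _ = ‖s - ρ‖ := by field_simp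
    refine le_trans ?_ hfs
    exact mul_le_mul_of_nonneg_right hlow' (Finset.prod_nonneg fun ρ _ => by positivity)

section EntireL

variable {q : ℕ} [NeZero q]

open DirichletCharacter in
/-- The Dirichlet `L`-function with its possible pole at `1` removed. -/
noncomputable def entireL (χ : DirichletCharacter ℂ q) : ℂ → ℂ :=
  open Classical in if χ = 1 then LFunctionTrivChar₁ q else LFunction χ

/-- The order of the pole at `1`. -/
noncomputable def poleOrder (χ : DirichletCharacter ℂ q) : ℕ :=
  open Classical in if χ = 1 then 1 else 0

theorem poleOrder_le (χ : DirichletCharacter ℂ q) : poleOrder χ ≤ 1 := by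
  unfold poleOrder; split_ifs <;> simp

theorem differentiable_entireL (χ : DirichletCharacter ℂ q) : Differentiable ℂ (entireL χ) := by
  unfold entireL
  split_ifs with h
  · exact DirichletCharacter.differentiable_LFunctionTrivChar₁ q
  · exact DirichletCharacter.differentiable_LFunction h

theorem entireL_eq (χ : DirichletCharacter ℂ q) {s : ℂ} (hs : s ≠ 1) :
    entireL χ s = (s - 1) ^ poleOrder χ * DirichletCharacter.LFunction χ s := by
  unfold entireL poleOrder
  split_ifs with h
  · simp [h, DirichletCharacter.LFunctionTrivChar₁, Function.update_of_ne hs]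
  · simp

theorem entireL_ne_zero (χ : DirichletCharacter ℂ q) {s : ℂ} (hs : 1 ≤ s.re) :
    entireL χ s ≠ 0 := by
  by_cases h1 : s = 1
  · unfold entireL
    split_ifs with h
    · rw [h1]; exact DirichletCharacter.LFunctionTrivChar₁_apply_one_ne_zero q
    · rw [h1]; exact DirichletCharacter.LFunction_apply_one_ne_zero h
  · rw [entireL_eq χ h1]
    exact mul_ne_zero (pow_ne_zero _ (sub_ne_zero.2 h1))
      (DirichletCharacter.LFunction_ne_zero_of_one_le_re χ (Or.inr h1) hs)

theorem entireL_eq_zero_iff (χ : DirichletCharacter ℂ q) {s : ℂ} (hs : s ≠ 1) :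
    entireL χ s = 0 ↔ DirichletCharacter.LFunction χ s = 0 := by
  rw [entireL_eq χ hs]
  simp [sub_ne_zero.2 hs]

theorem deriv_entireL (χ : DirichletCharacter ℂ q) {s : ℂ} (hs : s ≠ 1)
    (h0 : DirichletCharacter.LFunction χ s = 0) :
    deriv (entireL χ) s =
      (s - 1) ^ poleOrder χ * deriv (DirichletCharacter.LFunction χ) s := by
  have h1 : entireL χ =ᶠ[𝓝 s]
      fun s => (s - 1) ^ poleOrder χ * DirichletCharacter.LFunction χ s := by
    filter_upwards [isOpen_ne.mem_nhds hs] with z hz using entireL_eq χ hz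
  have h2 := (DirichletCharacter.differentiableAt_LFunction χ s (Or.inl hs)).hasDerivAt
  have h3 : DifferentiableAt ℂ (fun s : ℂ => (s - 1) ^ poleOrder χ) s := by fun_prop
  have h4 := (h3.hasDerivAt.mul h2).deriv
  rw [h0, mul_zero, zero_add] at h4
  rw [h1.deriv_eq]
  exact h4

/-- The mean value of `χ` over a period. -/
noncomputable def charMean (χ : DirichletCharacter ℂ q) : ℂ :=
  (∑ i ∈ Finset.range q, χ (i : ZMod q)) / q

theorem charMean_eq_zero {χ : DirichletCharacter ℂ q} (h : χ ≠ 1) : charMean χ = 0 := by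
  have h1 := MulChar.sum_eq_zero_of_ne_one h
  unfold charMean
  rw [div_eq_zero_iff]; left
  rw [← h1]
  obtain ⟨n, rfl⟩ := Nat.exists_eq_succ_of_ne_zero (NeZero.ne q)
  rw [← Fin.sum_univ_eq_sum_range (fun i => χ (i : ZMod (n + 1)))]
  refine Finset.sum_congr rfl fun i _ => ?_
  congr 1
  exact ZMod.natCast_zmod_val (n := n + 1) i

theorem norm_charMean_le (χ : DirichletCharacter ℂ q) : ‖charMean χ‖ ≤ 1 := by
  have hq : (0 : ℝ) < q := by exact_mod_cast Nat.pos_of_ne_zero (NeZero.ne q)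
  unfold charMean
  rw [norm_div, Complex.norm_natCast, div_le_one hq]
  refine (norm_sum_le_of_le _ fun i _ => DirichletCharacter.norm_le_one χ _).trans ?_
  simp

/-- The remainder in the count of `χ`. -/
noncomputable def charRem (χ : DirichletCharacter ℂ q) (t : ℝ) : ℂ :=
  (∑ k ∈ Finset.Icc 1 ⌊t⌋₊, χ (k : ZMod q)) - charMean χ * t

theorem sum_Icc_sub_charMean_periodic (χ : DirichletCharacter ℂ q) :
    Function.Periodic (fun N : ℕ => (∑ k ∈ Finset.Icc 1 N, χ (k : ZMod q)) - charMean χ * N) q := by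
  have hper : ∀ N : ℕ, χ ((N + q : ℕ) : ZMod q) = χ (N : ZMod q) := by intro N; simp
  have hq : (q : ℂ) ≠ 0 := by exact_mod_cast NeZero.ne q
  have hsum : ∀ N : ℕ, ∑ i ∈ Finset.range q, χ ((N + i : ℕ) : ZMod q) = charMean χ * q := by
    intro N
    induction N with
    | zero => simp [charMean, hq]
    | succ N ih =>
      rw [← ih]
      have h1 := Finset.sum_range_succ (fun i => χ ((N + i : ℕ) : ZMod q)) q
      have h2 := Finset.sum_range_succ' (fun i => χ ((N + i : ℕ) : ZMod q)) q
      have h3 : ∀ i, N + 1 + i = N + (i + 1) := fun i => by ring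
      simp only [h3]
      rw [h1, hper] at h2
      simpa using h2.symm
  intro N
  have h1 : ∀ N : ℕ, ∑ k ∈ Finset.Icc 1 N, χ (k : ZMod q) =
      ∑ i ∈ Finset.range N, χ ((1 + i : ℕ) : ZMod q) := by
    intro N
    rw [Finset.range_eq_Ico, Finset.sum_Ico_eq_sum_range, Nat.sub_zero]
    induction N with
    | zero => simp
    | succ N ih =>
      rw [Finset.sum_Icc_succ_top (by simp), Finset.sum_range_succ, ih]
      simp [add_comm]
  simp only [h1, Finset.sum_range_add]
  have h2 := hsum (1 + N)
  simp only [← add_assoc] at h2 ⊢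
  rw [h2]; push_cast; ring

theorem norm_charRem_le (χ : DirichletCharacter ℂ q) {t : ℝ} (ht : 0 ≤ t) :
    ‖charRem χ t‖ ≤ 3 * q := by
  have hq : 0 < q := Nat.pos_of_ne_zero (NeZero.ne q)
  have hq1 : (1 : ℝ) ≤ q := by exact_mod_cast hq
  have h1 := (sum_Icc_sub_charMean_periodic χ).map_mod_nat ⌊t⌋₊
  set m := ⌊t⌋₊ % q with hm
  have hmq : m < q := Nat.mod_lt _ hq
  have hmq' : (m : ℝ) ≤ q := by exact_mod_cast hmq.le
  have h2 : charRem χ t = ((∑ k ∈ Finset.Icc 1 m, χ (k : ZMod q)) - charMean χ * m)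
      - charMean χ * ((t - ⌊t⌋₊ : ℝ) : ℂ) := by
    rw [h1, charRem]; push_cast; ring
  have hf : |t - ⌊t⌋₊| ≤ 1 := by
    rw [abs_le]; constructor <;> linarith [Nat.floor_le ht, Nat.lt_floor_add_one t]
  have h3 : ‖∑ k ∈ Finset.Icc 1 m, χ (k : ZMod q)‖ ≤ m := by
    refine (norm_sum_le_of_le _ fun i _ => DirichletCharacter.norm_le_one χ _).trans ?_
    simp
  have hκ := norm_charMean_le χ
  have h4 : ‖charMean χ * m‖ ≤ m := by
    rw [norm_mul, Complex.norm_natCast]; nlinarith [Nat.cast_nonneg (α := ℝ) m]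
  have h5 : ‖charMean χ * ((t - ⌊t⌋₊ : ℝ) : ℂ)‖ ≤ 1 := by
    rw [norm_mul, Complex.norm_real, Real.norm_eq_abs]
    nlinarith [norm_nonneg (charMean χ), abs_nonneg (t - ⌊t⌋₊)]
  rw [h2]
  linarith [norm_sub_le ((∑ k ∈ Finset.Icc 1 m, χ (k : ZMod q)) - charMean χ * m)
    (charMean χ * ((t - ⌊t⌋₊ : ℝ) : ℂ)),
    norm_sub_le (∑ k ∈ Finset.Icc 1 m, χ (k : ZMod q)) (charMean χ * m)]

theorem measurable_charRem (χ : DirichletCharacter ℂ q) : Measurable (charRem χ) := by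
  unfold charRem
  refine Measurable.sub ?_ (by fun_prop)
  exact (measurable_from_nat (f := fun n => ∑ k ∈ Finset.Icc 1 n, χ (k : ZMod q))).comp
    Nat.measurable_floor

/-- The Mellin-type transform of the remainder. -/
noncomputable def charRemInt (χ : DirichletCharacter ℂ q) (s : ℂ) : ℂ :=
  ∫ t in Set.Ioi (1 : ℝ), charRem χ t * (t : ℂ) ^ (-(s + 1))

theorem norm_charRem_mul_le (χ : DirichletCharacter ℂ q) (s : ℂ) {t : ℝ} (ht : 1 < t) :
    ‖charRem χ t * (t : ℂ) ^ (-(s + 1))‖ ≤ 3 * q * t ^ (-(s.re + 1)) := by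
  have ht0 : 0 < t := by linarith
  rw [norm_mul, Complex.norm_cpow_eq_rpow_re_of_pos ht0]
  simp only [Complex.neg_re, Complex.add_re, Complex.one_re]
  gcongr
  exact norm_charRem_le χ ht0.le

theorem norm_charRemInt_le (χ : DirichletCharacter ℂ q) {s : ℂ} (hs : 0 < s.re) :
    ‖charRemInt χ s‖ ≤ 3 * q / s.re := by
  have h1 : ∀ᵐ t ∂(volume.restrict (Set.Ioi (1 : ℝ))),
      ‖charRem χ t * (t : ℂ) ^ (-(s + 1))‖ ≤ 3 * q * t ^ (-(s.re + 1)) := by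
    filter_upwards [ae_restrict_mem measurableSet_Ioi] with t ht using norm_charRem_mul_le χ s ht
  have h2 : IntegrableOn (fun t : ℝ => 3 * q * t ^ (-(s.re + 1))) (Set.Ioi 1) :=
    (integrableOn_Ioi_rpow_of_lt (by linarith) one_pos).const_mul _
  refine (norm_integral_le_of_norm_le h2 h1).trans (le_of_eq ?_)
  rw [integral_const_mul, integral_Ioi_rpow_of_lt (by linarith) one_pos]
  have : s.re ≠ 0 := hs.ne'
  simp
  field_simp

theorem integrableOn_charRem_mul (χ : DirichletCharacter ℂ q) {s : ℂ} (hs : 0 < s.re) :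
    IntegrableOn (fun t : ℝ => charRem χ t * (t : ℂ) ^ (-(s + 1))) (Set.Ioi 1) := by
  have h2 : IntegrableOn (fun t : ℝ => 3 * q * t ^ (-(s.re + 1))) (Set.Ioi 1) :=
    (integrableOn_Ioi_rpow_of_lt (by linarith) one_pos).const_mul _
  refine Integrable.mono' h2 ?_ ?_
  · exact ((measurable_charRem χ).mul (by fun_prop)).aestronglyMeasurable
  · filter_upwards [ae_restrict_mem measurableSet_Ioi] with t ht using norm_charRem_mul_le χ s ht

theorem differentiableAt_charRemInt (χ : DirichletCharacter ℂ q) {s : ℂ} (hs : 0 < s.re) :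
    DifferentiableAt ℂ (charRemInt χ) s := by
  set f : ℝ → ℂ := Set.indicator (Set.Ioi 1) (charRem χ) with hf
  have hfm : Measurable f := (measurable_charRem χ).indicator measurableSet_Ioi
  have hfb : ∀ t, ‖f t‖ ≤ 3 * q := by
    intro t
    rw [hf, Set.indicator_apply]
    split_ifs with h
    · exact norm_charRem_le χ (by have : (1 : ℝ) < t := h; linarith)
    · simp
  have hloc : LocallyIntegrableOn f (Set.Ioi 0) := by
    refine LocallyIntegrable.locallyIntegrableOn ?_ _
    refine (locallyIntegrable_const (3 * q : ℝ)).mono hfm.aestronglyMeasurable ?_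
    filter_upwards with t
    rw [Real.norm_of_nonneg (by positivity)]
    exact hfb t
  have heq : charRemInt χ = fun s => mellin f (-s) := by
    ext z
    rw [mellin, charRemInt, ← integral_indicator measurableSet_Ioi,
      ← integral_indicator measurableSet_Ioi]
    congr 1
    ext t
    simp only [hf, Set.indicator_apply, Set.mem_Ioi]
    split_ifs with h1 h2 h2
    · rw [smul_eq_mul, mul_comm]; congr 2; ring
    · linarith
    · simp
    · rfl
  rw [heq]
  have hm : DifferentiableAt ℂ (mellin f) (-s) := by
    refine mellin_differentiableAt_of_isBigO_rpow (a := 0) (b := (-s).re - 1) hloc ?_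
      (by simpa using hs) ?_ (by linarith)
    · refine Asymptotics.IsBigO.of_bound (3 * q) ?_
      filter_upwards with t
      simpa using hfb t
    · have : f =ᶠ[𝓝[>] 0] fun _ => (0 : ℂ) := by
        have : Set.Iio (1 : ℝ) ∈ 𝓝[>] (0 : ℝ) :=
          mem_nhdsWithin_of_mem_nhds (Iio_mem_nhds one_pos)
        filter_upwards [this] with t ht
        rw [hf, Set.indicator_of_notMem]
        simpa using ht.le
      exact this.trans_isBigO (Asymptotics.isBigO_zero _ _)
  exact hm.comp s differentiableAt_id.neg

theorem LFunction_eq_charRemInt (χ : DirichletCharacter ℂ q) {s : ℂ} (hs : 1 < s.re) :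
    (s - 1) * DirichletCharacter.LFunction χ s =
      (s - 1) * s * charRemInt χ s + charMean χ * s := by
  rw [DirichletCharacter.LFunction_eq_LSeries χ hs]
  have h1 := LSeries_eq_mul_integral' (fun n => χ (n : ZMod q)) (r := 1) zero_le_one hs (by
    refine Asymptotics.IsBigO.of_bound 1 ?_
    filter_upwards with n
    rw [Real.rpow_one, Real.norm_of_nonneg (Finset.sum_nonneg fun _ _ => norm_nonneg _), one_mul]
    refine (Finset.sum_le_sum fun i _ => DirichletCharacter.norm_le_one χ _).trans ?_
    simp)
  have hs1 : s - 1 ≠ 0 := fun h => by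
    rw [sub_eq_zero] at h; rw [h] at hs; simp at hs
  have h2 : ∫ t in Set.Ioi (1 : ℝ), (∑ k ∈ Finset.Icc 1 ⌊t⌋₊, χ (k : ZMod q)) *
      (t : ℂ) ^ (-(s + 1)) = charRemInt χ s + charMean χ * (1 / (s - 1)) := by
    have h3 : IntegrableOn (fun t : ℝ => (t : ℂ) ^ (-s)) (Set.Ioi 1) :=
      integrableOn_Ioi_cpow_of_lt (by simpa using hs) one_pos
    have h4 : ∫ t in Set.Ioi (1 : ℝ), (t : ℂ) ^ (-s) = 1 / (s - 1) := by
      rw [integral_Ioi_cpow_of_lt (by simpa using hs) one_pos]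
      have : -s + 1 ≠ 0 := fun h => hs1 (by linear_combination -h)
      simp
      rw [show -s + 1 = -(s - 1) by ring, div_neg, neg_div, neg_neg, one_div]
    rw [charRemInt, ← h4, ← integral_const_mul, ← integral_add
      (integrableOn_charRem_mul χ (by linarith)) (h3.const_mul _)]
    refine setIntegral_congr_fun measurableSet_Ioi fun t ht => ?_
    have ht0 : (t : ℂ) ≠ 0 := by
      have : (1 : ℝ) < t := ht
      exact_mod_cast (by linarith : t ≠ 0)
    have h5 : (t : ℂ) ^ (-s) = t * (t : ℂ) ^ (-(s + 1)) := by
      rw [show -s = 1 + -(s + 1) by ring, Complex.cpow_add _ _ ht0, Complex.cpow_one]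
    simp only [charRem]
    rw [h5]; ring
  rw [h1, h2]
  field_simp

theorem entireL_eq_charRemInt (χ : DirichletCharacter ℂ q) {s : ℂ} (hs : 0 < s.re) :
    entireL χ s = (s - 1) ^ poleOrder χ * s * charRemInt χ s + charMean χ * s := by
  have hopen : IsOpen {s : ℂ | 0 < s.re} := isOpen_lt continuous_const Complex.continuous_re
  have hd : DifferentiableOn ℂ (fun s => (s - 1) ^ poleOrder χ * s * charRemInt χ s +
      charMean χ * s) {s : ℂ | 0 < s.re} := by
    intro z hz
    have := differentiableAt_charRemInt χ hz
    apply DifferentiableAt.differentiableWithinAt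
    fun_prop
  have hpre : IsPreconnected {s : ℂ | 0 < s.re} :=
    (convex_halfSpace_re_gt 0).isPreconnected
  refine AnalyticOnNhd.eqOn_of_preconnected_of_eventuallyEq (z₀ := 2)
    ((differentiable_entireL χ).differentiableOn.analyticOnNhd hopen)
    (hd.analyticOnNhd hopen) hpre (by simp) ?_ hs
  have h2 : {s : ℂ | 1 < s.re} ∈ 𝓝 (2 : ℂ) :=
    (isOpen_lt continuous_const Complex.continuous_re).mem_nhds (by simp)
  filter_upwards [h2] with z hz
  have hz' : 1 < z.re := hz
  have hz1 : z ≠ 1 := fun h => by rw [h] at hz'; simp at hz'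
  have h3 := LFunction_eq_charRemInt χ hz'
  rw [entireL_eq χ hz1]
  by_cases h : χ = 1
  · simpa [poleOrder, h] using h3
  · rw [charMean_eq_zero h] at h3 ⊢
    simp only [poleOrder, h, if_false, pow_zero, one_mul, zero_mul, add_zero] at h3 ⊢
    exact mul_left_cancel₀ (sub_ne_zero.2 hz1) (by rw [h3]; ring)

theorem norm_entireL_le (χ : DirichletCharacter ℂ q) {δ : ℝ} (hδ : 0 < δ) {s : ℂ}
    (hs : δ ≤ s.re) : ‖entireL χ s‖ ≤ (3 * q / δ + 1) * (1 + ‖s‖) ^ 2 := by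
  rw [entireL_eq_charRemInt χ (hδ.trans_le hs)]
  have h1 : ‖charRemInt χ s‖ ≤ 3 * q / δ :=
    (norm_charRemInt_le χ (hδ.trans_le hs)).trans (by gcongr)
  have h2 : ‖(s - 1) ^ poleOrder χ‖ ≤ 1 + ‖s‖ := by
    have : ‖s - 1‖ ≤ 1 + ‖s‖ := by
      have := norm_sub_le s 1
      simp at this; linarith
    unfold poleOrder; split_ifs
    · simpa using this
    · simp
  have h3 := norm_charMean_le χ
  have hn := norm_nonneg s
  calc _ ≤ ‖(s - 1) ^ poleOrder χ‖ * ‖s‖ * ‖charRemInt χ s‖ + ‖charMean χ‖ * ‖s‖ := by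
        refine (norm_add_le _ _).trans ?_
        simp only [norm_mul, le_refl]
    _ ≤ (1 + ‖s‖) * (1 + ‖s‖) * (3 * q / δ) + 1 * (1 + ‖s‖) ^ 2 := by
        gcongr
        · linarith
        · nlinarith
    _ = _ := by ring

end EntireL

section ZeroCounting

variable {q : ℕ} [NeZero q]

theorem exists_norm_LSeries_moebius_le {σ : ℝ} (hσ : 1 < σ) : ∃ Z : ℝ, 0 < Z ∧
    ∀ (χ : DirichletCharacter ℂ q) (s : ℂ), σ ≤ s.re →
      ‖LSeries ((fun n : ℕ => χ (n : ZMod q)) * fun n : ℕ =>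
        ((ArithmeticFunction.moebius n : ℤ) : ℂ)) s‖ ≤ Z := by
  have hsum : LSeriesSummable (1 : ℕ → ℂ) (σ : ℂ) :=
    LSeriesSummable_one_iff.2 (by simpa using hσ)
  refine ⟨(∑' n, ‖LSeries.term (1 : ℕ → ℂ) (σ : ℂ) n‖) + 1,
    add_pos_of_nonneg_of_pos (tsum_nonneg fun _ => norm_nonneg _) one_pos, fun χ s hs => ?_⟩
  have hb : ∀ n, ‖LSeries.term ((fun n : ℕ => χ (n : ZMod q)) * fun n : ℕ =>
        ((ArithmeticFunction.moebius n : ℤ) : ℂ)) s n‖ ≤ ‖LSeries.term (1 : ℕ → ℂ) (σ : ℂ) n‖ := by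
    intro n
    refine (LSeries.norm_term_le (g := 1) s ?_).trans
      (LSeries.norm_term_le_of_re_le_re _ (by simpa using hs) n)
    simp only [Pi.mul_apply, norm_mul, Pi.one_apply, norm_one]
    have h1 := DirichletCharacter.norm_le_one χ (n : ZMod q)
    have h2 : ‖((ArithmeticFunction.moebius n : ℤ) : ℂ)‖ ≤ 1 := by
      rw [Complex.norm_intCast]; exact_mod_cast ArithmeticFunction.abs_moebius_le_one
    nlinarith [norm_nonneg (χ (n : ZMod q)), norm_nonneg ((ArithmeticFunction.moebius n : ℤ) : ℂ)]
  have h := tsum_of_norm_bounded hsum.norm.hasSum hb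
  unfold LSeries
  linarith

theorem exists_norm_LFunction_ge {σ : ℝ} (hσ : 1 < σ) : ∃ c : ℝ, 0 < c ∧
    ∀ (χ : DirichletCharacter ℂ q) (s : ℂ), σ ≤ s.re →
      c ≤ ‖DirichletCharacter.LFunction χ s‖ ∧ c ≤ ‖entireL χ s‖ := by
  obtain ⟨Z, hZ, hle⟩ := exists_norm_LSeries_moebius_le (q := q) hσ
  refine ⟨min (1 / Z) ((σ - 1) * (1 / Z)), by
    have : 0 < σ - 1 := by linarith
    positivity, fun χ s hs => ?_⟩
  have hs1 : 1 < s.re := hσ.trans_le hs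
  have h1 := DirichletCharacter.LSeries.mul_mu_eq_one χ hs1
  rw [← DirichletCharacter.LFunction_eq_LSeries χ hs1] at h1
  have h2 : 1 / Z ≤ ‖DirichletCharacter.LFunction χ s‖ := by
    rw [div_le_iff₀ hZ]
    calc (1 : ℝ) = ‖DirichletCharacter.LFunction χ s * _‖ := by rw [h1, norm_one]
      _ ≤ _ := by
        rw [norm_mul]
        exact mul_le_mul_of_nonneg_left (hle χ s hs) (norm_nonneg _)
  have hne : s ≠ 1 := fun h => by rw [h] at hs1; simp at hs1
  refine ⟨(min_le_left _ _).trans h2, ?_⟩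
  rw [entireL_eq χ hne, norm_mul]
  unfold poleOrder
  have h3 : σ - 1 ≤ ‖s - 1‖ := by
    refine le_trans ?_ (Complex.re_le_norm (s - 1))
    simpa using hs
  split_ifs
  · rw [pow_one]
    refine (min_le_right _ _).trans ?_
    gcongr
  · rw [pow_zero, norm_one, one_mul]
    exact (min_le_left _ _).trans h2

/-- The nontrivial zeros. -/
def stripZeros (χ : DirichletCharacter ℂ q) : Set ℂ :=
  {ρ | DirichletCharacter.LFunction χ ρ = 0 ∧ 0 < ρ.re ∧ ρ.re < 1}

theorem entireL_eq_zero_iff_mem (χ : DirichletCharacter ℂ q) {s : ℂ} (hs : 0 < s.re) :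
    entireL χ s = 0 ↔ s ∈ stripZeros χ := by
  constructor
  · intro h
    have h1 : s.re < 1 := by
      by_contra! h1
      exact entireL_ne_zero χ h1 h
    have hne : s ≠ 1 := fun h => by rw [h] at h1; simp at h1
    exact ⟨(entireL_eq_zero_iff χ hne).1 h, hs, h1⟩
  · intro h
    have h1 := h.2.2
    have hne : s ≠ 1 := fun h => by rw [h] at h1; simp at h1
    exact (entireL_eq_zero_iff χ hne).2 h.1

/-- All nontrivial zeros are simple, nonreal and lie on the critical line. -/
structure GoodZeros (χ : DirichletCharacter ℂ q) : Prop where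
  re_eq : ∀ ρ ∈ stripZeros χ, ρ.re = 1 / 2
  im_ne : ∀ ρ ∈ stripZeros χ, ρ.im ≠ 0
  simple : ∀ ρ ∈ stripZeros χ, deriv (DirichletCharacter.LFunction χ) ρ ≠ 0

theorem GoodZeros.deriv_entireL_ne {χ : DirichletCharacter ℂ q} (h : GoodZeros χ) {ρ : ℂ}
    (hρ : ρ ∈ stripZeros χ) : deriv (entireL χ) ρ ≠ 0 := by
  have h1 := hρ.2.2
  have hne : ρ ≠ 1 := fun h => by rw [h] at h1; simp at h1
  rw [deriv_entireL χ hne hρ.1]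
  exact mul_ne_zero (pow_ne_zero _ (sub_ne_zero.2 hne)) (h.simple ρ hρ)

/-- The centre of the discs used for zero counting. -/
noncomputable def discCentre (u : ℝ) : ℂ := 2 + u * Complex.I

theorem exists_disc_growth {δ : ℝ} (hδ : 0 < δ) :
    ∃ A : ℝ, 0 < A ∧ ∀ (χ : DirichletCharacter ℂ q) (u : ℝ),
      ∀ z ∈ Metric.closedBall (discCentre u) (2 - δ),
        ‖entireL χ z‖ ≤ ‖entireL χ (discCentre u)‖ * Real.exp (A * Real.log (5 + |u|)) := by
  obtain ⟨c, hc, hcle⟩ := exists_norm_LFunction_ge (q := q) (σ := 2) one_lt_two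
  set K : ℝ := (3 * q / δ + 1) / c with hK
  have hK0 : 0 < K := by positivity
  refine ⟨|Real.log K| + 2, by positivity, fun χ u z hz => ?_⟩
  have hz' : ‖z - discCentre u‖ ≤ 2 - δ := by simpa [dist_eq_norm] using hz
  have hre : δ ≤ z.re := by
    have h1 := (Complex.abs_re_le_norm (z - discCentre u)).trans hz'
    have h2 := (abs_le.1 h1).1
    simp [discCentre] at h2
    linarith
  have hnorm : 1 + ‖z‖ ≤ 5 + |u| := by
    have h1 : ‖z‖ ≤ ‖z - discCentre u‖ + ‖discCentre u‖ := by
      simpa using norm_add_le (z - discCentre u) (discCentre u)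
    have h2 : ‖discCentre u‖ ≤ 2 + |u| := by
      unfold discCentre
      refine (norm_add_le _ _).trans ?_
      simp
    linarith
  have hu : 1 ≤ Real.log (5 + |u|) := by
    rw [Real.le_log_iff_exp_le (by positivity)]
    linarith [Real.exp_one_lt_d9, abs_nonneg u]
  have h5 : (0 : ℝ) < 5 + |u| := by positivity
  have hexp : K * (5 + |u|) ^ 2 ≤ Real.exp ((|Real.log K| + 2) * Real.log (5 + |u|)) := by
    rw [add_mul, Real.exp_add]
    refine mul_le_mul ?_ (le_of_eq ?_) (by positivity) (Real.exp_pos _).le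
    · calc K = Real.exp (Real.log K) := (Real.exp_log hK0).symm
        _ ≤ _ := Real.exp_le_exp.2 ((le_abs_self _).trans
            (le_mul_of_one_le_right (abs_nonneg _) hu))
    · rw [mul_comm, Real.exp_mul, Real.exp_log h5]; norm_cast
  calc ‖entireL χ z‖ ≤ (3 * q / δ + 1) * (1 + ‖z‖) ^ 2 := norm_entireL_le χ hδ hre
    _ ≤ (3 * q / δ + 1) * (5 + |u|) ^ 2 := by gcongr
    _ = c * (K * (5 + |u|) ^ 2) := by rw [hK]; field_simp
    _ ≤ ‖entireL χ (discCentre u)‖ * Real.exp ((|Real.log K| + 2) * Real.log (5 + |u|)) := by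
      gcongr
      exact (hcle χ _ (by simp [discCentre])).2

theorem one_le_log_five_add (u : ℝ) : 1 ≤ Real.log (5 + |u|) := by
  rw [Real.le_log_iff_exp_le (by positivity)]
  linarith [Real.exp_one_lt_d9, abs_nonneg u]

theorem exists_finset_zeros_near : ∃ A : ℝ, 0 < A ∧ ∀ (χ : DirichletCharacter ℂ q) (u : ℝ),
    ∃ S : Finset ℂ, (∀ ρ, ρ ∈ S ↔ ρ ∈ Metric.closedBall (discCentre u) (2 - 1 / 3000) ∧
      entireL χ ρ = 0) ∧ (S.card : ℝ) ≤ A * Real.log (5 + |u|) := by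
  obtain ⟨A, hA, hle⟩ := exists_disc_growth (q := q) (δ := 1 / 4000) (by norm_num)
  have hL : 0 < Real.log ((2 - 1 / 4000) / (2 - 1 / 3000)) := Real.log_pos (by norm_num)
  refine ⟨A / Real.log ((2 - 1 / 4000) / (2 - 1 / 3000)), by positivity, fun χ u => ?_⟩
  have hu := one_le_log_five_add u
  have key : ∀ S : Finset ℂ, (∀ ρ ∈ S, ρ ∈ Metric.closedBall (discCentre u) (2 - 1 / 3000) ∧
      entireL χ ρ = 0) →
      (S.card : ℝ) ≤ A / Real.log ((2 - 1 / 4000) / (2 - 1 / 3000)) * Real.log (5 + |u|) := by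
    intro S hS
    have h := (disc_estimate (differentiable_entireL χ) (c := discCentre u) (R₀ := 2 - 1 / 2000)
      (R₁ := 2 - 1 / 3000) (R := 2 - 1 / 4000) (Λ := A * Real.log (5 + |u|))
      (by norm_num) (by norm_num) (by norm_num) (by positivity)
      (entireL_ne_zero χ (by simp [discCentre])) (hle χ u) hS).1
    rw [div_mul_eq_mul_div, le_div_iff₀ hL]
    exact h
  have hfin : {ρ | ρ ∈ Metric.closedBall (discCentre u) (2 - 1 / 3000) ∧
      entireL χ ρ = 0}.Finite := by
    by_contra hinf
    obtain ⟨n, hn⟩ := exists_nat_gt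
      (A / Real.log ((2 - 1 / 4000) / (2 - 1 / 3000)) * Real.log (5 + |u|))
    obtain ⟨S, hS, hcard⟩ := Set.Infinite.exists_subset_card_eq hinf n
    have := key S fun ρ hρ => hS hρ
    rw [hcard] at this
    linarith
  refine ⟨hfin.toFinset, by simp, key _ (by simp)⟩

theorem closedBall_discCentre_re_pos {u : ℝ} {z : ℂ}
    (hz : z ∈ Metric.closedBall (discCentre u) (2 - 1 / 3000)) : 0 < z.re := by
  have hz' : ‖z - discCentre u‖ ≤ 2 - 1 / 3000 := by simpa [dist_eq_norm] using hz
  have h1 := (Complex.abs_re_le_norm (z - discCentre u)).trans hz'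
  have h2 := (abs_le.1 h1).1
  simp [discCentre] at h2
  linarith

theorem mem_closedBall_discCentre {u r : ℝ} {z : ℂ} (hr : 0 ≤ r)
    (h : (z.re - 2) ^ 2 + (z.im - u) ^ 2 ≤ r ^ 2) : z ∈ Metric.closedBall (discCentre u) r := by
  rw [Metric.mem_closedBall, dist_eq_norm, Complex.norm_def]
  refine Real.sqrt_le_iff.2 ⟨hr, ?_⟩
  simp only [Complex.normSq_apply, discCentre]
  simp
  nlinarith

/-- The number of zeros with ordinate within `1/2` of `u` is `O(log |u|)`. -/
theorem exists_card_zeros_le : ∃ A : ℝ, 0 < A ∧ ∀ (χ : DirichletCharacter ℂ q), GoodZeros χ →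
    ∀ (u : ℝ) (S : Finset ℂ), (∀ ρ ∈ S, ρ ∈ stripZeros χ ∧ |ρ.im - u| ≤ 1 / 2) →
    (S.card : ℝ) ≤ A * Real.log (5 + |u|) := by
  obtain ⟨A, hA, h⟩ := exists_finset_zeros_near (q := q)
  refine ⟨A, hA, fun χ hχ u S hS => ?_⟩
  obtain ⟨S', hS', hcard⟩ := h χ u
  refine le_trans ?_ hcard
  refine Nat.cast_le.2 (Finset.card_le_card fun ρ hρ => ?_)
  obtain ⟨h1, h2⟩ := hS ρ hρ
  rw [hS']
  refine ⟨mem_closedBall_discCentre (by norm_num) ?_, (entireL_eq_zero_iff_mem χ h1.2.1).2 h1⟩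
  rw [hχ.re_eq ρ h1]
  have := abs_le.1 h2
  nlinarith

theorem GoodZeros.finite_zeros {χ : DirichletCharacter ℂ q} (hχ : GoodZeros χ) (T : ℝ) :
    {ρ | ρ ∈ stripZeros χ ∧ |ρ.im| ≤ T}.Finite := by
  obtain ⟨A, hA, h⟩ := exists_finset_zeros_near (q := q)
  choose S hS _ using h χ
  refine (((Finset.Icc (-⌈T⌉ - 1) (⌈T⌉ + 1)).biUnion fun n : ℤ => S n).finite_toSet).subset ?_
  rintro ρ ⟨h1, h2⟩
  simp only [Finset.coe_biUnion, Set.mem_iUnion, Finset.mem_coe, Finset.mem_Icc]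
  have h3 := abs_le.1 h2
  refine ⟨⌊ρ.im⌋, ⟨?_, ?_⟩, (hS _ ρ).2
    ⟨mem_closedBall_discCentre (by norm_num) ?_, (entireL_eq_zero_iff_mem χ h1.2.1).2 h1⟩⟩
  · have := Int.le_ceil T
    rw [Int.le_floor]; push_cast; linarith
  · have := Int.le_ceil T
    have h4 := Int.floor_le ρ.im
    have : (⌊ρ.im⌋ : ℝ) ≤ ⌈T⌉ + 1 := by linarith
    exact_mod_cast this
  · rw [hχ.re_eq ρ h1]
    have h4 := Int.floor_le ρ.im
    have h5 := Int.lt_floor_add_one ρ.im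
    nlinarith

theorem exists_mem_Icc_forall_le_abs_sub (S : Finset ℝ) (u : ℝ) {w d : ℝ} (hd : 0 < d)
    (hw : 2 * d * S.card < w) : ∃ T ∈ Set.Icc u (u + w), ∀ γ ∈ S, d ≤ |T - γ| := by
  by_contra! hcon
  have hsub : Set.Icc u (u + w) ⊆ ⋃ γ ∈ S, Metric.ball γ d := by
    intro T hT
    obtain ⟨γ, hγ, h⟩ := hcon T hT
    simp only [Set.mem_iUnion]
    exact ⟨γ, hγ, by simpa [Real.dist_eq] using h⟩
  have h1 := (measure_mono (μ := volume) hsub).trans (measure_biUnion_finset_le S _)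
  simp only [Real.volume_Icc, Real.volume_ball, Finset.sum_const, nsmul_eq_mul] at h1
  rw [← ENNReal.ofReal_natCast, ← ENNReal.ofReal_mul (Nat.cast_nonneg _),
    ENNReal.ofReal_le_ofReal_iff (by positivity)] at h1
  nlinarith

/-- Heights at which `1/L` has a (weak) upper bound. -/
theorem exists_good_height : ∃ B : ℝ, 0 < B ∧ ∀ (χ : DirichletCharacter ℂ q), GoodZeros χ →
    ∀ u : ℝ, ∃ T ∈ Set.Icc u (u + 1), ∀ σ ∈ Set.Icc (1 / 1000 : ℝ) 2,
      Real.exp (-(B * (5 + |u|))) ≤ ‖entireL χ (σ + T * Complex.I)‖ := by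
  obtain ⟨A, hA, hle⟩ := exists_disc_growth (q := q) (δ := 1 / 4000) (by norm_num)
  obtain ⟨A', hA', hS⟩ := exists_finset_zeros_near (q := q)
  obtain ⟨c, hc, hcle⟩ := exists_norm_LFunction_ge (q := q) (σ := 2) one_lt_two
  set K : ℝ := 2 * (2 - 1 / 2000) / ((2 - 1 / 3000) - (2 - 1 / 2000)) with hK
  have hK0 : 0 < K := by rw [hK]; norm_num
  refine ⟨|Real.log c| + K * A + 4 * (1600 * A' * (A' + 1)), by positivity, fun χ hχ u => ?_⟩
  obtain ⟨S, hSm, hcard⟩ := hS χ u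
  set ℓ := Real.log (5 + |u|) with hℓ
  have hℓ1 : 1 ≤ ℓ := one_le_log_five_add u
  have h5 : (0 : ℝ) < 5 + |u| := by positivity
  have hℓ2 : ℓ ≤ 5 + |u| := (Real.log_le_sub_one_of_pos h5).trans (by linarith)
  have hℓ3 : ℓ ^ 2 ≤ 4 * (5 + |u|) := by
    have h := Real.log_le_sub_one_of_pos (Real.sqrt_pos.2 h5)
    rw [Real.log_sqrt h5.le] at h
    have h' : ℓ ≤ 2 * Real.sqrt (5 + |u|) := by linarith
    calc ℓ ^ 2 ≤ (2 * Real.sqrt (5 + |u|)) ^ 2 := by gcongr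
      _ = 4 * (5 + |u|) := by rw [mul_pow, Real.sq_sqrt h5.le]; norm_num
  set N : ℝ := (S.card : ℝ) with hN
  have hN0 : 0 ≤ N := by positivity
  set d : ℝ := 1 / (400 * (N + 1)) with hd
  have hd0 : 0 < d := by positivity
  obtain ⟨T, hT, hTd⟩ := exists_mem_Icc_forall_le_abs_sub (S.image Complex.im) u (w := 1 / 100) hd0
    (by
      have h1 : ((S.image Complex.im).card : ℝ) ≤ N := by
        rw [hN]; exact_mod_cast Finset.card_image_le
      calc 2 * d * ((S.image Complex.im).card : ℝ) ≤ 2 * d * N := by gcongr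
        _ < 1 / 100 := by
          rw [hd]
          field_simp
          linarith)
  refine ⟨T, ⟨hT.1, by linarith [hT.2]⟩, fun σ hσ => ?_⟩
  have hsmem : (σ + T * Complex.I : ℂ) ∈ Metric.closedBall (discCentre u) (2 - 1 / 2000) := by
    refine mem_closedBall_discCentre (by norm_num) ?_
    simp
    have h1 := hT.1
    have h2 := hT.2
    have h3 := hσ.1
    have h4 := hσ.2
    nlinarith
  have hbig := (disc_estimate (differentiable_entireL χ) (c := discCentre u) (R₀ := 2 - 1 / 2000)
      (R₁ := 2 - 1 / 3000) (R := 2 - 1 / 4000) (Λ := A * ℓ)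
      (by norm_num) (by norm_num) (by norm_num) (by positivity)
      (entireL_ne_zero χ (by simp [discCentre])) (hle χ u) (S := S) fun ρ hρ => (hSm ρ).1 hρ).2
      (fun ρ h1 h2 => (hSm ρ).2 ⟨h1, h2⟩)
      (fun ρ hρ => hχ.deriv_entireL_ne ((entireL_eq_zero_iff_mem χ
        (closedBall_discCentre_re_pos ((hSm ρ).1 hρ).1)).1 ((hSm ρ).1 hρ).2)) _ hsmem
  refine le_trans ?_ hbig
  have hc1 : Real.exp (-|Real.log c|) ≤ ‖entireL χ (discCentre u)‖ := by
    refine le_trans ?_ (hcle χ (discCentre u) (by simp [discCentre])).2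
    calc _ ≤ Real.exp (Real.log c) := Real.exp_le_exp.2 (neg_abs_le _)
      _ = c := Real.exp_log hc
  have hprod : Real.exp (-(1600 * A' * (A' + 1) * ℓ ^ 2)) ≤
      ∏ ρ ∈ S, (‖(σ + T * Complex.I : ℂ) - ρ‖ / (2 * (2 - 1 / 4000))) := by
    have h1 : ∀ ρ ∈ S, d / 4 ≤ ‖(σ + T * Complex.I : ℂ) - ρ‖ / (2 * (2 - 1 / 4000)) := by
      intro ρ hρ
      have h2 := hTd ρ.im (Finset.mem_image_of_mem _ hρ)
      have h3 := Complex.abs_im_le_norm ((σ + T * Complex.I : ℂ) - ρ)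
      simp at h3
      have h4 : d ≤ ‖(σ + T * Complex.I : ℂ) - ρ‖ := h2.trans h3
      gcongr
      norm_num
    refine le_trans ?_ (Finset.prod_le_prod (fun ρ _ => by positivity) h1)
    rw [Finset.prod_const]
    have h2 : Real.exp (-(1600 * (N + 1))) ≤ d / 4 := by
      have h3 := Real.add_one_le_exp (1600 * (N + 1))
      rw [Real.exp_neg, hd]
      have : (1600 * (N + 1)) ≤ Real.exp (1600 * (N + 1)) := by linarith
      calc (Real.exp (1600 * (N + 1)))⁻¹ ≤ (1600 * (N + 1))⁻¹ := by gcongr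
        _ = _ := by field_simp; norm_num
    calc Real.exp (-(1600 * A' * (A' + 1) * ℓ ^ 2)) ≤ Real.exp (-(1600 * (N + 1))) ^ S.card := by
          rw [← Real.exp_nat_mul]
          refine Real.exp_le_exp.2 ?_
          have h6 : N * (N + 1) ≤ (A' * ℓ) * ((A' + 1) * ℓ) := by
            have : N ≤ A' * ℓ := hcard
            gcongr
            nlinarith
          rw [← hN]
          nlinarith
      _ ≤ (d / 4) ^ S.card := by gcongr
  calc Real.exp (-((|Real.log c| + K * A + 4 * (1600 * A' * (A' + 1))) * (5 + |u|)))
      ≤ Real.exp (-|Real.log c| + -(K * (A * ℓ)) + -(1600 * A' * (A' + 1) * ℓ ^ 2)) := by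
        refine Real.exp_le_exp.2 ?_
        have h1 : |Real.log c| ≤ |Real.log c| * (5 + |u|) :=
          le_mul_of_one_le_right (abs_nonneg _) (by linarith)
        have h2 : K * (A * ℓ) ≤ K * A * (5 + |u|) := by
          rw [← mul_assoc]; gcongr
        have h3 : 1600 * A' * (A' + 1) * ℓ ^ 2 ≤ 1600 * A' * (A' + 1) * (4 * (5 + |u|)) := by gcongr
        linarith
    _ = Real.exp (-|Real.log c|) * Real.exp (-(K * (A * ℓ))) *
        Real.exp (-(1600 * A' * (A' + 1) * ℓ ^ 2)) := by rw [Real.exp_add, Real.exp_add]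
    _ ≤ _ := by gcongr

end ZeroCounting

section GammaRatio

theorem one_le_gammaFactor {x b τ : ℝ} (hx : 0 < x) (hb : 0 ≤ b) :
    1 ≤ ((x ^ 2 + τ ^ 2) * (x + b) ^ 2) / (x ^ 2 * ((x + b) ^ 2 + τ ^ 2)) := by
  rw [one_le_div (by positivity)]
  nlinarith [mul_nonneg (sq_nonneg τ) (mul_nonneg hb (by linarith : 0 ≤ 2 * x + b))]

theorem one_add_div_le_gammaFactor {x b τ : ℝ} (hx : 0 < x) (hb : 0 ≤ b) (h : x + b ≤ τ) :
    1 + b / x ≤ ((x ^ 2 + τ ^ 2) * (x + b) ^ 2) / (x ^ 2 * ((x + b) ^ 2 + τ ^ 2)) := by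
  have h1 : 1 + b / x = (x + b) / x := by field_simp
  rw [h1, div_le_div_iff₀ hx (by positivity)]
  have h2 : (x + b) ^ 2 ≤ τ ^ 2 := by gcongr
  have h3 : x * ((x + b) ^ 2 + τ ^ 2) ≤ (x ^ 2 + τ ^ 2) * (x + b) := by
    nlinarith [mul_nonneg hb (sub_nonneg.2 h2), mul_nonneg hb (sq_nonneg x),
      mul_nonneg hx.le hb, mul_nonneg (mul_nonneg hx.le hb) (by linarith : 0 ≤ x + b)]
  calc (x + b) * (x ^ 2 * ((x + b) ^ 2 + τ ^ 2))
      = (x * (x + b)) * (x * ((x + b) ^ 2 + τ ^ 2)) := by ring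
    _ ≤ (x * (x + b)) * ((x ^ 2 + τ ^ 2) * (x + b)) := by gcongr
    _ = _ := by ring

theorem rpow_le_prod_gammaFactor {α b τ : ℝ} (hα : 0 < α) (hα1 : α ≤ 1) (hb : 0 ≤ b) (hb1 : b ≤ 1)
    (hτ : 0 ≤ τ) {n : ℕ} (hn : τ ≤ n) :
    (τ / 2) ^ b ≤ ∏ j ∈ Finset.range (n + 1),
      (((α + j) ^ 2 + τ ^ 2) * (α + j + b) ^ 2) /
        ((α + j) ^ 2 * ((α + j + b) ^ 2 + τ ^ 2)) := by
  have hpos : ∀ j : ℕ, 0 < α + j := fun j => by positivity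
  rcases le_total τ 2 with h2 | h2
  · calc (τ / 2) ^ b ≤ 1 := Real.rpow_le_one (by positivity) (by linarith) hb
      _ ≤ _ := by
        rw [← Finset.prod_const_one (s := Finset.range (n + 1))]
        exact Finset.prod_le_prod (fun _ _ => zero_le_one)
          fun j _ => one_le_gammaFactor (hpos j) hb
  · have hfl : 2 ≤ ⌊τ⌋₊ := Nat.le_floor (by exact_mod_cast h2)
    obtain ⟨m, hm⟩ : ∃ m, ⌊τ⌋₊ = m + 1 := ⟨⌊τ⌋₊ - 1, by omega⟩
    have hmτ : (m : ℝ) + 1 ≤ τ := by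
      have := Nat.floor_le hτ
      rw [hm] at this
      exact_mod_cast this
    have hτm : τ < m + 2 := by
      have := Nat.lt_floor_add_one τ
      rw [hm] at this
      push_cast at this
      linarith
    have hmn : m ≤ n + 1 := by
      have : (m : ℝ) ≤ n := by linarith
      have : m ≤ n := by exact_mod_cast this
      omega
    have hm1 : (1 : ℝ) ≤ m := by
      have : 1 ≤ m := by omega
      exact_mod_cast this
    have htel : ∀ k : ℕ, ((k : ℝ) + 1) ^ b =
        ∏ j ∈ Finset.range k, (1 + 1 / ((j : ℝ) + 1)) ^ b := by
      intro k
      induction k with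
      | zero => simp
      | succ k ih =>
        rw [Finset.prod_range_succ, ← ih, ← Real.mul_rpow (by positivity) (by positivity)]
        congr 1
        push_cast
        field_simp
    calc (τ / 2) ^ b ≤ ((m : ℝ) + 1) ^ b :=
          Real.rpow_le_rpow (by positivity) (by linarith) hb
      _ = ∏ j ∈ Finset.range m, (1 + 1 / ((j : ℝ) + 1)) ^ b := htel m
      _ ≤ ∏ j ∈ Finset.range m, (((α + j) ^ 2 + τ ^ 2) * (α + j + b) ^ 2) /
        ((α + j) ^ 2 * ((α + j + b) ^ 2 + τ ^ 2)) := by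
          refine Finset.prod_le_prod (fun _ _ => by positivity) fun j hj => ?_
          have hjm : (j : ℝ) + 1 ≤ m := by exact_mod_cast Finset.mem_range.1 hj
          refine le_trans ?_ (one_add_div_le_gammaFactor (hpos j) hb (by linarith))
          refine (rpow_one_add_le_one_add_mul_self (by
            have : 0 ≤ 1 / ((j : ℝ) + 1) := by positivity
            linarith) hb hb1).trans ?_
          have : b * (1 / ((j : ℝ) + 1)) ≤ b / (α + j) := by
            rw [mul_one_div]
            exact div_le_div_of_nonneg_left hb (by positivity) (by linarith)
          linarith
      _ ≤ _ := Finset.prod_le_prod_of_subset_of_one_le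
          (Finset.range_subset_range.2 hmn)
          (fun j _ => (zero_le_one.trans (one_le_gammaFactor (hpos j) hb)))
          fun j _ _ => one_le_gammaFactor (hpos j) hb

theorem norm_GammaSeq (x τ : ℝ) {n : ℕ} (hn : 0 < n) :
    ‖Complex.GammaSeq (x + τ * Complex.I) n‖ =
      (n : ℝ) ^ x * n.factorial / ∏ j ∈ Finset.range (n + 1), √((x + j) ^ 2 + τ ^ 2) := by
  rw [Complex.GammaSeq, norm_div, norm_mul, norm_prod, ← Complex.ofReal_natCast n,
    Complex.norm_cpow_eq_rpow_re_of_pos (by exact_mod_cast hn)]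
  congr 1
  · simp
  · refine Finset.prod_congr rfl fun j _ => ?_
    rw [← Complex.norm_add_mul_I]
    congr 1
    push_cast
    ring

theorem Gamma_ratio_le {α b τ : ℝ} (hα : 0 < α) (hα1 : α ≤ 1) (hb : 0 ≤ b) (hb1 : b ≤ 1) :
    (|τ| / 2) ^ (b / 2) * Real.Gamma (α + b) * ‖Complex.Gamma (α + τ * Complex.I)‖ ≤
      Real.Gamma α * ‖Complex.Gamma ((α + b : ℝ) + τ * Complex.I)‖ := by
  refine le_of_tendsto_of_tendsto
    (((Real.GammaSeq_tendsto_Gamma (α + b)).const_mul _).mul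
      (Complex.GammaSeq_tendsto_Gamma (α + τ * Complex.I)).norm)
    ((Real.GammaSeq_tendsto_Gamma α).mul
      (Complex.GammaSeq_tendsto_Gamma ((α + b : ℝ) + τ * Complex.I)).norm) ?_
  filter_upwards [eventually_gt_atTop 0, eventually_ge_atTop ⌈|τ|⌉₊] with n hn hn2
  have hprod := rpow_le_prod_gammaFactor hα hα1 hb hb1 (abs_nonneg τ) (Nat.ceil_le.1 hn2)
  rw [norm_GammaSeq _ _ hn, norm_GammaSeq _ _ hn, Real.GammaSeq, Real.GammaSeq]
  have hP := Real.sqrt_le_sqrt hprod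
  rw [Real.sqrt_eq_rpow, ← Real.rpow_mul (by positivity), mul_one_div] at hP
  have hsplit : √(∏ j ∈ Finset.range (n + 1),
      (((α + j) ^ 2 + |τ| ^ 2) * (α + j + b) ^ 2) /
        ((α + j) ^ 2 * ((α + j + b) ^ 2 + |τ| ^ 2))) =
      (∏ j ∈ Finset.range (n + 1), √((α + j) ^ 2 + τ ^ 2)) *
        (∏ j ∈ Finset.range (n + 1), (α + b + j)) /
      ((∏ j ∈ Finset.range (n + 1), (α + j)) *
        ∏ j ∈ Finset.range (n + 1), √((α + b + j) ^ 2 + τ ^ 2)) := by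
    rw [← Finset.prod_mul_distrib, ← Finset.prod_mul_distrib, ← Finset.prod_div_distrib]
    rw [Real.sqrt_eq_iff_mul_self_eq
      (Finset.prod_nonneg fun j _ => by positivity)
      (Finset.prod_nonneg fun j _ => by positivity), ← Finset.prod_mul_distrib]
    refine Finset.prod_congr rfl fun j _ => ?_
    rw [div_mul_div_comm]
    have e1 : √((α + j) ^ 2 + τ ^ 2) * √((α + j) ^ 2 + τ ^ 2) = (α + j) ^ 2 + τ ^ 2 :=
      Real.mul_self_sqrt (by positivity)
    have e2 : √((α + b + j) ^ 2 + τ ^ 2) * √((α + b + j) ^ 2 + τ ^ 2) =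
      (α + b + j) ^ 2 + τ ^ 2 := Real.mul_self_sqrt (by positivity)
    rw [mul_mul_mul_comm, e1, mul_mul_mul_comm, e2, sq_abs]
    ring_nf
  rw [hsplit] at hP
  have p1 : 0 < ∏ j ∈ Finset.range (n + 1), √((α + j) ^ 2 + τ ^ 2) :=
    Finset.prod_pos fun j _ => by positivity
  have p2 : 0 < ∏ j ∈ Finset.range (n + 1), (α + b + j) :=
    Finset.prod_pos fun j _ => by positivity
  have p3 : 0 < ∏ j ∈ Finset.range (n + 1), (α + j) :=
    Finset.prod_pos fun j _ => by positivity
  have p4 : 0 < ∏ j ∈ Finset.range (n + 1), √((α + b + j) ^ 2 + τ ^ 2) :=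
    Finset.prod_pos fun j _ => by positivity
  set p₁ := ∏ j ∈ Finset.range (n + 1), √((α + j) ^ 2 + τ ^ 2)
  set p₂ := ∏ j ∈ Finset.range (n + 1), (α + b + j)
  set p₃ := ∏ j ∈ Finset.range (n + 1), (α + j)
  set p₄ := ∏ j ∈ Finset.range (n + 1), √((α + b + j) ^ 2 + τ ^ 2)
  have hnn : (0 : ℝ) < n := by exact_mod_cast hn
  set N : ℝ := (n : ℝ) ^ α * n.factorial
  set N' : ℝ := (n : ℝ) ^ (α + b) * n.factorial
  have hN : 0 < N := by positivity
  have hN' : 0 < N' := by positivity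
  calc (|τ| / 2) ^ (b / 2) * (N' / p₂) * (N / p₁)
      ≤ (p₁ * p₂ / (p₃ * p₄)) * (N' / p₂) * (N / p₁) := by gcongr
    _ = N / p₃ * (N' / p₄) := by field_simp

end GammaRatio

section FunctionalEquation

open DirichletCharacter

theorem norm_Gammaℝ (s : ℂ) :
    ‖Complex.Gammaℝ s‖ = Real.pi ^ (-s.re / 2) * ‖Complex.Gamma (s / 2)‖ := by
  rw [Complex.Gammaℝ_def, norm_mul, Complex.norm_cpow_eq_rpow_re_of_pos Real.pi_pos]
  congr 2
  simp

theorem norm_Gamma_neg_im (x t : ℝ) :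
    ‖Complex.Gamma (x + (-t : ℝ) * Complex.I)‖ = ‖Complex.Gamma (x + t * Complex.I)‖ := by
  rw [← Complex.norm_conj, ← Complex.Gamma_conj]
  simp

theorem exists_Gammaℝ_ratio {α b : ℝ} (hα : 0 < α) (hα1 : α ≤ 1) (hb : 0 ≤ b) (hb1 : b ≤ 1) :
    ∃ c : ℝ, 0 < c ∧ ∀ t : ℝ, c * |t| ^ (b / 2) *
      ‖Complex.Gammaℝ ((2 * α : ℝ) + t * Complex.I)‖ ≤
        ‖Complex.Gammaℝ ((2 * (α + b) : ℝ) + (-t : ℝ) * Complex.I)‖ := by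
  have hG1 := Real.Gamma_pos_of_pos hα
  have hG2 := Real.Gamma_pos_of_pos (by linarith : 0 < α + b)
  have hp1 : 0 < Real.pi ^ (-α) := Real.rpow_pos_of_pos Real.pi_pos _
  have hp2 : 0 < Real.pi ^ (-(α + b)) := Real.rpow_pos_of_pos Real.pi_pos _
  refine ⟨(1 / 4) ^ (b / 2) * Real.Gamma (α + b) / Real.Gamma α *
    (Real.pi ^ (-(α + b)) / Real.pi ^ (-α)), by positivity, fun t => ?_⟩
  have key := Gamma_ratio_le (τ := t / 2) hα hα1 hb hb1
  have e0 : |t / 2| / 2 = (1 / 4) * |t| := by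
    rw [abs_div, abs_two]; ring
  rw [e0, Real.mul_rpow (by norm_num) (abs_nonneg t)] at key
  have e1 : ((2 * α : ℝ) + t * Complex.I : ℂ) / 2 = α + (t / 2 : ℝ) * Complex.I := by
    push_cast; ring
  have e2 : ((2 * (α + b) : ℝ) + (-t : ℝ) * Complex.I : ℂ) / 2 =
      ((α + b : ℝ) : ℂ) + (-(t / 2) : ℝ) * Complex.I := by
    push_cast; ring
  rw [norm_Gammaℝ, norm_Gammaℝ, e1, e2, norm_Gamma_neg_im]
  have r1 : -(((2 * α : ℝ) + t * Complex.I : ℂ)).re / 2 = -α := by simp; ring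
  have r2 : -(((2 * (α + b) : ℝ) + (-t : ℝ) * Complex.I : ℂ)).re / 2 = -(α + b) := by
    simp; ring
  rw [r1, r2]
  set P₁ := Real.pi ^ (-α)
  set P₂ := Real.pi ^ (-(α + b))
  set g₁ := ‖Complex.Gamma (α + (t / 2 : ℝ) * Complex.I)‖
  set g₂ := ‖Complex.Gamma (((α + b : ℝ) : ℂ) + (t / 2 : ℝ) * Complex.I)‖
  calc _ = P₂ * (((1 / 4) ^ (b / 2) * |t| ^ (b / 2) * Real.Gamma (α + b) * g₁) /
        Real.Gamma α) := by field_simp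
    _ ≤ P₂ * g₂ := by
      gcongr
      rw [div_le_iff₀ hG1, mul_comm g₂]
      exact key

theorem gammaFactor_inv {N : ℕ} [NeZero N] (χ : DirichletCharacter ℂ N) (s : ℂ) :
    gammaFactor χ⁻¹ s = gammaFactor χ s := by
  have hinv : χ⁻¹ (-1) = (χ (-1))⁻¹ := MulChar.inv_apply_eq_inv' χ (-1)
  rcases χ.even_or_odd with h | h
  · have h' : χ⁻¹.Even := by
      rw [DirichletCharacter.Even] at h ⊢
      rw [hinv, h, inv_one]
    rw [h.gammaFactor_def, h'.gammaFactor_def]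
  · have h' : χ⁻¹.Odd := by
      rw [DirichletCharacter.Odd] at h ⊢
      rw [hinv, h]
      norm_num
    rw [h.gammaFactor_def, h'.gammaFactor_def]

theorem exists_gammaFactor_ratio {N : ℕ} [NeZero N] (χ : DirichletCharacter ℂ N) {η : ℝ}
    (hη : 0 < η) (hη1 : η < 1 / 2) :
    ∃ c : ℝ, 0 < c ∧ ∀ t : ℝ, c * |t| ^ ((1 / 2 - η) / 2) *
      ‖gammaFactor χ (η + t * Complex.I)‖ ≤ ‖gammaFactor χ (1 - (η + t * Complex.I))‖ := by
  rcases χ.even_or_odd with h | h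
  · obtain ⟨c, hc, H⟩ := exists_Gammaℝ_ratio (α := η / 2) (b := 1 / 2 - η) (by linarith)
      (by linarith) (by linarith) (by linarith)
    refine ⟨c, hc, fun t => ?_⟩
    rw [h.gammaFactor_def, h.gammaFactor_def]
    convert H t using 3
    · push_cast; ring_nf
    · push_cast; ring_nf
  · obtain ⟨c, hc, H⟩ := exists_Gammaℝ_ratio (α := (1 + η) / 2) (b := 1 / 2 - η) (by linarith)
      (by linarith) (by linarith) (by linarith)
    refine ⟨c, hc, fun t => ?_⟩
    rw [h.gammaFactor_def, h.gammaFactor_def]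
    convert H t using 3
    · push_cast; ring_nf
    · push_cast; ring_nf

theorem gammaFactor_ne_zero {N : ℕ} [NeZero N] (χ : DirichletCharacter ℂ N) {s : ℂ}
    (hs : 0 < s.re) : gammaFactor χ s ≠ 0 := by
  rcases χ.even_or_odd with h | h
  · rw [h.gammaFactor_def]
    exact Complex.Gammaℝ_ne_zero_of_re_pos hs
  · rw [h.gammaFactor_def]
    refine Complex.Gammaℝ_ne_zero_of_re_pos ?_
    simp
    linarith

theorem LFunction_mul_gammaFactor {N : ℕ} [NeZero N] (χ : DirichletCharacter ℂ N) {s : ℂ}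
    (hs : 0 < s.re) : LFunction χ s * gammaFactor χ s = completedLFunction χ s := by
  rw [LFunction_eq_completed_div_gammaFactor χ s (Or.inl ?_),
    div_mul_cancel₀ _ (gammaFactor_ne_zero χ hs)]
  rintro rfl
  simp at hs

theorem rootNumber_ne_zero {N : ℕ} [NeZero N] {χ : DirichletCharacter ℂ N}
    (hχ : χ.IsPrimitive) : rootNumber χ ≠ 0 := by
  intro h
  have h1 : ∀ s : ℂ, completedLFunction χ s = 0 := fun s => by
    have := hχ.completedLFunction_one_sub (1 - s)
    rwa [h, mul_zero, zero_mul, sub_sub_cancel] at this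
  have h2 := LFunction_mul_gammaFactor χ (s := 2) (by norm_num)
  rw [h1] at h2
  rcases mul_eq_zero.1 h2 with h3 | h3
  · exact LFunction_ne_zero_of_one_le_re χ (Or.inr (by norm_num)) (by norm_num) h3
  · exact gammaFactor_ne_zero χ (by norm_num) h3

theorem exists_norm_LFunction_primitive_ge {N : ℕ} [NeZero N] {χ : DirichletCharacter ℂ N}
    (hχ : χ.IsPrimitive) {η : ℝ} (hη : 0 < η) (hη1 : η < 1 / 2) :
    ∃ c : ℝ, 0 < c ∧ ∀ t : ℝ, c * |t| ^ ((1 / 2 - η) / 2) *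
      ‖LFunction χ⁻¹ (1 - (η + t * Complex.I))‖ ≤ ‖LFunction χ (η + t * Complex.I)‖ := by
  obtain ⟨c, hc, H⟩ := exists_gammaFactor_ratio χ hη hη1
  have hN : (0 : ℝ) < N := by exact_mod_cast Nat.pos_of_ne_zero (NeZero.ne N)
  have hr : 0 < ‖rootNumber χ‖ := norm_pos_iff.2 (rootNumber_ne_zero hχ)
  have hp : 0 < (N : ℝ) ^ (1 / 2 - η) := Real.rpow_pos_of_pos hN _
  refine ⟨(N : ℝ) ^ (1 / 2 - η) * ‖rootNumber χ‖ * c, by positivity, fun t => ?_⟩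
  set s : ℂ := η + t * Complex.I with hs
  have hsre : s.re = η := by simp [hs]
  have h1 := LFunction_mul_gammaFactor χ (s := s) (by rw [hsre]; exact hη)
  have h2 := LFunction_mul_gammaFactor χ⁻¹ (s := 1 - s) (by simp [hsre]; linarith)
  have h3 := hχ.completedLFunction_one_sub (1 - s)
  rw [sub_sub_cancel, ← h1, ← h2, gammaFactor_inv] at h3
  have h4 := congrArg norm h3
  rw [norm_mul, norm_mul, norm_mul, norm_mul, ← Complex.ofReal_natCast,
    Complex.norm_cpow_eq_rpow_re_of_pos hN] at h4
  have h5 : (1 - s - 1 / 2 : ℂ).re = 1 / 2 - η := by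
    simp [hsre]; ring
  rw [h5] at h4
  have hg : 0 < ‖gammaFactor χ s‖ :=
    norm_pos_iff.2 (gammaFactor_ne_zero χ (by rw [hsre]; exact hη))
  refine le_of_mul_le_mul_right ?_ hg
  rw [h4]
  calc _ = (N : ℝ) ^ (1 / 2 - η) * ‖rootNumber χ‖ * (‖LFunction χ⁻¹ (1 - s)‖ *
      (c * |t| ^ ((1 / 2 - η) / 2) * ‖gammaFactor χ s‖)) := by ring
    _ ≤ _ := by
      gcongr
      exact H t

theorem exists_norm_LFunction_ge_one_sub {q : ℕ} [NeZero q] (χ : DirichletCharacter ℂ q) {η : ℝ}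
    (hη : 0 < η) (hη1 : η < 1 / 2) :
    ∃ c : ℝ, 0 < c ∧ ∀ t : ℝ, c * |t| ^ ((1 / 2 - η) / 2) *
      ‖LFunction χ⁻¹ (1 - (η + t * Complex.I))‖ ≤ ‖LFunction χ (η + t * Complex.I)‖ := by
  have hc0 : χ.conductor ≠ 0 := fun h => NeZero.ne q
    (Nat.eq_zero_of_zero_dvd (h ▸ χ.conductor_dvd_level))
  have : NeZero χ.conductor := ⟨hc0⟩
  obtain ⟨c, hc, H⟩ := exists_norm_LFunction_primitive_ge χ.primitiveCharacter_isPrimitive hη hη1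
  set ψ := χ.primitiveCharacter with hψ
  have hχ : χ = changeLevel χ.conductor_dvd_level ψ := (changeLevel_primitiveCharacter χ).symm
  have hχi : χ⁻¹ = changeLevel χ.conductor_dvd_level ψ⁻¹ := by
    rw [map_inv]
    exact congrArg _ hχ
  have hn : ∀ (φ : DirichletCharacter ℂ χ.conductor) (s : ℂ) (p : ℕ), p ∈ q.primeFactors →
      ‖φ (p : ZMod χ.conductor) * (p : ℂ) ^ (-s)‖ ≤ (p : ℝ) ^ (-s.re) := by
    intro φ s p hp
    have hp0 : 0 < p := (Nat.prime_of_mem_primeFactors hp).pos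
    rw [norm_mul, Complex.norm_natCast_cpow_of_pos hp0]
    calc _ ≤ 1 * (p : ℝ) ^ (-s).re := by
          gcongr
          exact φ.norm_le_one _
      _ = _ := by simp
  have hpη : ∀ p ∈ q.primeFactors, (p : ℝ) ^ (-η) < 1 := by
    intro p hp
    have hp1 : (1 : ℝ) < p := by exact_mod_cast (Nat.prime_of_mem_primeFactors hp).one_lt
    exact Real.rpow_lt_one_of_one_lt_of_neg hp1 (by linarith)
  have hE : 0 < ∏ p ∈ q.primeFactors, (1 - (p : ℝ) ^ (-η)) :=
    Finset.prod_pos fun p hp => by linarith [hpη p hp]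
  have hE2 : 0 < ∏ p ∈ q.primeFactors, (2 : ℝ) := Finset.prod_pos fun p hp => by norm_num
  refine ⟨c * (∏ p ∈ q.primeFactors, (1 - (p : ℝ) ^ (-η))) / ∏ p ∈ q.primeFactors, (2 : ℝ),
    by positivity, fun t => ?_⟩
  set s : ℂ := η + t * Complex.I with hs
  have hsre : s.re = η := by simp [hs]
  have hL1 : LFunction χ s = LFunction ψ s * ∏ p ∈ q.primeFactors, (1 - ψ p * p ^ (-s)) := by
    conv_lhs => rw [hχ]
    refine LFunction_changeLevel _ _ (Or.inr ?_)
    intro h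
    rw [h] at hsre
    simp at hsre
    linarith
  have hL2 : LFunction χ⁻¹ (1 - s) =
      LFunction ψ⁻¹ (1 - s) * ∏ p ∈ q.primeFactors, (1 - ψ⁻¹ p * p ^ (-(1 - s))) := by
    conv_lhs => rw [hχi]
    refine LFunction_changeLevel _ _ (Or.inr ?_)
    intro h
    have : s = 0 := by linear_combination -h
    rw [this] at hsre
    simp at hsre
    linarith
  have hlow : ∏ p ∈ q.primeFactors, (1 - (p : ℝ) ^ (-η)) ≤
      ‖∏ p ∈ q.primeFactors, (1 - ψ p * (p : ℂ) ^ (-s))‖ := by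
    rw [norm_prod]
    refine Finset.prod_le_prod (fun p hp => by linarith [hpη p hp]) fun p hp => ?_
    have h1 := hn ψ s p hp
    have h2 := norm_sub_norm_le (1 : ℂ) (ψ p * (p : ℂ) ^ (-s))
    rw [hsre] at h1
    rw [norm_one] at h2
    linarith
  have hup : ‖∏ p ∈ q.primeFactors, (1 - ψ⁻¹ p * (p : ℂ) ^ (-(1 - s)))‖ ≤
      ∏ p ∈ q.primeFactors, (2 : ℝ) := by
    rw [norm_prod]
    refine Finset.prod_le_prod (fun p hp => norm_nonneg _) fun p hp => ?_
    have h1 := hn ψ⁻¹ (1 - s) p hp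
    have h2 := norm_sub_le (1 : ℂ) (ψ⁻¹ p * (p : ℂ) ^ (-(1 - s)))
    have hp1 : (1 : ℝ) < p := by exact_mod_cast (Nat.prime_of_mem_primeFactors hp).one_lt
    have h3 : (p : ℝ) ^ (-(1 - s).re) < 1 :=
      Real.rpow_lt_one_of_one_lt_of_neg hp1 (by simp [hsre]; linarith)
    rw [norm_one] at h2
    linarith
  rw [hL1, hL2, norm_mul, norm_mul]
  set E₁ := ∏ p ∈ q.primeFactors, (1 - (p : ℝ) ^ (-η))
  set E₂ := ∏ p ∈ q.primeFactors, (2 : ℝ)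
  set ψ₁ := ‖LFunction ψ⁻¹ (1 - s)‖
  calc _ ≤ c * E₁ / E₂ * |t| ^ ((1 / 2 - η) / 2) * (ψ₁ * E₂) := by gcongr
    _ = (c * |t| ^ ((1 / 2 - η) / 2) * ψ₁) * E₁ := by field_simp
    _ ≤ _ := by
      gcongr
      exact H t

end FunctionalEquation

section LeftLine

open DirichletCharacter

variable {q : ℕ} [NeZero q]

theorem GoodZeros.LFunction_ne_zero {χ : DirichletCharacter ℂ q} (h : GoodZeros χ) {s : ℂ}
    (hs : 0 < s.re) (hs2 : s.re ≠ 1 / 2) (hs1 : s ≠ 1) : LFunction χ s ≠ 0 := fun h0 =>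
  hs2 (h.re_eq s ((entireL_eq_zero_iff_mem χ hs).1 ((entireL_eq_zero_iff χ hs1).2 h0)))

theorem GoodZeros.exists_norm_LFunction_one_sub_ge {χ : DirichletCharacter ℂ q}
    (h : GoodZeros χ) : ∃ c : ℝ, 0 < c ∧ ∀ t : ℝ, 1 ≤ |t| →
      c * |t| ^ (-(1 / 20) : ℝ) ≤
        ‖LFunction χ (1 - (((1 / 1000 : ℝ) : ℂ) + t * Complex.I))‖ := by
  obtain ⟨c, hc, H⟩ := exists_norm_LFunction_ge (q := q) (σ := 1001 / 1000) (by norm_num)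
  set A : ℝ := max (Real.log (2 * (6 * q + 1) / c)) 0 with hA
  have hA0 : 0 ≤ A := le_max_right _ _
  refine ⟨c * Real.exp (-A) * Real.exp (-3 * Real.log 6), by positivity, fun t ht => ?_⟩
  set w : ℂ := ((1001 / 1000 : ℝ) : ℂ) + (-t : ℝ) * Complex.I with hw
  have hwre : w.re = 1001 / 1000 := by simp [hw]
  have hwim : w.im = -t := by simp [hw]
  have hlog := one_le_log_five_add t
  set Λ : ℝ := A + 2 * Real.log (5 + |t|) with hΛ
  have hball : ∀ z ∈ Metric.ball w (1 / 4), 1 / 2 < z.re ∧ 3 / 4 ≤ ‖z - 1‖ ∧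
      1 + ‖z‖ ≤ 5 + |t| := by
    intro z hz
    have hz' : ‖z - w‖ < 1 / 4 := by simpa [dist_eq_norm] using hz
    have h1 := abs_lt.1 ((Complex.abs_re_le_norm (z - w)).trans_lt hz')
    have h2 := (Complex.abs_im_le_norm (z - w)).trans_lt hz'
    rw [Complex.sub_re, hwre] at h1
    rw [Complex.sub_im, hwim, sub_neg_eq_add] at h2
    refine ⟨by linarith [h1.1], ?_, ?_⟩
    · have h3 := Complex.abs_im_le_norm (z - 1)
      rw [Complex.sub_im, Complex.one_im, sub_zero] at h3
      have h4 : |t| ≤ |z.im + t| + |z.im| := by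
        calc |t| = |(z.im + t) - z.im| := by ring_nf
          _ ≤ _ := abs_sub _ _
      linarith
    · have h3 : ‖z‖ ≤ ‖z - w‖ + ‖w‖ := by simpa using norm_add_le (z - w) w
      have h4 : ‖w‖ ≤ 1001 / 1000 + |t| := by
        refine (norm_add_le _ _).trans (le_of_eq ?_)
        rw [norm_mul, Complex.norm_real, Complex.norm_real, Complex.norm_I, mul_one,
          Real.norm_eq_abs, Real.norm_eq_abs, abs_neg, abs_of_pos (by norm_num)]
      linarith
  have hne1 : ∀ z ∈ Metric.ball w (1 / 4), z ≠ 1 := fun z hz h1 => by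
    have := (hball z hz).2.1
    rw [h1] at this
    norm_num at this
  have hs : (1 - (((1 / 1000 : ℝ) : ℂ) + t * Complex.I)) ∈
      Metric.closedBall w (2 / 1000) := by
    have : (1 - (((1 / 1000 : ℝ) : ℂ) + t * Complex.I)) - w = ((-2 / 1000 : ℝ) : ℂ) := by
      rw [hw]; push_cast; ring
    rw [Metric.mem_closedBall, dist_eq_norm, this, Complex.norm_real, Real.norm_eq_abs]
    norm_num [abs_of_neg]
  have h5 : (0 : ℝ) < 5 + |t| := by positivity
  have key := norm_ge_of_forall_ne_zero (h := LFunction χ) (c := w) (R₀ := 2 / 1000)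
    (R := 1 / 4) (Λ := Λ) (by norm_num) (by norm_num) (by positivity)
    (fun z hz => (differentiableAt_LFunction χ z
      (Or.inl (hne1 z hz))).differentiableWithinAt)
    (fun z hz => h.LFunction_ne_zero (by linarith [(hball z hz).1])
      (by linarith [(hball z hz).1]) (hne1 z hz))
    (fun z hz => by
      obtain ⟨hz1, hz2, hz3⟩ := hball z hz
      have e1 : ‖LFunction χ z‖ ≤ 2 * ‖entireL χ z‖ := by
        rw [entireL_eq χ (hne1 z hz), norm_mul, norm_pow]
        have hk : 1 / 2 ≤ ‖z - 1‖ ^ poleOrder χ := by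
          rcases Nat.le_one_iff_eq_zero_or_eq_one.1 (poleOrder_le χ) with hk | hk <;> rw [hk]
          · norm_num
          · rw [pow_one]; linarith
        nlinarith [norm_nonneg (LFunction χ z)]
      have e2 := norm_entireL_le χ (δ := 1 / 2) (by norm_num) hz1.le
      have e3 : (3 * q / (1 / 2 : ℝ) + 1) = 6 * q + 1 := by ring
      rw [e3] at e2
      have hexp : 2 * (6 * q + 1) / c * (5 + |t|) ^ 2 ≤ Real.exp Λ := by
        rw [hΛ, Real.exp_add]
        refine mul_le_mul ?_ (le_of_eq ?_) (by positivity) (Real.exp_pos _).le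
        · rw [← Real.log_le_iff_le_exp (by positivity)]
          exact le_max_left _ _
        · rw [mul_comm, Real.exp_mul, Real.exp_log h5]; norm_cast
      calc ‖LFunction χ z‖ ≤ 2 * ((6 * q + 1) * (1 + ‖z‖) ^ 2) := by linarith
        _ ≤ 2 * ((6 * q + 1) * (5 + |t|) ^ 2) := by gcongr
        _ = c * (2 * (6 * q + 1) / c * (5 + |t|) ^ 2) := by field_simp
        _ ≤ _ := by
          gcongr
          exact (H χ w hwre.ge).1)
    hs
  refine le_trans ?_ key
  have ht0 : 0 < |t| := by linarith
  have hlt : Real.log (5 + |t|) ≤ Real.log 6 + Real.log |t| := by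
    rw [← Real.log_mul (by norm_num) (by positivity)]
    exact Real.log_le_log h5 (by linarith)
  have hlog0 : 0 ≤ Real.log |t| := Real.log_nonneg ht
  have hlog6 : 0 ≤ Real.log 6 := Real.log_nonneg (by norm_num)
  rw [Real.rpow_def_of_pos ht0, mul_assoc, mul_assoc, ← Real.exp_add, ← Real.exp_add]
  refine mul_le_mul (H χ w hwre.ge).1 (Real.exp_le_exp.2 ?_) (Real.exp_pos _).le
    (norm_nonneg _)
  have : 2 * (2 / 1000) / (1 / 4 - 2 / 1000) * Λ ≤ 1 / 50 * Λ := by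
    have : 0 ≤ Λ := by positivity
    exact mul_le_mul_of_nonneg_right (by norm_num) this
  rw [hΛ] at this ⊢
  linarith

/-- The Dirichlet series of `μ χ` divided by `s`. -/
noncomputable def perronKernel (χ : DirichletCharacter ℂ q) (s : ℂ) : ℂ :=
  ((s - 1) ^ poleOrder χ / s) / entireL χ s

theorem perronKernel_eq (χ : DirichletCharacter ℂ q) {s : ℂ} (hs : s ≠ 1) :
    perronKernel χ s = 1 / (s * LFunction χ s) := by
  rw [perronKernel, entireL_eq χ hs]
  have := pow_ne_zero (poleOrder χ) (sub_ne_zero.2 hs)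
  rw [div_div, mul_left_comm, ← div_div, div_self this]

theorem GoodZeros.exists_norm_perronKernel_le {χ : DirichletCharacter ℂ q}
    (h : GoodZeros χ) (h' : GoodZeros χ⁻¹) : ∃ C : ℝ, 0 < C ∧ ∀ t : ℝ,
      ‖perronKernel χ (((1 / 1000 : ℝ) : ℂ) + t * Complex.I)‖ ≤
        C * (1 + ‖t‖) ^ (-(9 / 8) : ℝ) := by
  obtain ⟨c₁, hc₁, H₁⟩ := exists_norm_LFunction_ge_one_sub χ (η := 1 / 1000) (by norm_num)
    (by norm_num)
  obtain ⟨c₂, hc₂, H₂⟩ := h'.exists_norm_LFunction_one_sub_ge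
  have hne : ∀ t : ℝ, ((1 / 1000 : ℝ) : ℂ) + t * Complex.I ≠ 1 := fun t ht => by
    have := congrArg Complex.re ht
    norm_num at this
  have hre : ∀ t : ℝ, (((1 / 1000 : ℝ) : ℂ) + t * Complex.I).re = 1 / 1000 := fun t => by simp
  have hne0 : ∀ t : ℝ, ((1 / 1000 : ℝ) : ℂ) + t * Complex.I ≠ 0 := fun t ht => by
    have := hre t
    rw [ht] at this
    norm_num at this
  have hent : ∀ t : ℝ, entireL χ (((1 / 1000 : ℝ) : ℂ) + t * Complex.I) ≠ 0 := fun t ht => by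
    refine h.LFunction_ne_zero ?_ ?_ (hne t) ((entireL_eq_zero_iff χ (hne t)).1 ht)
    · rw [hre]; norm_num
    · rw [hre]; norm_num
  have hcont : Continuous fun t : ℝ =>
      perronKernel χ (((1 / 1000 : ℝ) : ℂ) + t * Complex.I) := by
    unfold perronKernel
    have := (differentiable_entireL χ).continuous
    exact ((by fun_prop : Continuous fun t : ℝ =>
      (((1 / 1000 : ℝ) : ℂ) + t * Complex.I - 1) ^ poleOrder χ).div (by fun_prop) hne0).div
      (by fun_prop) hent
  obtain ⟨K, hK⟩ := (isCompact_Icc (a := (-1 : ℝ)) (b := 1)).exists_bound_of_continuousOn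
    hcont.continuousOn
  have hpow : (0 : ℝ) < 2 ^ (9 / 8 : ℝ) := by positivity
  refine ⟨max (K * 2 ^ (9 / 8 : ℝ)) (1 / (c₁ * c₂) * 2 ^ (9 / 8 : ℝ)),
    lt_max_of_lt_right (by positivity), fun t => ?_⟩
  rw [Real.norm_eq_abs]
  have h1t : 0 < 1 + |t| := by positivity
  rcases le_total |t| 1 with ht | ht
  · refine (hK t (abs_le.1 ht)).trans ?_
    have hK0 : 0 ≤ K := (norm_nonneg _).trans (hK t (abs_le.1 ht))
    calc K = K * 2 ^ (9 / 8 : ℝ) * 2 ^ (-(9 / 8) : ℝ) := by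
          rw [mul_assoc, ← Real.rpow_add (by norm_num)]; norm_num
      _ ≤ max (K * 2 ^ (9 / 8 : ℝ)) (1 / (c₁ * c₂) * 2 ^ (9 / 8 : ℝ)) *
          (1 + |t|) ^ (-(9 / 8) : ℝ) := by
          refine mul_le_mul (le_max_left _ _) ?_ (by positivity) (by positivity)
          exact Real.rpow_le_rpow_of_nonpos h1t (by linarith) (by norm_num)
  · have ht0 : 0 < |t| := by linarith
    rw [perronKernel_eq χ (hne t), norm_div, norm_one, norm_mul]
    have hs : |t| ≤ ‖((1 / 1000 : ℝ) : ℂ) + t * Complex.I‖ := by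
      have := Complex.abs_im_le_norm (((1 / 1000 : ℝ) : ℂ) + t * Complex.I)
      simpa using this
    have hL : c₁ * c₂ * |t| ^ (1 / 8 : ℝ) ≤
        ‖LFunction χ (((1 / 1000 : ℝ) : ℂ) + t * Complex.I)‖ := by
      refine le_trans ?_ (H₁ t)
      calc c₁ * c₂ * |t| ^ (1 / 8 : ℝ)
          ≤ c₁ * c₂ * |t| ^ (((1 / 2 - 1 / 1000) / 2 : ℝ) + (-(1 / 20) : ℝ)) := by
            gcongr
            norm_num
        _ = c₁ * |t| ^ ((1 / 2 - 1 / 1000) / 2 : ℝ) * (c₂ * |t| ^ (-(1 / 20) : ℝ)) := by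
            rw [Real.rpow_add ht0]; ring
        _ ≤ _ := by
            gcongr
            exact H₂ t ht
    have hprod : c₁ * c₂ * |t| ^ (9 / 8 : ℝ) ≤
        ‖((1 / 1000 : ℝ) : ℂ) + t * Complex.I‖ *
          ‖LFunction χ (((1 / 1000 : ℝ) : ℂ) + t * Complex.I)‖ := by
      calc c₁ * c₂ * |t| ^ (9 / 8 : ℝ) = |t| * (c₁ * c₂ * |t| ^ (1 / 8 : ℝ)) := by
            rw [show (9 / 8 : ℝ) = 1 + 1 / 8 by norm_num, Real.rpow_add ht0, Real.rpow_one]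
            ring
        _ ≤ _ := by gcongr
    calc _ ≤ 1 / (c₁ * c₂ * |t| ^ (9 / 8 : ℝ)) :=
          one_div_le_one_div_of_le (by positivity) hprod
      _ = 1 / (c₁ * c₂) * 2 ^ (9 / 8 : ℝ) * (2 * |t|) ^ (-(9 / 8) : ℝ) := by
          rw [Real.mul_rpow (by norm_num) ht0.le, Real.rpow_neg (by norm_num),
            Real.rpow_neg ht0.le]
          field_simp
      _ ≤ _ := by
          refine mul_le_mul (le_max_right _ _) ?_ (by positivity) (by positivity)
          exact Real.rpow_le_rpow_of_nonpos h1t (by linarith) (by norm_num)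

end LeftLine

section NormalizedSum

variable {q : ℕ}

/-- `e^{-u/2} ∑_{n ≤ e^u} χ(n) μ(n)`. -/
noncomputable def normSum (χ : DirichletCharacter ℂ q) (u : ℝ) : ℂ :=
  (Real.exp (-u / 2) : ℂ) * ∑ n ∈ Finset.Icc 1 ⌊Real.exp u⌋₊,
    χ (n : ZMod q) * ((ArithmeticFunction.moebius n : ℤ) : ℂ)

theorem normSum_of_neg (χ : DirichletCharacter ℂ q) {u : ℝ} (hu : u < 0) : normSum χ u = 0 := by
  have : ⌊Real.exp u⌋₊ = 0 := Nat.floor_eq_zero.2 (by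
    rw [← Real.exp_zero]; exact Real.exp_lt_exp.2 hu)
  simp [normSum, this]

theorem norm_moebius_mul_le (χ : DirichletCharacter ℂ q) (n : ℕ) :
    ‖χ (n : ZMod q) * ((ArithmeticFunction.moebius n : ℤ) : ℂ)‖ ≤ 1 := by
  rw [norm_mul]
  have h1 := χ.norm_le_one (n : ZMod q)
  have h2 : ‖((ArithmeticFunction.moebius n : ℤ) : ℂ)‖ ≤ 1 := by
    rw [Complex.norm_intCast]; exact_mod_cast ArithmeticFunction.abs_moebius_le_one
  nlinarith [norm_nonneg (χ (n : ZMod q)), norm_nonneg ((ArithmeticFunction.moebius n : ℤ) : ℂ)]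

theorem norm_normSum_le (χ : DirichletCharacter ℂ q) (u : ℝ) :
    ‖normSum χ u‖ ≤ Real.exp (u / 2) := by
  rw [normSum, norm_mul, Complex.norm_real, Real.norm_eq_abs, abs_of_pos (Real.exp_pos _)]
  have h : ‖∑ n ∈ Finset.Icc 1 ⌊Real.exp u⌋₊,
      χ (n : ZMod q) * ((ArithmeticFunction.moebius n : ℤ) : ℂ)‖ ≤ Real.exp u := by
    refine (norm_sum_le_of_le _ fun n _ => norm_moebius_mul_le χ n).trans ?_
    simp only [Finset.sum_const, Nat.card_Icc, nsmul_eq_mul, mul_one, add_tsub_cancel_right]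
    exact Nat.floor_le (Real.exp_pos _).le
  calc _ ≤ Real.exp (-u / 2) * Real.exp u := by gcongr
    _ = _ := by rw [← Real.exp_add]; ring_nf

theorem measurable_normSum (χ : DirichletCharacter ℂ q) : Measurable (normSum χ) := by
  unfold normSum
  refine Measurable.mul (by fun_prop) ?_
  have h : Measurable fun N : ℕ => ∑ n ∈ Finset.Icc 1 N,
      χ (n : ZMod q) * ((ArithmeticFunction.moebius n : ℤ) : ℂ) := measurable_from_top
  exact h.comp (Nat.measurable_floor.comp Real.measurable_exp)

theorem ae_continuousAt_normSum (χ : DirichletCharacter ℂ q) :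
    ∀ᵐ u : ℝ, ContinuousAt (normSum χ) u := by
  have hc : (Set.range fun n : ℕ => Real.log n).Countable := Set.countable_range _
  filter_upwards [hc.ae_notMem volume] with u hu
  have hfl : ∀ᶠ v in 𝓝 u, ⌊Real.exp v⌋₊ = ⌊Real.exp u⌋₊ := by
    have h1 : (⌊Real.exp u⌋₊ : ℝ) < Real.exp u := by
      refine lt_of_le_of_ne (Nat.floor_le (Real.exp_pos _).le) fun h => hu ?_
      exact ⟨⌊Real.exp u⌋₊, by simp only [h, Real.log_exp]⟩
    have h2 : Real.exp u < ⌊Real.exp u⌋₊ + 1 := Nat.lt_floor_add_one _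
    have hcont := Real.continuous_exp.continuousAt (x := u)
    filter_upwards [hcont.eventually (lt_mem_nhds h1), hcont.eventually (gt_mem_nhds h2)]
      with v hv1 hv2
    exact (Nat.floor_eq_iff (Real.exp_pos _).le).2 ⟨hv1.le, hv2⟩
  have : normSum χ =ᶠ[𝓝 u] fun v => (Real.exp (-v / 2) : ℂ) *
      ∑ n ∈ Finset.Icc 1 ⌊Real.exp u⌋₊,
        χ (n : ZMod q) * ((ArithmeticFunction.moebius n : ℤ) : ℂ) := by
    filter_upwards [hfl] with v hv
    rw [normSum, hv]
  refine ContinuousAt.congr ?_ this.symm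
  fun_prop

theorem normSum_of_mem_Ico (χ : DirichletCharacter ℂ q) {u : ℝ} (h0 : 0 ≤ u)
    (h1 : u < Real.log 2) : normSum χ u = (Real.exp (-u / 2) : ℂ) := by
  have : ⌊Real.exp u⌋₊ = 1 := by
    rw [Nat.floor_eq_iff (Real.exp_pos _).le]
    refine ⟨by simpa using h0, ?_⟩
    have := Real.exp_lt_exp.2 h1
    rw [Real.exp_log (by norm_num)] at this
    norm_num
    exact this
  simp [normSum, this]

theorem perronKernel_eq_integral [NeZero q] (χ : DirichletCharacter ℂ q) (t : ℝ) :
    perronKernel χ (2 + t * Complex.I) =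
      ∫ u : ℝ, normSum χ u * Complex.exp (-((3 / 2 + t * Complex.I) * u)) := by
  set s : ℂ := 2 + t * Complex.I with hs
  have hre : s.re = 2 := by simp [hs]
  have hs1 : s ≠ 1 := fun h => by rw [h] at hre; norm_num at hre
  have hs0 : s ≠ 0 := fun h => by rw [h] at hre; norm_num at hre
  set f : ℕ → ℂ := (fun n : ℕ => χ (n : ZMod q)) * fun n : ℕ =>
        ((ArithmeticFunction.moebius n : ℤ) : ℂ) with hf
  have hinv := DirichletCharacter.LSeries.mul_mu_eq_one χ (s := s) (by rw [hre]; norm_num)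
  rw [← DirichletCharacter.LFunction_eq_LSeries χ (by rw [hre]; norm_num)] at hinv
  have hO : (fun n ↦ ∑ k ∈ Finset.Icc 1 n, ‖f k‖) =O[atTop] fun n : ℕ ↦ (n : ℝ) ^ (1 : ℝ) := by
    refine Asymptotics.isBigO_of_le _ fun n => ?_
    rw [Real.norm_of_nonneg (Finset.sum_nonneg fun _ _ => norm_nonneg _), Real.rpow_one,
      Real.norm_natCast]
    refine (Finset.sum_le_sum fun k _ => norm_moebius_mul_le χ k).trans ?_
    simp
  have hInt := LSeries_eq_mul_integral' f zero_le_one (s := s) (by rw [hre]; norm_num) hO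
  have h1 : perronKernel χ s = LSeries f s / s := by
    rw [perronKernel_eq χ hs1, eq_div_iff hs0]
    have hL : DirichletCharacter.LFunction χ s ≠ 0 := left_ne_zero_of_mul_eq_one hinv
    rw [div_mul_eq_mul_div, one_mul, ← div_div, div_self hs0]
    exact (eq_one_div_of_mul_eq_one_right hinv).symm
  rw [h1, hInt, mul_div_cancel_left₀ _ hs0]
  have h2 := integral_comp_exp_Ioi (fun t : ℝ => (∑ k ∈ Finset.Icc 1 ⌊t⌋₊, f k) *
    (t : ℂ) ^ (-(s + 1))) 0
  rw [Real.exp_zero] at h2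
  rw [← h2, ← integral_Ici_eq_integral_Ioi]
  have h3 : ∫ u : ℝ, normSum χ u * Complex.exp (-((3 / 2 + t * Complex.I) * u)) =
      ∫ u in Set.Ici (0 : ℝ), normSum χ u * Complex.exp (-((3 / 2 + t * Complex.I) * u)) := by
    rw [setIntegral_eq_integral_of_forall_compl_eq_zero]
    intro u hu
    rw [normSum_of_neg χ (by simpa using hu), zero_mul]
  rw [h3]
  refine setIntegral_congr_fun measurableSet_Ici fun u _ => ?_
  simp only [normSum, Complex.real_smul]
  rw [Complex.cpow_def_of_ne_zero (by exact_mod_cast (Real.exp_pos u).ne'),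
    ← Complex.ofReal_log (Real.exp_pos u).le, Real.log_exp]
  have : (Real.exp u : ℂ) * Complex.exp (u * -(s + 1)) =
      (Real.exp (-u / 2) : ℂ) * Complex.exp (-((3 / 2 + t * Complex.I) * u)) := by
    rw [Complex.ofReal_exp, Complex.ofReal_exp, ← Complex.exp_add, ← Complex.exp_add]
    congr 1
    rw [hs]
    push_cast
    ring
  have hfs : ∑ k ∈ Finset.Icc 1 ⌊Real.exp u⌋₊, f k = ∑ n ∈ Finset.Icc 1 ⌊Real.exp u⌋₊,
    χ (n : ZMod q) * ((ArithmeticFunction.moebius n : ℤ) : ℂ) := rfl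
  rw [hfs]
  linear_combination (∑ n ∈ Finset.Icc 1 ⌊Real.exp u⌋₊,
    χ (n : ZMod q) * ((ArithmeticFunction.moebius n : ℤ) : ℂ)) * this

end NormalizedSum

section Smoothing

/-- The heat kernel, normalised as a Gaussian integral. -/
noncomputable def heatKernel (κ w : ℝ) : ℂ :=
  (Real.pi / κ : ℂ) ^ (1 / 2 : ℂ) / (2 * Real.pi) * Complex.exp (-(w : ℂ) ^ 2 / (4 * κ))

theorem integral_smoothing {κ : ℝ} (hκ : 0 < κ) (σ w : ℝ) :
    ∫ t : ℝ, Complex.exp ((σ + t * Complex.I) * w + κ * (σ + t * Complex.I) ^ 2) =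
      2 * Real.pi * heatKernel κ w := by
  have hb : (-(κ : ℂ)).re < 0 := by simpa using hκ
  have h := integral_cexp_quadratic hb (Complex.I * (w + 2 * κ * σ)) (σ * w + κ * σ ^ 2)
  have hk : (κ : ℂ) ≠ 0 := by exact_mod_cast hκ.ne'
  have hpi : (Real.pi : ℂ) ≠ 0 := by exact_mod_cast Real.pi_ne_zero
  have e1 : ∀ t : ℝ, -(κ : ℂ) * (t : ℂ) ^ 2 + Complex.I * (w + 2 * κ * σ) * t +
      (σ * w + κ * σ ^ 2) = (σ + t * Complex.I) * w + κ * (σ + t * Complex.I) ^ 2 := fun t => by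
    linear_combination -(κ : ℂ) * t ^ 2 * Complex.I_sq
  simp_rw [e1] at h
  rw [h, heatKernel, neg_neg]
  have e2 : (σ * w + κ * σ ^ 2 : ℂ) - (Complex.I * (w + 2 * κ * σ)) ^ 2 / (4 * -κ) =
      -(w : ℂ) ^ 2 / (4 * κ) := by
    rw [mul_pow, Complex.I_sq]
    field_simp
    ring
  rw [e2]
  field_simp

variable {q : ℕ}

/-- `normSum` convolved with the heat kernel. -/
noncomputable def smoothSum (χ : DirichletCharacter ℂ q) (κ y : ℝ) : ℂ :=
  ∫ u : ℝ, normSum χ u * heatKernel κ (y - u)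

theorem integrable_normSum_mul_exp (χ : DirichletCharacter ℂ q) :
    Integrable fun u : ℝ => normSum χ u * Complex.exp (-((3 / 2) * u)) := by
  have hInt : IntegrableOn (fun u : ℝ => Real.exp (-1 * u)) (Set.Ioi 0) := by
    simpa using integrableOn_exp_neg_Ioi (0 : ℝ)
  have hInt' : IntegrableOn (fun u : ℝ => Real.exp (-1 * u)) (Set.Ici 0) :=
    (integrableOn_Ici_iff_integrableOn_Ioi).2 hInt
  refine (hInt'.integrable_indicator measurableSet_Ici).mono'
    ((measurable_normSum χ).aestronglyMeasurable.mul (by fun_prop)) (ae_of_all _ fun u => ?_)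
  rcases lt_or_ge u 0 with hu | hu
  · rw [normSum_of_neg χ hu]
    simp only [zero_mul, norm_zero]
    exact Set.indicator_nonneg (fun _ _ => (Real.exp_pos _).le) _
  · rw [Set.indicator_of_mem (by simpa using hu), norm_mul, Complex.norm_exp]
    have : (-(3 / 2 * (u : ℂ))).re = -(3 / 2 * u) := by
      have : (-(3 / 2 * (u : ℂ))) = ((-(3 / 2 * u) : ℝ) : ℂ) := by push_cast; ring
      rw [this, Complex.ofReal_re]
    rw [this]
    calc _ ≤ Real.exp (u / 2) * Real.exp (-(3 / 2 * u)) := by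
          gcongr
          exact norm_normSum_le χ u
      _ = _ := by rw [← Real.exp_add]; ring_nf

theorem integrable_smoothing {κ : ℝ} (hκ : 0 < κ) (σ w : ℝ) :
    Integrable fun t : ℝ =>
      Complex.exp ((σ + t * Complex.I) * w + κ * (σ + t * Complex.I) ^ 2) := by
  have hb : (-(κ : ℂ)).re < 0 := by simpa using hκ
  have h := integrable_cexp_quadratic' hb (Complex.I * (w + 2 * κ * σ)) (σ * w + κ * σ ^ 2)
  have e1 : ∀ t : ℝ, -(κ : ℂ) * (t : ℂ) ^ 2 + Complex.I * (w + 2 * κ * σ) * t +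
      (σ * w + κ * σ ^ 2) = (σ + t * Complex.I) * w + κ * (σ + t * Complex.I) ^ 2 := fun t => by
    linear_combination -(κ : ℂ) * t ^ 2 * Complex.I_sq
  simp_rw [e1] at h
  exact h

/-- The integrand of the smoothed Perron formula. -/
noncomputable def smoothPerron [NeZero q] (χ : DirichletCharacter ℂ q) (κ y : ℝ) (s : ℂ) : ℂ :=
  perronKernel χ s * Complex.exp ((s - 1 / 2) * y + κ * (s - 1 / 2) ^ 2)

theorem smoothSum_eq_integral [NeZero q] (χ : DirichletCharacter ℂ q) {κ : ℝ} (hκ : 0 < κ) (y : ℝ) :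
    2 * Real.pi * smoothSum χ κ y =
      ∫ t : ℝ, smoothPerron χ κ y (2 + t * Complex.I) := by
  have h1 : ∀ t : ℝ, smoothPerron χ κ y (2 + t * Complex.I) =
      ∫ u : ℝ, normSum χ u *
        Complex.exp (((3 / 2 : ℝ) + t * Complex.I) * ((y - u : ℝ) : ℂ) +
          κ * ((3 / 2 : ℝ) + t * Complex.I) ^ 2) := fun t => by
    rw [smoothPerron, perronKernel_eq_integral, ← integral_mul_const]
    refine integral_congr_ae (ae_of_all _ fun u => ?_)
    simp only
    rw [mul_assoc, ← Complex.exp_add]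
    congr 2
    push_cast
    ring
  simp_rw [h1]
  rw [integral_integral_swap]
  · rw [smoothSum, ← integral_const_mul]
    refine integral_congr_ae (ae_of_all _ fun u => ?_)
    simp only
    rw [integral_const_mul, integral_smoothing hκ]
    ring
  · have hI := (integrable_smoothing hκ (3 / 2) y).mul_prod (integrable_normSum_mul_exp χ)
    have := hI.bdd_mul (c := 1)
      (f := fun p : ℝ × ℝ => Complex.exp (((-(p.1 * p.2) : ℝ) : ℂ) * Complex.I))
      (by fun_prop) (ae_of_all _ fun p => by rw [Complex.norm_exp_ofReal_mul_I])
    refine this.congr (ae_of_all _ fun p => ?_)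
    simp only [Function.uncurry]
    rw [mul_comm (Complex.exp ((((3 / 2 : ℝ) : ℂ) + _) * _ + _)), ← mul_assoc, mul_assoc,
      mul_left_comm, mul_assoc, ← Complex.exp_add, ← Complex.exp_add]
    congr 2
    push_cast
    ring

theorem heatKernel_eq {κ : ℝ} (hκ : 0 < κ) (v : ℝ) :
    (2 * √κ : ℝ) * heatKernel κ (2 * √κ * v) =
      (((√Real.pi)⁻¹ * Real.exp (-1 * v ^ 2) : ℝ) : ℂ) := by
  have h1 : (Real.pi / κ : ℂ) ^ (1 / 2 : ℂ) = ((√Real.pi / √κ : ℝ) : ℂ) := by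
    rw [← Real.sqrt_div' _ hκ.le, Real.sqrt_eq_rpow, Complex.ofReal_cpow (by positivity)]
    push_cast
    rfl
  have h2 : -((2 * √κ * v : ℝ) : ℂ) ^ 2 / (4 * κ) = ((-1 * v ^ 2 : ℝ) : ℂ) := by
    rw [← Complex.ofReal_pow, mul_pow, mul_pow, Real.sq_sqrt hκ.le]
    push_cast
    have hk : (κ : ℂ) ≠ 0 := by exact_mod_cast hκ.ne'
    field_simp
    ring
  rw [heatKernel, h1, h2, ← Complex.ofReal_exp]
  norm_cast
  have hs : √κ ≠ 0 := (Real.sqrt_pos.2 hκ).ne'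
  have hp : √Real.pi ≠ 0 := (Real.sqrt_pos.2 Real.pi_pos).ne'
  have := Real.mul_self_sqrt Real.pi_pos.le
  rw [← mul_assoc]
  congr 1
  rw [← one_div, eq_div_iff hp]
  field_simp
  linear_combination this

theorem smoothSum_eq (χ : DirichletCharacter ℂ q) {κ : ℝ} (hκ : 0 < κ) (y : ℝ) :
    smoothSum χ κ y = ∫ v : ℝ, normSum χ (y - 2 * √κ * v) *
      (((√Real.pi)⁻¹ * Real.exp (-1 * v ^ 2) : ℝ) : ℂ) := by
  have hs : 0 < 2 * √κ := by positivity
  rw [smoothSum, ← integral_sub_left_eq_self _ _ y]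
  have := Measure.integral_comp_mul_left
    (fun x : ℝ => normSum χ (y - x) * heatKernel κ (y - (y - x))) (2 * √κ)
  rw [abs_of_pos (inv_pos.2 hs)] at this
  have h2 := congrArg (fun z => (2 * √κ) • z) this
  simp only [smul_smul, mul_inv_cancel₀ hs.ne', one_smul] at h2
  rw [← h2, ← integral_smul]
  refine integral_congr_ae (ae_of_all _ fun v => ?_)
  simp only [sub_sub_cancel]
  rw [← heatKernel_eq hκ, Complex.real_smul]
  ring

theorem tendsto_smoothSum (χ : DirichletCharacter ℂ q) {y : ℝ}
    (hy : ContinuousAt (normSum χ) y) :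
    Tendsto (fun κ : ℝ => smoothSum χ κ y) (𝓝[>] 0) (𝓝 (normSum χ y)) := by
  have hG : ∫ v : ℝ, normSum χ y * (((√Real.pi)⁻¹ * Real.exp (-1 * v ^ 2) : ℝ) : ℂ) =
      normSum χ y := by
    rw [integral_const_mul, integral_complex_ofReal, integral_const_mul, integral_gaussian, div_one,
      inv_mul_cancel₀ (Real.sqrt_pos.2 Real.pi_pos).ne', Complex.ofReal_one, mul_one]
  rw [← hG]
  have hbound : Integrable fun v : ℝ =>
      Real.exp (y / 2) * (√Real.pi)⁻¹ * Real.exp (-(1 / 2) * v ^ 2 + 1 / 2) := by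
    refine Integrable.const_mul ?_ _
    simp_rw [Real.exp_add]
    exact (integrable_exp_neg_mul_sq (by norm_num)).mul_const _
  refine Tendsto.congr' (f₁ := fun κ : ℝ => ∫ v : ℝ, normSum χ (y - 2 * √κ * v) *
      (((√Real.pi)⁻¹ * Real.exp (-1 * v ^ 2) : ℝ) : ℂ)) ?_ ?_
  · filter_upwards [self_mem_nhdsWithin] with κ hκ using (smoothSum_eq χ hκ y).symm
  · refine tendsto_integral_filter_of_dominated_convergence _ ?_ ?_ hbound ?_
    · refine Eventually.of_forall fun κ => ?_
      exact ((measurable_normSum χ).comp (by fun_prop)).aestronglyMeasurable.mul (by fun_prop)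
    · have : ∀ᶠ κ : ℝ in 𝓝[>] 0, κ < 1 := nhdsWithin_le_nhds (gt_mem_nhds one_pos)
      filter_upwards [this, self_mem_nhdsWithin] with κ hκ hκ0
      refine ae_of_all _ fun v => ?_
      have hκ0' : (0 : ℝ) < κ := hκ0
      have hs1 : √κ ≤ 1 := Real.sqrt_le_one.2 hκ.le
      have hs0 : 0 ≤ √κ := Real.sqrt_nonneg κ
      rw [norm_mul, Complex.norm_real, Real.norm_of_nonneg (by positivity)]
      calc _ ≤ Real.exp ((y - 2 * √κ * v) / 2) * ((√Real.pi)⁻¹ * Real.exp (-1 * v ^ 2)) := by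
            gcongr
            exact norm_normSum_le χ _
        _ = (√Real.pi)⁻¹ * Real.exp ((y - 2 * √κ * v) / 2 + -1 * v ^ 2) := by
            rw [Real.exp_add]; ring
        _ ≤ (√Real.pi)⁻¹ * Real.exp (y / 2 + (-(1 / 2) * v ^ 2 + 1 / 2)) := by
            refine mul_le_mul_of_nonneg_left (Real.exp_le_exp.2 ?_) (by positivity)
            nlinarith [sq_nonneg (√κ + v), mul_le_mul hs1 hs1 hs0 zero_le_one]
        _ = _ := by rw [Real.exp_add]; ring
    · refine ae_of_all _ fun v => ?_
      refine Tendsto.mul_const _ ?_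
      have hc : Tendsto (fun κ : ℝ => y - 2 * √κ * v) (𝓝[>] 0) (𝓝 y) := by
        have : Continuous fun κ : ℝ => y - 2 * √κ * v := by fun_prop
        have h := (this.tendsto 0).mono_left (nhdsWithin_le_nhds (s := Set.Ioi 0))
        simpa using h
      exact hy.tendsto.comp hc

end Smoothing

section Contour

variable {q : ℕ} [NeZero q]

/-- The contribution of the vertical line `Re s = 1/1000`. -/
noncomputable def remTerm (χ : DirichletCharacter ℂ q) (κ y : ℝ) : ℂ :=
  (2 * Real.pi : ℂ)⁻¹ * ∫ t : ℝ, smoothPerron χ κ y (((1 / 1000 : ℝ) : ℂ) + t * Complex.I)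

/-- The coefficient of a zero in the explicit formula. -/
noncomputable def zeroCoeff (χ : DirichletCharacter ℂ q) (ρ : ℂ) : ℂ :=
  ((ρ - 1) ^ poleOrder χ / ρ) / deriv (entireL χ) ρ

theorem norm_exp_smoothing (σ t κ y : ℝ) :
    ‖Complex.exp (((σ : ℂ) + t * Complex.I - 1 / 2) * y +
      κ * ((σ : ℂ) + t * Complex.I - 1 / 2) ^ 2)‖ =
      Real.exp ((σ - 1 / 2) * y + κ * ((σ - 1 / 2) ^ 2 - t ^ 2)) := by
  rw [Complex.norm_exp]
  congr 1
  have : ((σ : ℂ) + t * Complex.I - 1 / 2) * y + κ * ((σ : ℂ) + t * Complex.I - 1 / 2) ^ 2 =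
      (((σ - 1 / 2) * y + κ * ((σ - 1 / 2) ^ 2 - t ^ 2) : ℝ) : ℂ) +
        ((t * y + κ * (2 * (σ - 1 / 2) * t) : ℝ) : ℂ) * Complex.I := by
    push_cast
    linear_combination (κ : ℂ) * t ^ 2 * Complex.I_sq
  rw [this, Complex.add_re, Complex.ofReal_re, Complex.re_ofReal_mul, Complex.I_re, mul_zero,
    add_zero]

theorem continuous_smoothPerron {χ : DirichletCharacter ℂ q} {σ : ℝ} (hσ : 0 < σ)
    (h0 : ∀ t : ℝ, entireL χ (σ + t * Complex.I) ≠ 0) (κ y : ℝ) :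
    Continuous fun t : ℝ => smoothPerron χ κ y (σ + t * Complex.I) := by
  have hne0 : ∀ t : ℝ, (σ : ℂ) + t * Complex.I ≠ 0 := fun t ht => by
    have := congrArg Complex.re ht
    simp at this
    linarith
  unfold smoothPerron perronKernel
  have := (differentiable_entireL χ).continuous
  exact (((by fun_prop : Continuous fun t : ℝ =>
      ((σ : ℂ) + t * Complex.I - 1) ^ poleOrder χ).div (by fun_prop) hne0).div
      (by fun_prop) h0).mul (by fun_prop)

theorem entireL_ne_zero_right (χ : DirichletCharacter ℂ q) (t : ℝ) :
    entireL χ (((2 : ℝ) : ℂ) + t * Complex.I) ≠ 0 :=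
  entireL_ne_zero χ (by simp)

theorem GoodZeros.entireL_ne_zero_left {χ : DirichletCharacter ℂ q} (h : GoodZeros χ) (t : ℝ) :
    entireL χ (((1 / 1000 : ℝ) : ℂ) + t * Complex.I) ≠ 0 := fun h0 => by
  have hre : (((1 / 1000 : ℝ) : ℂ) + t * Complex.I).re = 1 / 1000 := by simp
  have := h.re_eq _ ((entireL_eq_zero_iff_mem χ (by rw [hre]; norm_num)).1 h0)
  rw [hre] at this
  norm_num at this

theorem integrable_smoothPerron_right (χ : DirichletCharacter ℂ q) {κ : ℝ} (hκ : 0 < κ) (y : ℝ) :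
    Integrable fun t : ℝ => smoothPerron χ κ y (((2 : ℝ) : ℂ) + t * Complex.I) := by
  obtain ⟨c, hc, H⟩ := exists_norm_LFunction_ge (q := q) (σ := 2) one_lt_two
  refine ((integrable_smoothing hκ (3 / 2) y).norm.const_mul (1 / (2 * c))).mono'
    (continuous_smoothPerron two_pos (entireL_ne_zero_right χ) κ y).aestronglyMeasurable
    (ae_of_all _ fun t => ?_)
  have hre : (((2 : ℝ) : ℂ) + t * Complex.I).re = 2 := by simp
  rw [smoothPerron, norm_mul, perronKernel_eq χ (fun h => by rw [h] at hre; norm_num at hre)]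
  have e : (((2 : ℝ) : ℂ) + t * Complex.I - 1 / 2) = ((3 / 2 : ℝ) : ℂ) + t * Complex.I := by
    push_cast; ring
  rw [e, norm_div, norm_one, norm_mul]
  refine mul_le_mul_of_nonneg_right (one_div_le_one_div_of_le (by positivity) ?_) (norm_nonneg _)
  refine mul_le_mul ?_ (H χ _ hre.ge).1 hc.le (norm_nonneg _)
  have := Complex.abs_re_le_norm (((2 : ℝ) : ℂ) + t * Complex.I)
  rwa [hre, abs_two] at this

theorem GoodZeros.exists_norm_smoothPerron_left_le {χ : DirichletCharacter ℂ q}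
    (h : GoodZeros χ) (h' : GoodZeros χ⁻¹) : ∃ C : ℝ, 0 < C ∧ ∀ κ ∈ Set.Icc (0 : ℝ) 1, ∀ y t : ℝ,
      ‖smoothPerron χ κ y (((1 / 1000 : ℝ) : ℂ) + t * Complex.I)‖ ≤
        C * Real.exp (-(499 / 1000) * y) * (1 + ‖t‖) ^ (-(9 / 8) : ℝ) := by
  obtain ⟨C, hC, H⟩ := h.exists_norm_perronKernel_le h'
  refine ⟨C * Real.exp 1, by positivity, fun κ hκ y t => ?_⟩
  rw [smoothPerron, norm_mul, norm_exp_smoothing]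
  have : Real.exp ((1 / 1000 - 1 / 2) * y + κ * ((1 / 1000 - 1 / 2) ^ 2 - t ^ 2)) ≤
      Real.exp (1 + -(499 / 1000) * y) := by
    refine Real.exp_le_exp.2 ?_
    nlinarith [hκ.1, hκ.2, mul_nonneg hκ.1 (sq_nonneg t)]
  rw [Real.exp_add 1] at this
  calc _ ≤ C * (1 + ‖t‖) ^ (-(9 / 8) : ℝ) * (Real.exp 1 * Real.exp (-(499 / 1000) * y)) := by
        refine mul_le_mul (H t) this (Real.exp_pos _).le (by positivity)
    _ = _ := by ring

theorem integrable_one_add_norm_rpow :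
    Integrable fun t : ℝ => (1 + ‖t‖) ^ (-(9 / 8) : ℝ) :=
  integrable_one_add_norm (by simp; norm_num)

theorem GoodZeros.integrable_smoothPerron_left {χ : DirichletCharacter ℂ q}
    (h : GoodZeros χ) (h' : GoodZeros χ⁻¹) {κ : ℝ} (hκ : κ ∈ Set.Icc (0 : ℝ) 1) (y : ℝ) :
    Integrable fun t : ℝ => smoothPerron χ κ y (((1 / 1000 : ℝ) : ℂ) + t * Complex.I) := by
  obtain ⟨C, hC, H⟩ := h.exists_norm_smoothPerron_left_le h'
  exact (integrable_one_add_norm_rpow.const_mul _).mono'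
    (continuous_smoothPerron (by norm_num) h.entireL_ne_zero_left κ y).aestronglyMeasurable
    (ae_of_all _ fun t => H κ hκ y t)

theorem GoodZeros.exists_norm_remTerm_le {χ : DirichletCharacter ℂ q}
    (h : GoodZeros χ) (h' : GoodZeros χ⁻¹) : ∃ C : ℝ, 0 < C ∧ ∀ κ ∈ Set.Icc (0 : ℝ) 1, ∀ y : ℝ,
      ‖remTerm χ κ y‖ ≤ C * Real.exp (-(499 / 1000) * y) := by
  obtain ⟨C, hC, H⟩ := h.exists_norm_smoothPerron_left_le h'
  set J := ∫ t : ℝ, (1 + ‖t‖) ^ (-(9 / 8) : ℝ) with hJ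
  have hJ0 : 0 ≤ J := integral_nonneg fun t => by positivity
  refine ⟨(2 * Real.pi)⁻¹ * (C * (J + 1)), by positivity, fun κ hκ y => ?_⟩
  have h1 := norm_integral_le_of_norm_le
    (integrable_one_add_norm_rpow.const_mul (C * Real.exp (-(499 / 1000) * y)))
    (ae_of_all _ fun t => H κ hκ y t)
  rw [integral_const_mul, ← hJ] at h1
  have h2 : ‖(2 * Real.pi : ℂ)⁻¹‖ = (2 * Real.pi)⁻¹ := by
    rw [norm_inv, norm_mul, Complex.norm_real, Real.norm_of_nonneg Real.pi_pos.le]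
    simp
  rw [remTerm, norm_mul, h2, mul_assoc (2 * Real.pi)⁻¹]
  refine mul_le_mul_of_nonneg_left (h1.trans ?_) (by positivity)
  have : 0 ≤ C * Real.exp (-(499 / 1000) * y) := by positivity
  nlinarith

theorem GoodZeros.tendsto_remTerm {χ : DirichletCharacter ℂ q}
    (h : GoodZeros χ) (h' : GoodZeros χ⁻¹) (y : ℝ) :
    Tendsto (fun κ : ℝ => remTerm χ κ y) (𝓝[>] 0) (𝓝 (remTerm χ 0 y)) := by
  obtain ⟨C, hC, H⟩ := h.exists_norm_smoothPerron_left_le h'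
  refine Tendsto.const_mul _ (tendsto_integral_filter_of_dominated_convergence _ ?_ ?_
    (integrable_one_add_norm_rpow.const_mul (C * Real.exp (-(499 / 1000) * y))) ?_)
  · exact Eventually.of_forall fun κ =>
      (continuous_smoothPerron (by norm_num) h.entireL_ne_zero_left κ y).aestronglyMeasurable
  · have : ∀ᶠ κ : ℝ in 𝓝[>] 0, κ < 1 := nhdsWithin_le_nhds (gt_mem_nhds one_pos)
    filter_upwards [this, self_mem_nhdsWithin] with κ hκ hκ0
    exact ae_of_all _ fun t => H κ ⟨le_of_lt hκ0, hκ.le⟩ y t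
  · refine ae_of_all _ fun t => ?_
    have : Continuous fun κ : ℝ =>
        smoothPerron χ κ y (((1 / 1000 : ℝ) : ℂ) + t * Complex.I) := by
      unfold smoothPerron
      fun_prop
    exact (this.tendsto 0).mono_left nhdsWithin_le_nhds

theorem GoodZeros.continuous_remTerm {χ : DirichletCharacter ℂ q}
    (h : GoodZeros χ) (h' : GoodZeros χ⁻¹) : Continuous (remTerm χ 0) := by
  obtain ⟨C, hC, H⟩ := h.exists_norm_smoothPerron_left_le h'
  refine continuous_iff_continuousAt.2 fun y => ?_
  refine Tendsto.const_mul _ (tendsto_integral_filter_of_dominated_convergence _ ?_ ?_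
    (integrable_one_add_norm_rpow.const_mul (C * Real.exp (-(499 / 1000) * (y - 1)))) ?_)
  · exact Eventually.of_forall fun z =>
      (continuous_smoothPerron (by norm_num) h.entireL_ne_zero_left 0 z).aestronglyMeasurable
  · filter_upwards [lt_mem_nhds (show y - 1 < y by linarith)] with z hz
    refine ae_of_all _ fun t => (H 0 ⟨le_rfl, zero_le_one⟩ z t).trans ?_
    gcongr ?_ * ?_ * ?_
    · exact Real.exp_le_exp.2 (by linarith)
  · refine ae_of_all _ fun t => ?_
    have : Continuous fun z : ℝ =>
        smoothPerron χ 0 z (((1 / 1000 : ℝ) : ℂ) + t * Complex.I) := by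
      unfold smoothPerron
      fun_prop
    exact this.tendsto y

end Contour

section ExplicitFormula

variable {q : ℕ} [NeZero q]

theorem norm_smoothPerron_le (χ : DirichletCharacter ℂ q) {κ y x T E N : ℝ} (hκ : 0 ≤ κ)
    (hx : x ∈ Set.Icc (1 / 1000 : ℝ) 2) (hN : 0 ≤ N) (hT : N ≤ |T|)
    (hE : Real.exp (-E) ≤ ‖entireL χ (x + T * Complex.I)‖) :
    ‖smoothPerron χ κ y (x + T * Complex.I)‖ ≤
      1001 * Real.exp (E + (2 * |y| + κ * (3 - N ^ 2))) := by
  have hs : 1 / 1000 ≤ ‖(x : ℂ) + T * Complex.I‖ := by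
    have := Complex.re_le_norm ((x : ℂ) + T * Complex.I)
    simp at this
    linarith [hx.1]
  have hP : ‖((x : ℂ) + T * Complex.I - 1) ^ poleOrder χ / (x + T * Complex.I)‖ ≤ 1001 := by
    rw [norm_div, norm_pow, div_le_iff₀ (by linarith)]
    rcases Nat.le_one_iff_eq_zero_or_eq_one.1 (poleOrder_le χ) with hk | hk <;> rw [hk]
    · rw [pow_zero]; linarith
    · rw [pow_one]
      have := norm_sub_le ((x : ℂ) + T * Complex.I) 1
      rw [norm_one] at this
      linarith
  have hG : ‖Complex.exp (((x : ℂ) + T * Complex.I - 1 / 2) * y +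
      κ * ((x : ℂ) + T * Complex.I - 1 / 2) ^ 2)‖ ≤
      Real.exp (2 * |y| + κ * (3 - N ^ 2)) := by
    rw [norm_exp_smoothing]
    refine Real.exp_le_exp.2 (add_le_add ?_ (mul_le_mul_of_nonneg_left ?_ hκ))
    · refine (le_abs_self _).trans ?_
      rw [abs_mul]
      gcongr
      rw [abs_le]
      constructor <;> linarith [hx.1, hx.2]
    · have : N ^ 2 ≤ T ^ 2 := by rw [← sq_abs T]; gcongr
      nlinarith [hx.1, hx.2]
  have hinv : ‖entireL χ (x + T * Complex.I)‖⁻¹ ≤ Real.exp E := by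
    rw [← inv_inv (Real.exp E), ← Real.exp_neg]
    exact inv_anti₀ (Real.exp_pos _) hE
  rw [smoothPerron, perronKernel, norm_mul, norm_div, div_eq_mul_inv, Real.exp_add E, ← mul_assoc]
  gcongr

theorem GoodZeros.exists_explicit_formula {χ : DirichletCharacter ℂ q} (h : GoodZeros χ)
    (h' : GoodZeros χ⁻¹) : ∃ S : ℕ → Finset ℂ, (∀ n, ∀ ρ ∈ S n, ρ ∈ stripZeros χ) ∧
      (∀ ρ ∈ stripZeros χ, ∀ᶠ n in atTop, ρ ∈ S n) ∧
      ∀ κ ∈ Set.Ioc (0 : ℝ) 1, ∀ y : ℝ,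
        Tendsto (fun n => ∑ ρ ∈ S n, zeroCoeff χ ρ *
          Complex.exp ((ρ - 1 / 2) * y + κ * (ρ - 1 / 2) ^ 2)) atTop
        (𝓝 (smoothSum χ κ y - remTerm χ κ y)) := by
  classical
  obtain ⟨B, hB, HB⟩ := exists_good_height (q := q)
  choose T hT hTl using fun n : ℕ => HB χ h (n : ℝ)
  choose T' hT' hTl' using fun n : ℕ => HB χ h (-(n : ℝ) - 1)
  refine ⟨fun n => (h.finite_zeros (n + 1)).toFinset.filter
    (fun ρ => T' n < ρ.im ∧ ρ.im < T n), ?_, ?_, ?_⟩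
  · intro n ρ hρ
    simp only [Finset.mem_filter, Set.Finite.mem_toFinset, Set.mem_ofPred_eq] at hρ
    exact hρ.1.1
  · intro ρ hρ
    filter_upwards [eventually_gt_atTop ⌈|ρ.im|⌉₊] with n hn
    have hn' : |ρ.im| < n := Nat.lt_of_ceil_lt hn
    have := abs_lt.1 hn'
    simp only [Finset.mem_filter, Set.Finite.mem_toFinset, Set.mem_ofPred_eq]
    exact ⟨⟨hρ, by linarith⟩, by linarith [(hT' n).2], by linarith [(hT n).1]⟩
  · intro κ hκ y
    set S : ℕ → Finset ℂ := fun n => (h.finite_zeros (n + 1)).toFinset.filter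
      (fun ρ => T' n < ρ.im ∧ ρ.im < T n) with hS
    have hTT : ∀ n, T' n ≤ T n := fun n => by
      have := (hT' n).2
      have := (hT n).1
      have : (0 : ℝ) ≤ n := n.cast_nonneg
      linarith
    set U : Set ℂ := {s | 0 < s.re} with hU
    have hUo : IsOpen U := isOpen_lt continuous_const Complex.continuous_re
    set m : ℂ → ℂ := fun s => (s - 1) ^ poleOrder χ / s *
      Complex.exp ((s - 1 / 2) * y + κ * (s - 1 / 2) ^ 2) with hm
    have hmd : DifferentiableOn ℂ m U := by
      have hne : ∀ s ∈ U, s ≠ 0 := fun s hs h0 => by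
        rw [h0] at hs
        simp [hU] at hs
      exact ((by fun_prop : DifferentiableOn ℂ (fun s : ℂ => (s - 1) ^ poleOrder χ) U).div
        (by fun_prop) hne).mul (by fun_prop)
    have hmf : (fun s => m s / entireL χ s) = smoothPerron χ κ y := by
      funext s
      simp only [hm, smoothPerron, perronKernel]
      ring
    have key : ∀ n, rectIntegral (smoothPerron χ κ y) (1 / 1000) 2 (T' n) (T n) =
        2 * Real.pi * Complex.I * ∑ ρ ∈ S n, zeroCoeff χ ρ *
          Complex.exp ((ρ - 1 / 2) * y + κ * (ρ - 1 / 2) ^ 2) := by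
      intro n
      have hmem : ∀ ρ, ρ ∈ S n ↔ (ρ ∈ Set.Icc (1 / 1000 : ℝ) 2 ×ℂ Set.Icc (T' n) (T n) ∧
          entireL χ ρ = 0) := by
        intro ρ
        simp only [hS, Finset.mem_filter, Set.Finite.mem_toFinset, Set.mem_ofPred_eq,
          Complex.mem_reProdIm, Set.mem_Icc]
        constructor
        · rintro ⟨⟨h1, h2⟩, h3, h4⟩
          have hre := h.re_eq ρ h1
          refine ⟨⟨⟨by rw [hre]; norm_num, by rw [hre]; norm_num⟩, h3.le, h4.le⟩,
            (entireL_eq_zero_iff_mem χ (by rw [hre]; norm_num)).2 h1⟩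
        · rintro ⟨⟨⟨h1, h2⟩, h3, h4⟩, h5⟩
          have hz := (entireL_eq_zero_iff_mem χ (by linarith)).1 h5
          have hdec : ρ = (ρ.re : ℂ) + ρ.im * Complex.I := (Complex.re_add_im ρ).symm
          refine ⟨⟨hz, ?_⟩, lt_of_le_of_ne h3 ?_, lt_of_le_of_ne h4 ?_⟩
          · rw [abs_le]
            constructor <;> linarith [(hT n).2, (hT' n).1]
          · intro he
            have := hTl' n ρ.re ⟨h1, h2⟩
            rw [he, ← hdec, h5, norm_zero] at this
            exact absurd this (not_le.2 (Real.exp_pos _))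
          · intro he
            have := hTl n ρ.re ⟨h1, h2⟩
            rw [← he, ← hdec, h5, norm_zero] at this
            exact absurd this (not_le.2 (Real.exp_pos _))
      have hzer : ∀ ρ ∈ S n, ρ ∈ stripZeros χ ∧ T' n < ρ.im ∧ ρ.im < T n := by
        intro ρ hρ
        simp only [hS, Finset.mem_filter, Set.Finite.mem_toFinset, Set.mem_ofPred_eq] at hρ
        exact ⟨hρ.1.1, hρ.2⟩
      have hr := rectIntegral_div hUo (m := m) (f := entireL χ) (a := 1 / 1000) (b := 2)
        (c := T' n) (d := T n) (by norm_num) (hTT n)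
        (fun s hs => by
          have := (Complex.mem_reProdIm.1 hs).1.1
          simp only [hU, Set.mem_ofPred_eq]
          linarith) hmd (differentiable_entireL χ).differentiableOn (S n) hmem
        (fun ρ hρ => by
          obtain ⟨h1, h2, h3⟩ := hzer ρ hρ
          rw [h.re_eq ρ h1]
          exact ⟨by norm_num, by norm_num, h2, h3⟩)
        (fun ρ hρ => h.deriv_entireL_ne (hzer ρ hρ).1)
      rw [hmf] at hr
      rw [hr]
      congr 1
      refine Finset.sum_congr rfl fun ρ _ => ?_
      simp only [hm, zeroCoeff]
      ring
    have hTtop : Tendsto T atTop atTop :=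
      tendsto_atTop_mono (fun n => (hT n).1) (tendsto_natCast_atTop_atTop (R := ℝ))
    have hTbot : Tendsto T' atTop atBot :=
      tendsto_atBot_mono (fun n => (by linarith [(hT' n).2] : T' n ≤ -(n : ℝ)))
        (tendsto_neg_atTop_atBot.comp (tendsto_natCast_atTop_atTop (R := ℝ)))
    have hright : Tendsto (fun n => ∫ t in (T' n)..(T n),
        smoothPerron χ κ y (((2 : ℝ) : ℂ) + t * Complex.I)) atTop
        (𝓝 (∫ t : ℝ, smoothPerron χ κ y (((2 : ℝ) : ℂ) + t * Complex.I))) := by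
      refine intervalIntegral_tendsto_integral (integrable_smoothPerron_right χ hκ.1 y) ?_ ?_
      · exact hTbot
      · exact hTtop
    have hleft : Tendsto (fun n => ∫ t in (T' n)..(T n),
        smoothPerron χ κ y (((1 / 1000 : ℝ) : ℂ) + t * Complex.I)) atTop
        (𝓝 (∫ t : ℝ, smoothPerron χ κ y (((1 / 1000 : ℝ) : ℂ) + t * Complex.I))) := by
      refine intervalIntegral_tendsto_integral
        (h.integrable_smoothPerron_left h' ⟨hκ.1.le, hκ.2⟩ y) ?_ ?_
      · exact hTbot
      · exact hTtop
    have hbnd : Tendsto (fun n : ℕ => 1001 * Real.exp (B * (6 + n) +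
        (2 * |y| + κ * (3 - (n : ℝ) ^ 2))) * |2 - 1 / 1000|) atTop (𝓝 0) := by
      have h1 : Tendsto (fun n : ℕ => (n : ℝ) * (B - κ * n)) atTop atBot := by
        refine Tendsto.atTop_mul_atBot₀ tendsto_natCast_atTop_atTop ?_
        refine tendsto_atBot_add_const_left _ B (f := fun n : ℕ => -(κ * n)) ?_
        exact tendsto_neg_atTop_atBot.comp
          (Tendsto.const_mul_atTop hκ.1 tendsto_natCast_atTop_atTop)
      have h2 := tendsto_atBot_add_const_right _ (B * 6 + 2 * |y| + κ * 3) h1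
      have h3 := ((Real.tendsto_exp_atBot.comp h2).const_mul 1001).mul_const |(2 : ℝ) - 1 / 1000|
      rw [mul_zero, zero_mul] at h3
      refine h3.congr fun n => ?_
      simp only [Function.comp]
      congr 3
      ring
    have htop : Tendsto (fun n => ∫ x in (1 / 1000 : ℝ)..2,
        smoothPerron χ κ y (x + T n * Complex.I)) atTop (𝓝 0) := by
      refine squeeze_zero_norm (fun n => intervalIntegral.norm_integral_le_of_norm_le_const
        fun x hx => ?_) hbnd
      rw [Set.uIoc_of_le (by norm_num)] at hx
      have hn : (0 : ℝ) ≤ n := n.cast_nonneg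
      refine norm_smoothPerron_le χ hκ.1.le ⟨hx.1.le, hx.2⟩ hn
        ((hT n).1.trans (le_abs_self _)) (le_trans (Real.exp_le_exp.2 ?_) (hTl n x ⟨hx.1.le, hx.2⟩))
      rw [abs_of_nonneg hn]
      nlinarith
    have hbot : Tendsto (fun n => ∫ x in (1 / 1000 : ℝ)..2,
        smoothPerron χ κ y (x + T' n * Complex.I)) atTop (𝓝 0) := by
      refine squeeze_zero_norm (fun n => intervalIntegral.norm_integral_le_of_norm_le_const
        fun x hx => ?_) hbnd
      rw [Set.uIoc_of_le (by norm_num)] at hx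
      have hn : (0 : ℝ) ≤ n := n.cast_nonneg
      refine norm_smoothPerron_le χ hκ.1.le ⟨hx.1.le, hx.2⟩ hn
        (le_trans (by linarith [(hT' n).2]) (neg_le_abs _))
        (le_trans (Real.exp_le_exp.2 ?_) (hTl' n x ⟨hx.1.le, hx.2⟩))
      rw [abs_of_nonpos (by linarith)]
      nlinarith
    have hpi : (2 * Real.pi : ℂ) ≠ 0 := by
      exact_mod_cast (mul_pos two_pos Real.pi_pos).ne'
    have hfin := ((((hbot.sub htop).add (hright.const_mul Complex.I)).sub
      (hleft.const_mul Complex.I)).const_mul (2 * Real.pi * Complex.I)⁻¹)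
    have hright' : ∫ t : ℝ, smoothPerron χ κ y (((2 : ℝ) : ℂ) + t * Complex.I) =
        2 * Real.pi * smoothSum χ κ y := by
      rw [smoothSum_eq_integral χ hκ.1]
      push_cast
      rfl
    rw [hright'] at hfin
    have hlim : (2 * Real.pi * Complex.I)⁻¹ * (0 - 0 + Complex.I * (2 * Real.pi * smoothSum χ κ y) -
        Complex.I * ∫ t : ℝ, smoothPerron χ κ y (((1 / 1000 : ℝ) : ℂ) + t * Complex.I)) =
        smoothSum χ κ y - remTerm χ κ y := by
      rw [remTerm]
      have hI := Complex.I_ne_zero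
      field_simp
      ring
    rw [hlim] at hfin
    refine hfin.congr fun n => ?_
    have hk := key n
    rw [rectIntegral] at hk
    rw [inv_mul_eq_iff_eq_mul₀ (mul_ne_zero hpi Complex.I_ne_zero), ← hk]

end ExplicitFormula

section Conjugation

variable {q : ℕ}

open ComplexConjugate

theorem LSeries_inv_char_conj (χ : DirichletCharacter ℂ q) (s : ℂ) :
    LSeries (fun n => χ⁻¹ n) s = conj (LSeries (fun n => χ n) (conj s)) := by
  unfold LSeries
  rw [Complex.conj_tsum]
  refine tsum_congr fun n => ?_
  rcases eq_or_ne n 0 with rfl | hn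
  · simp
  · rw [LSeries.term_of_ne_zero hn, LSeries.term_of_ne_zero hn, map_div₀, ← MulChar.star_apply',
      Complex.cpow_conj _ _ (by rw [Complex.natCast_arg]; exact Real.pi_pos.ne)]
    simp

variable [NeZero q]

theorem poleOrder_inv (χ : DirichletCharacter ℂ q) : poleOrder χ⁻¹ = poleOrder χ := by
  simp [poleOrder, inv_eq_one]

theorem entireL_inv (χ : DirichletCharacter ℂ q) (s : ℂ) :
    entireL χ⁻¹ s = conj (entireL χ (conj s)) := by
  have h1 : Differentiable ℂ (conj ∘ entireL χ ∘ conj) := fun s =>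
    by simpa using (differentiable_entireL χ (conj s)).conj_conj
  have h2 := h1.differentiableOn.analyticOnNhd isOpen_univ
  have h3 := (differentiable_entireL χ⁻¹).differentiableOn.analyticOnNhd isOpen_univ
  have h4 : entireL χ⁻¹ = conj ∘ entireL χ ∘ conj := by
    refine h3.eq_of_eventuallyEq h2 (z₀ := 2) ?_
    have hopen : IsOpen {s : ℂ | 1 < s.re} := isOpen_lt continuous_const Complex.continuous_re
    filter_upwards [hopen.mem_nhds (by simp : (2 : ℂ) ∈ {s : ℂ | 1 < s.re})] with s hs
    have hs' : 1 < s.re := hs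
    have hs1 : s ≠ 1 := fun h => by rw [h] at hs'; simp at hs'
    have hs2 : conj s ≠ 1 := fun h => by
      have := congrArg Complex.re h
      simp at this; linarith
    rw [Function.comp_apply, Function.comp_apply, entireL_eq _ hs1, entireL_eq _ hs2,
      DirichletCharacter.LFunction_eq_LSeries _ hs',
      DirichletCharacter.LFunction_eq_LSeries _ (by simpa using hs'), LSeries_inv_char_conj,
      poleOrder_inv]
    simp
  exact congrFun h4 s

theorem conj_mem_stripZeros {χ : DirichletCharacter ℂ q} {ρ : ℂ} (h : ρ ∈ stripZeros χ) :
    conj ρ ∈ stripZeros χ⁻¹ := by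
  rw [← entireL_eq_zero_iff_mem _ (by simpa using h.2.1), entireL_inv, Complex.conj_conj,
    (entireL_eq_zero_iff_mem χ h.2.1).2 h, map_zero]

theorem zeroCoeff_inv (χ : DirichletCharacter ℂ q) (ρ : ℂ) :
    zeroCoeff χ⁻¹ (conj ρ) = conj (zeroCoeff χ ρ) := by
  have h : entireL χ⁻¹ = conj ∘ entireL χ ∘ conj := funext fun s => entireL_inv χ s
  have h1 : deriv (entireL χ⁻¹) (conj ρ) = conj (deriv (entireL χ) ρ) := by
    rw [h]
    simp
  simp only [zeroCoeff, h1, poleOrder_inv]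
  simp

end Conjugation

section Existence

variable {q : ℕ} [NeZero q]

theorem GoodZeros.stripZeros_nonempty {χ : DirichletCharacter ℂ q} (h : GoodZeros χ)
    (h' : GoodZeros χ⁻¹) : (stripZeros χ).Nonempty := by
  by_contra hne
  rw [Set.not_nonempty_iff_eq_empty] at hne
  obtain ⟨S, hS, -, hlim⟩ := h.exists_explicit_formula h'
  have hS0 : ∀ n, S n = ∅ := fun n => Finset.eq_empty_of_forall_notMem fun ρ hρ => by
    have := hS n ρ hρ
    rw [hne] at this
    exact this
  have heq : ∀ κ ∈ Set.Ioc (0 : ℝ) 1, ∀ y : ℝ, smoothSum χ κ y = remTerm χ κ y := by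
    intro κ hκ y
    have h1 := hlim κ hκ y
    simp only [hS0, Finset.sum_empty] at h1
    exact (sub_eq_zero.1 (tendsto_nhds_unique h1 tendsto_const_nhds))
  have hae : normSum χ =ᵐ[volume] remTerm χ 0 := by
    filter_upwards [ae_continuousAt_normSum χ] with y hy
    refine tendsto_nhds_unique ((tendsto_smoothSum χ hy).congr' ?_) (h.tendsto_remTerm h' y)
    filter_upwards [Ioc_mem_nhdsGT (zero_lt_one (α := ℝ))] with κ hκ using heq κ hκ y
  have hc := h.continuous_remTerm h'
  have hl : Set.EqOn (remTerm χ 0) (fun _ => 0) (Set.Ioo (-1) 0) := by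
    refine Measure.eqOn_open_of_ae_eq (μ := volume) ?_ isOpen_Ioo hc.continuousOn
      continuousOn_const
    filter_upwards [ae_restrict_of_ae hae, ae_restrict_mem measurableSet_Ioo] with y hy hm
    rw [← hy, normSum_of_neg χ hm.2]
  have hlog : (0 : ℝ) < Real.log 2 := Real.log_pos (by norm_num)
  have hr : Set.EqOn (remTerm χ 0) (fun u => (Real.exp (-u / 2) : ℂ))
      (Set.Ioo 0 (Real.log 2)) := by
    refine Measure.eqOn_open_of_ae_eq (μ := volume) ?_ isOpen_Ioo hc.continuousOn
      (by fun_prop)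
    filter_upwards [ae_restrict_of_ae hae, ae_restrict_mem measurableSet_Ioo] with y hy hm
    rw [← hy, normSum_of_mem_Ico χ hm.1.le hm.2]
  have h0 := hl.closure hc continuous_const
    (by rw [closure_Ioo (by norm_num)]; simp : (0 : ℝ) ∈ closure (Set.Ioo (-1) 0))
  have h1 := hr.closure hc (by fun_prop)
    (by rw [closure_Ioo hlog.ne]; simp [hlog.le] : (0 : ℝ) ∈ closure (Set.Ioo 0 (Real.log 2)))
  rw [h0] at h1
  simp at h1

end Existence

section LargeSieve

open ComplexConjugate

theorem integrable_gaussian_oscillation (V δ : ℝ) : Integrable fun y : ℝ =>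
    Complex.exp (-1 * (y : ℂ) ^ 2 + (2 * V + Complex.I * δ) * y + -(V : ℂ) ^ 2) :=
  integrable_cexp_quadratic' (by simp) _ _

theorem norm_integral_gaussian_oscillation (V δ : ℝ) :
    ‖∫ y : ℝ, Complex.exp (-1 * (y : ℂ) ^ 2 + (2 * V + Complex.I * δ) * y + -(V : ℂ) ^ 2)‖ =
      √Real.pi * Real.exp (-δ ^ 2 / 4) := by
  rw [integral_cexp_quadratic (by simp), norm_mul, Complex.norm_exp]
  have h1 : (Real.pi : ℂ) / -(-1) = ((Real.pi : ℝ) : ℂ) := by simp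
  rw [h1, Complex.norm_cpow_eq_rpow_re_of_pos Real.pi_pos, Real.sqrt_eq_rpow]
  have h2 : -(V : ℂ) ^ 2 - (2 * V + Complex.I * δ) ^ 2 / (4 * -1) =
      ((-δ ^ 2 / 4 : ℝ) : ℂ) + ((V * δ : ℝ) : ℂ) * Complex.I := by
    push_cast
    linear_combination (δ : ℂ) ^ 2 / 4 * Complex.I_sq
  rw [h2, Complex.add_re, Complex.ofReal_re, Complex.re_ofReal_mul]
  simp

variable {ι : Type*}

theorem integral_gaussian_expSum_le (S : Finset ι) (a : ι → ℂ) (γ : ι → ℝ) (V : ℝ) :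
    ∫ y : ℝ, Real.exp (-(y - V) ^ 2) * ‖∑ i ∈ S, a i * Complex.exp (Complex.I * γ i * y)‖ ^ 2 ≤
      √Real.pi * ∑ i ∈ S, ∑ j ∈ S, ‖a i‖ * ‖a j‖ * Real.exp (-(γ i - γ j) ^ 2 / 4) := by
  have h1 : ∀ y : ℝ, ((Real.exp (-(y - V) ^ 2) *
      ‖∑ i ∈ S, a i * Complex.exp (Complex.I * γ i * y)‖ ^ 2 : ℝ) : ℂ) =
      ∑ i ∈ S, ∑ j ∈ S, a i * conj (a j) * Complex.exp (-1 * (y : ℂ) ^ 2 +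
        (2 * V + Complex.I * (γ i - γ j : ℝ)) * y + -(V : ℂ) ^ 2) := by
    intro y
    push_cast
    rw [← Complex.mul_conj', map_sum, Finset.sum_mul_sum, Finset.mul_sum]
    refine Finset.sum_congr rfl fun i _ => ?_
    rw [Finset.mul_sum]
    refine Finset.sum_congr rfl fun j _ => ?_
    rw [map_mul, ← Complex.exp_conj]
    have e : -1 * (y : ℂ) ^ 2 + (2 * V + Complex.I * (γ i - γ j)) * y + -(V : ℂ) ^ 2 =
        -(y - V : ℂ) ^ 2 + (Complex.I * γ i * y + conj (Complex.I * γ j * y)) := by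
      simp
      ring
    rw [e, Complex.exp_add, Complex.exp_add]
    ring
  have h2 : ((∫ y : ℝ, Real.exp (-(y - V) ^ 2) *
      ‖∑ i ∈ S, a i * Complex.exp (Complex.I * γ i * y)‖ ^ 2 : ℝ) : ℂ) =
      ∑ i ∈ S, ∑ j ∈ S, a i * conj (a j) * ∫ y : ℝ, Complex.exp (-1 * (y : ℂ) ^ 2 +
        (2 * V + Complex.I * (γ i - γ j : ℝ)) * y + -(V : ℂ) ^ 2) := by
    rw [← integral_complex_ofReal]
    simp_rw [h1]
    rw [integral_finsetSum _ fun i _ => integrable_finsetSum _ fun j _ =>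
      (integrable_gaussian_oscillation V (γ i - γ j)).const_mul _]
    refine Finset.sum_congr rfl fun i _ => ?_
    rw [integral_finsetSum _ fun j _ =>
      (integrable_gaussian_oscillation V (γ i - γ j)).const_mul _]
    refine Finset.sum_congr rfl fun j _ => ?_
    rw [integral_const_mul]
  refine (le_abs_self _).trans ?_
  rw [← Real.norm_eq_abs, ← Complex.norm_real, h2, Finset.mul_sum]
  refine (norm_sum_le _ _).trans (Finset.sum_le_sum fun i _ => ?_)
  rw [Finset.mul_sum]
  refine (norm_sum_le _ _).trans (Finset.sum_le_sum fun j _ => ?_)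
  rw [norm_mul, norm_mul, norm_integral_gaussian_oscillation, RCLike.norm_conj]
  exact le_of_eq (by ring)

theorem integrable_gaussian_expSum (S : Finset ι) (a : ι → ℂ) (γ : ι → ℝ) (V : ℝ) :
    Integrable fun y : ℝ =>
      Real.exp (-(y - V) ^ 2) * ‖∑ i ∈ S, a i * Complex.exp (Complex.I * γ i * y)‖ ^ 2 := by
  have hg : Integrable fun y : ℝ => Real.exp (-(y - V) ^ 2) := by
    have := (integrable_exp_neg_mul_sq (zero_lt_one (α := ℝ))).comp_sub_right V
    simpa using this
  refine hg.mul_bdd (c := (∑ i ∈ S, ‖a i‖) ^ 2) (by fun_prop) (ae_of_all _ fun y => ?_)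
  rw [norm_pow, norm_norm]
  refine pow_le_pow_left₀ (norm_nonneg _) ((norm_sum_le _ _).trans
    (Finset.sum_le_sum fun i _ => ?_)) 2
  rw [norm_mul, Complex.norm_exp]
  simp

theorem integral_norm_sq_expSum_le (S : Finset ι) (a : ι → ℂ) (γ : ι → ℝ) (V : ℝ) :
    ∫ y in Set.Ioc V (V + 1), ‖∑ i ∈ S, a i * Complex.exp (Complex.I * γ i * y)‖ ^ 2 ≤
      Real.exp 1 * √Real.pi *
        ∑ i ∈ S, ‖a i‖ ^ 2 * ∑ j ∈ S, Real.exp (-(γ i - γ j) ^ 2 / 4) := by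
  have hInt := integrable_gaussian_expSum S a γ V
  have h1 : ∫ y in Set.Ioc V (V + 1), ‖∑ i ∈ S, a i * Complex.exp (Complex.I * γ i * y)‖ ^ 2 ≤
      ∫ y in Set.Ioc V (V + 1), Real.exp 1 * (Real.exp (-(y - V) ^ 2) *
        ‖∑ i ∈ S, a i * Complex.exp (Complex.I * γ i * y)‖ ^ 2) := by
    refine setIntegral_mono_on (Continuous.integrableOn_Ioc (by fun_prop))
      (hInt.const_mul _).integrableOn measurableSet_Ioc fun y hy => ?_
    rw [← mul_assoc, ← Real.exp_add]
    refine le_mul_of_one_le_left (by positivity) (Real.one_le_exp ?_)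
    nlinarith [hy.1, hy.2]
  have h2 : ∫ y in Set.Ioc V (V + 1), Real.exp 1 * (Real.exp (-(y - V) ^ 2) *
        ‖∑ i ∈ S, a i * Complex.exp (Complex.I * γ i * y)‖ ^ 2) ≤
      Real.exp 1 * ∫ y : ℝ, Real.exp (-(y - V) ^ 2) *
        ‖∑ i ∈ S, a i * Complex.exp (Complex.I * γ i * y)‖ ^ 2 := by
    rw [integral_const_mul]
    exact mul_le_mul_of_nonneg_left (setIntegral_le_integral hInt
      (ae_of_all _ fun y => by positivity)) (Real.exp_pos 1).le
  have h3 : ∑ i ∈ S, ∑ j ∈ S, ‖a i‖ * ‖a j‖ * Real.exp (-(γ i - γ j) ^ 2 / 4) ≤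
      ∑ i ∈ S, ‖a i‖ ^ 2 * ∑ j ∈ S, Real.exp (-(γ i - γ j) ^ 2 / 4) := by
    have h4 : ∑ i ∈ S, ∑ j ∈ S, ‖a i‖ * ‖a j‖ * Real.exp (-(γ i - γ j) ^ 2 / 4) ≤
        ∑ i ∈ S, ∑ j ∈ S, (‖a i‖ ^ 2 / 2 * Real.exp (-(γ i - γ j) ^ 2 / 4) +
          ‖a j‖ ^ 2 / 2 * Real.exp (-(γ j - γ i) ^ 2 / 4)) := by
      refine Finset.sum_le_sum fun i _ => Finset.sum_le_sum fun j _ => ?_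
      rw [show (γ j - γ i) ^ 2 = (γ i - γ j) ^ 2 by ring, ← add_mul]
      refine mul_le_mul_of_nonneg_right ?_ (Real.exp_pos _).le
      nlinarith [sq_nonneg (‖a i‖ - ‖a j‖)]
    refine h4.trans (le_of_eq ?_)
    simp_rw [Finset.sum_add_distrib]
    rw [Finset.sum_comm (f := fun i j => ‖a j‖ ^ 2 / 2 * Real.exp (-(γ j - γ i) ^ 2 / 4)),
      ← Finset.sum_add_distrib]
    refine Finset.sum_congr rfl fun i _ => ?_
    rw [← Finset.sum_add_distrib, Finset.mul_sum]
    exact Finset.sum_congr rfl fun j _ => by ring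
  have h5 := mul_le_mul_of_nonneg_left
    ((integral_gaussian_expSum_le S a γ V).trans
      (mul_le_mul_of_nonneg_left h3 (Real.sqrt_nonneg _))) (Real.exp_pos 1).le
  rw [← mul_assoc] at h5
  exact h1.trans (h2.trans h5)

end LargeSieve

section ZeroSums

variable {q : ℕ} [NeZero q]

theorem summable_one_add_abs_mul_exp :
    Summable fun k : ℤ => (1 + |(k : ℝ)|) * Real.exp (3 / 2 - |(k : ℝ)|) := by
  have h : Summable fun n : ℕ => (1 + (n : ℝ)) * Real.exp (3 / 2 - n) := by
    have h1 := (Real.summable_pow_mul_exp_neg_nat_mul 0 (zero_lt_one (α := ℝ))).mul_left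
      (Real.exp (3 / 2))
    have h2 := (Real.summable_pow_mul_exp_neg_nat_mul 1 (zero_lt_one (α := ℝ))).mul_left
      (Real.exp (3 / 2))
    refine (h1.add h2).congr fun n => ?_
    rw [sub_eq_add_neg, Real.exp_add]
    simp
    ring
  refine Summable.of_nat_of_neg ?_ ?_
  · simpa using h
  · simpa using h

theorem exists_sum_gaussian_zeros_le : ∃ A : ℝ, 0 < A ∧ ∀ (χ : DirichletCharacter ℂ q),
    GoodZeros χ → ∀ (u : ℝ) (S : Finset ℂ), (∀ ρ ∈ S, ρ ∈ stripZeros χ) →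
    ∑ ρ ∈ S, Real.exp (-(u - ρ.im) ^ 2 / 4) ≤ A * Real.log (5 + |u|) := by
  classical
  obtain ⟨A, hA, h⟩ := exists_card_zeros_le (q := q)
  set W := ∑' k : ℤ, (1 + |(k : ℝ)|) * Real.exp (3 / 2 - |(k : ℝ)|) with hW
  have hWpos : 0 < W := summable_one_add_abs_mul_exp.tsum_pos (fun k => by positivity) 0
    (by positivity)
  refine ⟨A * W, by positivity, fun χ hχ u S hS => ?_⟩
  set k : ℂ → ℤ := fun ρ => round (ρ.im - u) with hk
  rw [← Finset.sum_fiberwise_of_maps_to (g := k) (t := S.image k)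
    fun ρ hρ => Finset.mem_image_of_mem k hρ]
  have hfib : ∀ m ∈ S.image k, ∑ ρ ∈ S with k ρ = m, Real.exp (-(u - ρ.im) ^ 2 / 4) ≤
      A * Real.log (5 + |u|) * ((1 + |(m : ℝ)|) * Real.exp (3 / 2 - |(m : ℝ)|)) := by
    intro m _
    have hnear : ∀ ρ ∈ S.filter (fun ρ => k ρ = m), |ρ.im - u - m| ≤ 1 / 2 := by
      intro ρ hρ
      rw [← (Finset.mem_filter.1 hρ).2]
      exact abs_sub_round _
    have hcard : ((S.filter (fun ρ => k ρ = m)).card : ℝ) ≤ A * Real.log (5 + |u + m|) := by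
      refine h χ hχ (u + m) _ fun ρ hρ => ⟨hS ρ (Finset.mem_filter.1 hρ).1, ?_⟩
      rw [← sub_sub]
      exact hnear ρ hρ
    have hlog : Real.log (5 + |u + m|) ≤ Real.log (5 + |u|) * (1 + |(m : ℝ)|) := by
      have h1 : Real.log (5 + |u + m|) ≤ Real.log ((5 + |u|) * (1 + |(m : ℝ)|)) := by
        refine Real.log_le_log (by positivity) ?_
        nlinarith [abs_add_le u m, abs_nonneg u, abs_nonneg (m : ℝ),
          mul_nonneg (abs_nonneg u) (abs_nonneg (m : ℝ))]
      rw [Real.log_mul (by positivity) (by positivity)] at h1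
      have h2 := Real.log_le_sub_one_of_pos (by positivity : 0 < 1 + |(m : ℝ)|)
      nlinarith [one_le_log_five_add u, abs_nonneg (m : ℝ)]
    have hterm : ∀ ρ ∈ S.filter (fun ρ => k ρ = m), Real.exp (-(u - ρ.im) ^ 2 / 4) ≤
        Real.exp (3 / 2 - |(m : ℝ)|) := by
      intro ρ hρ
      have h1 := hnear ρ hρ
      refine Real.exp_le_exp.2 ?_
      have h2 : |(m : ℝ)| ≤ |ρ.im - u| + 1 / 2 := by
        have := abs_sub_abs_le_abs_sub (m : ℝ) (ρ.im - u)
        rw [abs_sub_comm (m : ℝ)] at this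
        linarith
      have h3 : (u - ρ.im) ^ 2 = |ρ.im - u| ^ 2 := by rw [sq_abs]; ring
      rw [h3]
      nlinarith [sq_nonneg (|ρ.im - u| - 2)]
    refine (Finset.sum_le_card_nsmul _ _ _ hterm).trans ?_
    rw [nsmul_eq_mul, ← mul_assoc]
    refine mul_le_mul_of_nonneg_right ?_ (Real.exp_pos _).le
    refine hcard.trans ?_
    rw [mul_assoc]
    exact mul_le_mul_of_nonneg_left hlog hA.le
  refine (Finset.sum_le_sum hfib).trans ?_
  rw [← Finset.mul_sum, mul_right_comm A W]
  refine mul_le_mul_of_nonneg_left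
    (summable_one_add_abs_mul_exp.sum_le_tsum _ fun k _ => by positivity) ?_
  exact mul_nonneg hA.le (zero_le_one.trans (one_le_log_five_add u))

/-- The mean square of a sum over zeros on a unit interval. -/
theorem exists_integral_norm_sq_zeros_le : ∃ A : ℝ, 0 < A ∧ ∀ (χ : DirichletCharacter ℂ q),
    GoodZeros χ → ∀ (S : Finset ℂ), (∀ ρ ∈ S, ρ ∈ stripZeros χ) → ∀ (a : ℂ → ℂ) (V : ℝ),
    ∫ y in Set.Ioc V (V + 1), ‖∑ ρ ∈ S, a ρ * Complex.exp (Complex.I * ρ.im * y)‖ ^ 2 ≤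
      A * ∑ ρ ∈ S, ‖a ρ‖ ^ 2 * Real.log (5 + |ρ.im|) := by
  obtain ⟨A, hA, h⟩ := exists_sum_gaussian_zeros_le (q := q)
  refine ⟨Real.exp 1 * √Real.pi * A, by positivity, fun χ hχ S hS a V => ?_⟩
  refine (integral_norm_sq_expSum_le S a (fun ρ => ρ.im) V).trans ?_
  rw [mul_assoc _ A]
  refine mul_le_mul_of_nonneg_left ?_ (by positivity)
  rw [Finset.mul_sum]
  refine Finset.sum_le_sum fun ρ _ => ?_
  rw [mul_left_comm]
  exact mul_le_mul_of_nonneg_left (h χ hχ ρ.im S hS) (by positivity)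

/-- A second moment bound with exponent below `2` makes the weighted coefficients summable. -/
theorem GoodZeros.summable_zeroCoeff {χ : DirichletCharacter ℂ q} (h : GoodZeros χ) {θ C : ℝ}
    (hθ : θ < 2) (hJ : ∀ T : ℝ, 1 ≤ T → ∀ S : Finset ℂ,
      (∀ ρ ∈ S, ρ ∈ stripZeros χ ∧ |ρ.im| ≤ T) →
      ∑ ρ ∈ S, 1 / ‖deriv (DirichletCharacter.LFunction χ) ρ‖ ^ 2 ≤ C * T ^ θ) :
    Summable fun ρ : stripZeros χ => ‖zeroCoeff χ ρ‖ ^ 2 * Real.log (5 + |(ρ : ℂ).im|) := by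
  classical
  have hC : 0 ≤ C := by
    have := hJ 1 le_rfl ∅ (by simp)
    simpa using this
  set r : ℝ := 2 ^ (θ - 2) with hr
  have hr0 : 0 < r := by positivity
  have hr1 : r < 1 := Real.rpow_lt_one_of_one_lt_of_neg (by norm_num) (by linarith)
  have hsum : Summable fun k : ℕ => 4 * C * ((2 + k) * r ^ k) := by
    refine Summable.mul_left _ ?_
    have h1 := (summable_geometric_of_lt_one hr0.le hr1).mul_left 2
    have h2 := summable_pow_mul_geometric_of_norm_lt_one 1
      (by rwa [Real.norm_eq_abs, abs_of_pos hr0] : ‖r‖ < 1)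
    refine (h1.add h2).congr fun k => ?_
    ring
  set k : ℂ → ℕ := fun ρ => Nat.clog 2 ⌈|ρ.im|⌉₊ with hk
  have hk1 : ∀ ρ : ℂ, |ρ.im| ≤ 2 ^ k ρ := fun ρ => by
    refine (Nat.le_ceil _).trans ?_
    exact_mod_cast Nat.le_pow_clog (by norm_num) _
  have hk2 : ∀ ρ ∈ stripZeros χ, (4 : ℝ) ^ k ρ / 4 ≤ ‖ρ‖ ^ 2 := by
    intro ρ hρ
    have hre := h.re_eq ρ hρ
    rw [← Complex.normSq_eq_norm_sq, Complex.normSq_apply, hre]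
    rcases Nat.eq_zero_or_pos (k ρ) with h0 | h0
    · rw [h0]; nlinarith [mul_self_nonneg ρ.im]
    · obtain ⟨m, hm⟩ : ∃ m, k ρ = m + 1 := ⟨k ρ - 1, by omega⟩
      have h1 : 2 ^ m < ⌈|ρ.im|⌉₊ := by
        refine (Nat.lt_clog_iff_pow_lt (by norm_num)).1 ?_
        have : Nat.clog 2 ⌈|ρ.im|⌉₊ = m + 1 := hm
        omega
      have h2 : (2 : ℝ) ^ m < |ρ.im| := by
        have := Nat.lt_ceil.1 h1
        exact_mod_cast this
      rw [hm, pow_succ, mul_div_assoc, div_self (by norm_num), mul_one,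
        show (4 : ℝ) = 2 ^ 2 by norm_num, ← pow_mul, mul_comm, pow_mul]
      have h3 : ((2 : ℝ) ^ m) ^ 2 ≤ |ρ.im| ^ 2 := by
        exact pow_le_pow_left₀ (by positivity) h2.le 2
      rw [sq_abs] at h3
      nlinarith
  have hterm : ∀ ρ ∈ stripZeros χ, ‖zeroCoeff χ ρ‖ ^ 2 * Real.log (5 + |ρ.im|) ≤
      4 * (2 + k ρ) / 4 ^ k ρ * (1 / ‖deriv (DirichletCharacter.LFunction χ) ρ‖ ^ 2) := by
    intro ρ hρ
    have h1 := hρ.2.2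
    have hne : ρ ≠ 1 := fun h => by rw [h] at h1; simp at h1
    have hz : ‖zeroCoeff χ ρ‖ ^ 2 =
        1 / ‖ρ‖ ^ 2 * (1 / ‖deriv (DirichletCharacter.LFunction χ) ρ‖ ^ 2) := by
      have : zeroCoeff χ ρ = 1 / ρ * (1 / deriv (DirichletCharacter.LFunction χ) ρ) := by
        have h2 : (ρ - 1) ^ poleOrder χ ≠ 0 := pow_ne_zero _ (sub_ne_zero.2 hne)
        have h3 := h.simple ρ hρ
        have h4 : ρ ≠ 0 := fun h => by have := hρ.2.1; rw [h] at this; simp at this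
        rw [zeroCoeff, deriv_entireL χ hne hρ.1]
        field_simp
      rw [this, norm_mul, mul_pow, norm_div, norm_div, norm_one, div_pow, div_pow, one_pow]
    have hl : Real.log (5 + |ρ.im|) ≤ 2 + k ρ := by
      have h2 : (5 : ℝ) + |ρ.im| ≤ Real.exp (2 + k ρ) := by
        rw [Real.exp_add]
        have h3 : (1 : ℝ) ≤ 2 ^ k ρ := one_le_pow₀ (by norm_num)
        have h4 : (2 : ℝ) ^ k ρ ≤ Real.exp (k ρ) := by
          rw [← Real.exp_one_pow]
          exact pow_le_pow_left₀ (by norm_num) (by linarith [Real.exp_one_gt_d9]) _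
        have h5 : (6 : ℝ) ≤ Real.exp 2 := by
          have : Real.exp 2 = Real.exp 1 * Real.exp 1 := by rw [← Real.exp_add]; norm_num
          rw [this]
          nlinarith [Real.exp_one_gt_d9]
        have h6 := hk1 ρ
        have h7 : (0 : ℝ) ≤ Real.exp (k ρ) := (Real.exp_pos _).le
        nlinarith
      rw [← Real.log_exp (2 + k ρ)]
      exact Real.log_le_log (by positivity) h2
    rw [hz, mul_right_comm]
    refine mul_le_mul_of_nonneg_right ?_ (by positivity)
    have h2 := hk2 ρ hρ
    have h3 : 1 / ‖ρ‖ ^ 2 ≤ 4 / 4 ^ k ρ := by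
      rw [div_le_div_iff₀ (lt_of_lt_of_le (by positivity) h2) (by positivity)]
      linarith
    calc _ ≤ 4 / 4 ^ k ρ * (2 + k ρ : ℝ) := by
          refine mul_le_mul h3 hl (zero_le_one.trans (one_le_log_five_add _)) (by positivity)
      _ = _ := by ring
  have key : ∀ S : Finset ℂ, (∀ ρ ∈ S, ρ ∈ stripZeros χ) →
      ∑ ρ ∈ S, ‖zeroCoeff χ ρ‖ ^ 2 * Real.log (5 + |ρ.im|) ≤
        ∑' k : ℕ, 4 * C * ((2 + k) * r ^ k) := by
    intro S hS
    rw [← Finset.sum_fiberwise_of_maps_to (g := k) (t := S.image k)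
      fun ρ hρ => Finset.mem_image_of_mem k hρ]
    refine (Finset.sum_le_sum fun m _ => ?_).trans
      (hsum.sum_le_tsum (S.image k) fun k _ => by positivity)
    have h1 : ∑ ρ ∈ S with k ρ = m, ‖zeroCoeff χ ρ‖ ^ 2 * Real.log (5 + |ρ.im|) ≤
        ∑ ρ ∈ S with k ρ = m, 4 * (2 + m) / 4 ^ m *
          (1 / ‖deriv (DirichletCharacter.LFunction χ) ρ‖ ^ 2) := by
      refine Finset.sum_le_sum fun ρ hρ => ?_
      obtain ⟨h2, h3⟩ := Finset.mem_filter.1 hρ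
      have := hterm ρ (hS ρ h2)
      rwa [h3] at this
    refine h1.trans ?_
    rw [← Finset.mul_sum]
    have h2 := hJ (2 ^ m) (one_le_pow₀ (by norm_num)) (S.filter (fun ρ => k ρ = m))
      fun ρ hρ => by
        obtain ⟨h2, h3⟩ := Finset.mem_filter.1 hρ
        refine ⟨hS ρ h2, ?_⟩
        have := hk1 ρ
        rwa [h3] at this
    refine (mul_le_mul_of_nonneg_left h2 (by positivity)).trans (le_of_eq ?_)
    have h3 : ((2 : ℝ) ^ m) ^ θ = r ^ m * 4 ^ m := by
      rw [hr, ← mul_pow, ← Real.rpow_natCast, ← Real.rpow_natCast, ← Real.rpow_mul (by norm_num),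
        mul_comm (m : ℝ), Real.rpow_mul (by norm_num)]
      congr 1
      rw [Real.rpow_sub (by norm_num)]
      norm_num
    rw [h3]
    field_simp
  refine summable_of_sum_le (c := ∑' k : ℕ, 4 * C * ((2 + k) * r ^ k)) (fun ρ => ?_) fun S => ?_
  · exact mul_nonneg (by positivity) (zero_le_one.trans (one_le_log_five_add _))
  · have := key (S.map (Function.Embedding.subtype _)) fun ρ hρ => by
      obtain ⟨x, -, rfl⟩ := Finset.mem_map.1 hρ
      exact x.2
    rw [Finset.sum_map] at this
    exact this

end ZeroSums

section MeanSquare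

theorem lintegral_enorm_sq_le_of_tendsto {α : Type*} [MeasurableSpace α] {μ : Measure α}
    {f : ℕ → α → ℂ} {g : α → ℂ} {B : ENNReal} (hf : ∀ n, Measurable (f n))
    (hlim : ∀ᵐ x ∂μ, Tendsto (fun n => f n x) atTop (𝓝 (g x)))
    (hB : ∀ᶠ n in atTop, ∫⁻ x, ‖f n x‖ₑ ^ 2 ∂μ ≤ B) : ∫⁻ x, ‖g x‖ₑ ^ 2 ∂μ ≤ B := by
  have h1 : ∫⁻ x, ‖g x‖ₑ ^ 2 ∂μ = ∫⁻ x, liminf (fun n => ‖f n x‖ₑ ^ 2) atTop ∂μ := by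
    refine lintegral_congr_ae ?_
    filter_upwards [hlim] with x hx
    exact ((ENNReal.continuous_pow 2).continuousAt.tendsto.comp hx.enorm).liminf_eq.symm
  rw [h1]
  refine (lintegral_liminf_le fun n => (hf n).enorm.pow_const 2).trans ?_
  exact liminf_le_of_frequently_le hB.frequently

variable {q : ℕ} [NeZero q]

/-- The mean square of the error in the truncated explicit formula on unit intervals. -/
theorem GoodZeros.exists_lintegral_error_le {χ : DirichletCharacter ℂ q} (h : GoodZeros χ)
    (h' : GoodZeros χ⁻¹) (hsum : Summable fun ρ : stripZeros χ =>
      ‖zeroCoeff χ ρ‖ ^ 2 * Real.log (5 + |(ρ : ℂ).im|)) {ε : ℝ} (hε : 0 < ε) :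
    ∃ S₀ : Finset ℂ, (∀ ρ ∈ S₀, ρ ∈ stripZeros χ) ∧ ∀ S : Finset ℂ, S₀ ⊆ S →
      (∀ ρ ∈ S, ρ ∈ stripZeros χ) → ∀ V : ℝ,
      ∫⁻ y in Set.Ioc V (V + 1), ‖normSum χ y - remTerm χ 0 y -
        ∑ ρ ∈ S, zeroCoeff χ ρ * Complex.exp (Complex.I * ρ.im * y)‖ₑ ^ 2 ≤ ENNReal.ofReal ε := by
  classical
  obtain ⟨A, hA, hA'⟩ := exists_integral_norm_sq_zeros_le (q := q)
  obtain ⟨s, hs⟩ := summable_iff_vanishing_norm.1 hsum (ε / A) (by positivity)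
  refine ⟨s.map (Function.Embedding.subtype _), fun ρ hρ => ?_, fun S hS₀ hS V => ?_⟩
  · obtain ⟨x, -, rfl⟩ := Finset.mem_map.1 hρ
    exact x.2
  have htail : ∀ T : Finset ℂ, (∀ ρ ∈ T, ρ ∈ stripZeros χ) → Disjoint T S →
      ∑ ρ ∈ T, ‖zeroCoeff χ ρ‖ ^ 2 * Real.log (5 + |ρ.im|) ≤ ε / A := by
    intro T hT hdisj
    have h1 := hs (T.subtype (· ∈ stripZeros χ)) (Finset.disjoint_left.2 fun x hx hxs =>
      Finset.disjoint_left.1 hdisj (Finset.mem_subtype.1 hx)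
        (hS₀ (Finset.mem_map_of_mem (Function.Embedding.subtype _) hxs)))
    have h2 := Finset.sum_subtype_of_mem
      (fun ρ => ‖zeroCoeff χ ρ‖ ^ 2 * Real.log (5 + |ρ.im|)) hT
    rw [← h2]
    exact (le_abs_self _).trans h1.le
  obtain ⟨Z, hZ, hZ', hlim⟩ := h.exists_explicit_formula h'
  set b : ℝ → ℂ → ℂ := fun κ ρ => zeroCoeff χ ρ * (Real.exp (-κ * ρ.im ^ 2) : ℂ) with hb
  have hexp : ∀ ρ ∈ stripZeros χ, ∀ κ y : ℝ, zeroCoeff χ ρ *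
      Complex.exp ((ρ - 1 / 2) * y + κ * (ρ - 1 / 2) ^ 2) =
      b κ ρ * Complex.exp (Complex.I * ρ.im * y) := by
    intro ρ hρ κ y
    have h1 : ρ - 1 / 2 = Complex.I * ρ.im := by
      apply Complex.ext
      · simp [h.re_eq ρ hρ]
      · simp
    have h2 : (ρ - 1 / 2) * y + κ * (ρ - 1 / 2) ^ 2 =
        ((-κ * ρ.im ^ 2 : ℝ) : ℂ) + Complex.I * ρ.im * y := by
      rw [h1]
      push_cast
      linear_combination (κ : ℂ) * ρ.im ^ 2 * Complex.I_sq
    rw [h2, Complex.exp_add, ← Complex.ofReal_exp]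
    simp only [hb]
    ring
  set g : ℝ → ℝ → ℂ := fun κ y => smoothSum χ κ y - remTerm χ κ y -
    ∑ ρ ∈ S, b κ ρ * Complex.exp (Complex.I * ρ.im * y) with hg
  have hlim' : ∀ κ ∈ Set.Ioc (0 : ℝ) 1, ∀ y : ℝ, Tendsto (fun n => ∑ ρ ∈ Z n \ S,
      b κ ρ * Complex.exp (Complex.I * ρ.im * y)) atTop (𝓝 (g κ y)) := by
    intro κ hκ y
    have hsub : ∀ᶠ n in atTop, S ⊆ Z n := by
      have := (Filter.eventually_all_finset S).2 fun ρ hρ => hZ' ρ (hS ρ hρ)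
      filter_upwards [this] with n hn using hn
    refine ((hlim κ hκ y).sub_const
      (∑ ρ ∈ S, b κ ρ * Complex.exp (Complex.I * ρ.im * y))).congr' ?_
    filter_upwards [hsub] with n hn
    rw [Finset.sum_congr rfl fun ρ hρ => hexp ρ (hZ n ρ hρ) κ y, ← Finset.sum_sdiff hn,
      add_sub_cancel_right]
  have hgmeas : ∀ κ ∈ Set.Ioc (0 : ℝ) 1, Measurable (g κ) := fun κ hκ =>
    measurable_of_tendsto_metrizable (f := fun n (y : ℝ) => ∑ ρ ∈ Z n \ S,
      b κ ρ * Complex.exp (Complex.I * ρ.im * y))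
      (fun n => Continuous.measurable (by fun_prop))
      (tendsto_pi_nhds.2 (hlim' κ hκ))
  have hgle : ∀ κ ∈ Set.Ioc (0 : ℝ) 1,
      ∫⁻ y in Set.Ioc V (V + 1), ‖g κ y‖ₑ ^ 2 ≤ ENNReal.ofReal ε := by
    intro κ hκ
    refine lintegral_enorm_sq_le_of_tendsto (f := fun n (y : ℝ) => ∑ ρ ∈ Z n \ S,
      b κ ρ * Complex.exp (Complex.I * ρ.im * y))
      (fun n => Continuous.measurable (by fun_prop)) (ae_of_all _ (hlim' κ hκ))
      (Eventually.of_forall fun n => ?_)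
    have h1 : ∀ y : ℝ, ‖∑ ρ ∈ Z n \ S, b κ ρ * Complex.exp (Complex.I * ρ.im * y)‖ₑ ^ 2 =
        ENNReal.ofReal
          (‖∑ ρ ∈ Z n \ S, b κ ρ * Complex.exp (Complex.I * ρ.im * y)‖ ^ 2) := fun y => by
      rw [ENNReal.ofReal_pow (norm_nonneg _), ofReal_norm]
    simp_rw [h1]
    rw [← ofReal_integral_eq_lintegral_ofReal (Continuous.integrableOn_Ioc (by fun_prop))
      (ae_of_all _ fun y => by positivity)]
    refine ENNReal.ofReal_le_ofReal ?_
    refine (hA' χ h (Z n \ S) (fun ρ hρ => hZ n ρ (Finset.mem_sdiff.1 hρ).1) (b κ) V).trans ?_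
    have h2 := htail (Z n \ S) (fun ρ hρ => hZ n ρ (Finset.mem_sdiff.1 hρ).1)
      Finset.sdiff_disjoint
    rw [le_div_iff₀ hA, mul_comm] at h2
    refine le_trans (mul_le_mul_of_nonneg_left (Finset.sum_le_sum fun ρ _ => ?_) hA.le) h2
    refine mul_le_mul_of_nonneg_right (pow_le_pow_left₀ (norm_nonneg _) ?_ 2)
      (zero_le_one.trans (one_le_log_five_add _))
    rw [hb, norm_mul, Complex.norm_real, Real.norm_eq_abs, Real.abs_exp]
    refine mul_le_of_le_one_right (norm_nonneg _) (Real.exp_le_one_iff.2 ?_)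
    nlinarith [hκ.1, sq_nonneg ρ.im]
  set κs : ℕ → ℝ := fun m => 1 / ((m : ℝ) + 1) with hκs
  have hκmem : ∀ m, κs m ∈ Set.Ioc (0 : ℝ) 1 := fun m => by
    refine ⟨by positivity, ?_⟩
    rw [hκs, div_le_one (by positivity)]
    linarith [Nat.cast_nonneg (α := ℝ) m]
  have hκlim : Tendsto κs atTop (𝓝[>] 0) := tendsto_nhdsWithin_iff.2
    ⟨tendsto_one_div_add_atTop_nhds_zero_nat, Eventually.of_forall fun m => (hκmem m).1⟩
  refine lintegral_enorm_sq_le_of_tendsto (f := fun m => g (κs m))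
    (fun m => hgmeas _ (hκmem m)) ?_ (Eventually.of_forall fun m => hgle _ (hκmem m))
  filter_upwards [ae_restrict_of_ae (ae_continuousAt_normSum χ)] with y hy
  refine Tendsto.sub (((tendsto_smoothSum χ hy).comp hκlim).sub
    ((h.tendsto_remTerm h' y).comp hκlim)) ?_
  refine tendsto_finsetSum _ fun ρ _ => Tendsto.mul_const _ ?_
  have h1 : Tendsto (fun κ : ℝ => b κ ρ) (𝓝 0) (𝓝 (b 0 ρ)) :=
    Continuous.tendsto (by fun_prop) 0
  have h2 : b 0 ρ = zeroCoeff χ ρ := by simp [hb]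
  rw [h2] at h1
  exact h1.comp (hκlim.mono_right nhdsWithin_le_nhds)

end MeanSquare

section MeanError

variable {q : ℕ}

theorem integrableOn_normSum (χ : DirichletCharacter ℂ q) (a b : ℝ) :
    IntegrableOn (normSum χ) (Set.Ioc a b) := by
  refine Measure.integrableOn_of_bounded (M := Real.exp (b / 2)) measure_Ioc_lt_top.ne
    (measurable_normSum χ).aestronglyMeasurable ?_
  filter_upwards [ae_restrict_mem measurableSet_Ioc] with y hy
  exact (norm_normSum_le χ y).trans (Real.exp_le_exp.2 (by linarith [hy.2]))

theorem setIntegral_norm_le_of_lintegral_enorm_sq_le {f : ℝ → ℂ} {V η : ℝ} (hη : 0 < η)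
    (hf : IntegrableOn f (Set.Ioc V (V + 1)))
    (hle : ∫⁻ y in Set.Ioc V (V + 1), ‖f y‖ₑ ^ 2 ≤ ENNReal.ofReal (η ^ 2)) :
    ∫ y in Set.Ioc V (V + 1), ‖f y‖ ≤ η := by
  have h1 : ∀ y, ‖f y‖ₑ ^ 2 = ENNReal.ofReal (‖f y‖ ^ 2) := fun y => by
    rw [ENNReal.ofReal_pow (norm_nonneg _), ofReal_norm]
  simp_rw [h1] at hle
  have hm : AEStronglyMeasurable (fun y => ‖f y‖ ^ 2) (volume.restrict (Set.Ioc V (V + 1))) :=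
    hf.aestronglyMeasurable.norm.pow 2
  have hInt : IntegrableOn (fun y => ‖f y‖ ^ 2) (Set.Ioc V (V + 1)) := by
    refine ⟨hm, ?_⟩
    rw [hasFiniteIntegral_iff_ofReal (ae_of_all _ fun y => by positivity)]
    exact hle.trans_lt ENNReal.ofReal_lt_top
  have h2 : ∫ y in Set.Ioc V (V + 1), ‖f y‖ ^ 2 ≤ η ^ 2 := by
    rw [← ofReal_integral_eq_lintegral_ofReal hInt (ae_of_all _ fun y => by positivity)] at hle
    exact (ENNReal.ofReal_le_ofReal_iff (by positivity)).1 hle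
  have hc : Integrable (fun _ : ℝ => η / 2) (volume.restrict (Set.Ioc V (V + 1))) :=
    integrableOn_const measure_Ioc_lt_top.ne
  have h3 : ∫ y in Set.Ioc V (V + 1), ‖f y‖ ≤
      ∫ y in Set.Ioc V (V + 1), (η / 2 + ‖f y‖ ^ 2 * (1 / (2 * η))) := by
    refine integral_mono hf.norm (hc.add (hInt.mul_const _)) fun y => ?_
    have h4 : η / 2 + ‖f y‖ ^ 2 * (1 / (2 * η)) - ‖f y‖ = (‖f y‖ - η) ^ 2 / (2 * η) := by
      field_simp
      ring
    have h5 : 0 ≤ (‖f y‖ - η) ^ 2 / (2 * η) := by positivity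
    change ‖f y‖ ≤ _
    linarith
  refine h3.trans ?_
  rw [integral_add hc (hInt.mul_const _),
    integral_mul_const, setIntegral_const]
  have h4 := mul_le_mul_of_nonneg_right h2 (by positivity : 0 ≤ 1 / (2 * η))
  have h5 : η ^ 2 * (1 / (2 * η)) = η / 2 := by field_simp
  simp only [measureReal_def, Real.volume_Ioc, add_sub_cancel_left, ENNReal.ofReal_one,
    ENNReal.toReal_one, one_smul]
  linarith

theorem setIntegral_Ioc_le_of_forall_unit {f : ℝ → ℝ} {η : ℝ} (hη : 0 ≤ η) (hf : ∀ y, 0 ≤ f y)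
    (hInt : ∀ a b, IntegrableOn f (Set.Ioc a b))
    (h : ∀ V : ℝ, ∫ y in Set.Ioc V (V + 1), f y ≤ η) {Y : ℝ} (hY : 0 ≤ Y) :
    ∫ y in Set.Ioc 0 Y, f y ≤ η * Y + η := by
  have h1 : ∀ n : ℕ, ∫ y in Set.Ioc 0 (n : ℝ), f y ≤ η * n := by
    intro n
    induction n with
    | zero => simp
    | succ n ih =>
      have h2 : Set.Ioc (0 : ℝ) ((n + 1 : ℕ) : ℝ) =
          Set.Ioc 0 (n : ℝ) ∪ Set.Ioc (n : ℝ) (n + 1) := by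
        push_cast
        rw [Set.Ioc_union_Ioc_eq_Ioc n.cast_nonneg (by linarith)]
      rw [h2, setIntegral_union (Set.Ioc_disjoint_Ioc_of_le le_rfl) measurableSet_Ioc
        (hInt _ _) (hInt _ _)]
      have := h n
      push_cast
      linarith
  have h2 : ∫ y in Set.Ioc 0 Y, f y ≤ ∫ y in Set.Ioc 0 (⌈Y⌉₊ : ℝ), f y :=
    setIntegral_mono_set (hInt _ _) (ae_of_all _ hf)
      (Set.Ioc_subset_Ioc_right (Nat.le_ceil Y)).eventuallyLE
  have h3 := Nat.ceil_lt_add_one hY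
  have h4 := h1 ⌈Y⌉₊
  nlinarith

variable [NeZero q]

/-- The truncated explicit formula is close to the normalised sum on average. -/
theorem GoodZeros.exists_integral_error_le {χ : DirichletCharacter ℂ q} (h : GoodZeros χ)
    (h' : GoodZeros χ⁻¹) (hsum : Summable fun ρ : stripZeros χ =>
      ‖zeroCoeff χ ρ‖ ^ 2 * Real.log (5 + |(ρ : ℂ).im|)) {η : ℝ} (hη : 0 < η) :
    ∃ S₀ : Finset ℂ, (∀ ρ ∈ S₀, ρ ∈ stripZeros χ) ∧ ∃ K : ℝ, ∀ S : Finset ℂ, S₀ ⊆ S →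
      (∀ ρ ∈ S, ρ ∈ stripZeros χ) → ∀ Y : ℝ, 0 ≤ Y →
      ∫ y in Set.Ioc 0 Y, ‖normSum χ y -
        ∑ ρ ∈ S, zeroCoeff χ ρ * Complex.exp (Complex.I * ρ.im * y)‖ ≤ η * Y + K := by
  obtain ⟨S₀, hS₀, hS₀'⟩ := h.exists_lintegral_error_le h' hsum (ε := η ^ 2) (by positivity)
  obtain ⟨C, hC, hC'⟩ := h.exists_norm_remTerm_le h'
  have hexp : IntegrableOn (fun y => C * Real.exp (-(499 / 1000) * y)) (Set.Ioi 0) :=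
    (exp_neg_integrableOn_Ioi 0 (by norm_num)).const_mul C
  refine ⟨S₀, hS₀, η + ∫ y in Set.Ioi (0 : ℝ), C * Real.exp (-(499 / 1000) * y),
    fun S hS hSz Y hY => ?_⟩
  have hRc := h.continuous_remTerm h'
  have hPc : Continuous fun y : ℝ =>
    ∑ ρ ∈ S, zeroCoeff χ ρ * Complex.exp (Complex.I * ρ.im * y) := by fun_prop
  set g : ℝ → ℂ := fun y => normSum χ y - remTerm χ 0 y -
    ∑ ρ ∈ S, zeroCoeff χ ρ * Complex.exp (Complex.I * ρ.im * y) with hg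
  have hgint : ∀ a b, IntegrableOn g (Set.Ioc a b) := fun a b =>
    ((integrableOn_normSum χ a b).sub hRc.integrableOn_Ioc).sub hPc.integrableOn_Ioc
  have h1 := setIntegral_Ioc_le_of_forall_unit hη.le (fun y => norm_nonneg (g y))
    (fun a b => (hgint a b).norm) (fun V => setIntegral_norm_le_of_lintegral_enorm_sq_le hη
      (hgint V (V + 1)) (hS₀' S hS hSz V)) hY
  have h2 : ∫ y in Set.Ioc 0 Y, ‖remTerm χ 0 y‖ ≤
      ∫ y in Set.Ioi (0 : ℝ), C * Real.exp (-(499 / 1000) * y) := by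
    refine (integral_mono hRc.norm.integrableOn_Ioc
      (hexp.mono_set Set.Ioc_subset_Ioi_self) fun y => hC' 0 (by simp) y).trans ?_
    exact setIntegral_mono_set hexp (ae_of_all _ fun y => by positivity)
      Set.Ioc_subset_Ioi_self.eventuallyLE
  have h3 : ∫ y in Set.Ioc 0 Y, ‖normSum χ y -
        ∑ ρ ∈ S, zeroCoeff χ ρ * Complex.exp (Complex.I * ρ.im * y)‖ ≤
      ∫ y in Set.Ioc 0 Y, (‖g y‖ + ‖remTerm χ 0 y‖) := by
    refine integral_mono ((integrableOn_normSum χ 0 Y).sub hPc.integrableOn_Ioc).norm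
      ((hgint 0 Y).norm.add hRc.norm.integrableOn_Ioc) fun y => ?_
    refine le_trans (le_of_eq ?_) (norm_add_le (g y) (remTerm χ 0 y))
    congr 1
    simp only [hg]
    ring
  rw [integral_add (hgint 0 Y).norm hRc.norm.integrableOn_Ioc] at h3
  linarith

end MeanError

section KroneckerWeyl

variable {I : Type*} [Fintype I]

/-- The uniform probability measure on a torus. -/
noncomputable def torusMeasure (I : Type*) [Fintype I] : Measure (UnitAddTorus I) :=
  Measure.pi fun _ => AddCircle.haarAddCircle

instance : IsProbabilityMeasure (torusMeasure I) := by
  unfold torusMeasure; infer_instance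

instance : (torusMeasure I).IsAddRightInvariant := by
  unfold torusMeasure; infer_instance

theorem integral_mFourier_eq_zero {n : I → ℤ} (hn : n ≠ 0) :
    ∫ x, UnitAddTorus.mFourier n x ∂torusMeasure I = 0 := by
  simp only [UnitAddTorus.mFourier, ContinuousMap.coe_mk, torusMeasure]
  rw [integral_fintype_prod_eq_prod (fun i => ⇑(fourier (n i)))]
  obtain ⟨i, hi⟩ := Function.ne_iff.1 hn
  exact Finset.prod_eq_zero (Finset.mem_univ i)
    (integral_eq_zero_of_add_right_eq_neg (fourier_add_half_inv_index hi zero_lt_one))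

/-- The linear flow on a torus. -/
noncomputable def torusFlow (ω : I → ℝ) (y : ℝ) : UnitAddTorus I :=
  fun i => ((ω i * y : ℝ) : UnitAddCircle)

theorem continuous_torusFlow (ω : I → ℝ) : Continuous (torusFlow ω) :=
  continuous_pi fun i => (AddCircle.continuous_mk' 1).comp (by fun_prop)

theorem mFourier_torusFlow (n : I → ℤ) (ω : I → ℝ) (y : ℝ) :
    UnitAddTorus.mFourier n (torusFlow ω y) =
      Complex.exp (2 * Real.pi * Complex.I * (∑ i, n i * ω i : ℝ) * y) := by
  simp only [UnitAddTorus.mFourier, ContinuousMap.coe_mk, torusFlow, fourier_coe_apply]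
  rw [← Complex.exp_sum]
  congr 1
  push_cast
  rw [Finset.mul_sum, Finset.sum_mul]
  exact Finset.sum_congr rfl fun i _ => by ring

theorem tendsto_mean_exp {c : ℝ} (hc : c ≠ 0) :
    Tendsto (fun Y : ℝ => (Y⁻¹ : ℂ) * ∫ y in Set.Ioc 0 Y,
      Complex.exp (2 * Real.pi * Complex.I * c * y)) atTop (𝓝 0) := by
  have hc' : 2 * Real.pi * Complex.I * c ≠ 0 := by
    simp [hc, Real.pi_ne_zero]
  have h1 : Tendsto (fun Y : ℝ => Y⁻¹ * (2 / ‖2 * Real.pi * Complex.I * c‖)) atTop (𝓝 0) := by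
    simpa using tendsto_inv_atTop_zero.mul_const (2 / ‖2 * Real.pi * Complex.I * c‖)
  refine squeeze_zero_norm' ?_ h1
  filter_upwards [eventually_gt_atTop 0] with Y hY
  rw [← intervalIntegral.integral_of_le hY.le, integral_exp_mul_complex hc', norm_mul, norm_inv,
    Complex.norm_real, Real.norm_eq_abs, abs_of_pos hY, norm_div]
  have h2 : ∀ y : ℝ, ‖Complex.exp (2 * Real.pi * Complex.I * c * y)‖ = 1 := fun y => by
    rw [Complex.norm_exp]; simp
  refine mul_le_mul_of_nonneg_left (div_le_div_of_nonneg_right ?_ (norm_nonneg _))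
    (inv_nonneg.2 hY.le)
  refine (norm_sub_le _ _).trans (le_of_eq ?_)
  rw [h2, h2]
  norm_num

/-- Kronecker–Weyl equidistribution of a linear flow with rationally independent frequencies. -/
theorem tendsto_mean_torusFlow {ω : I → ℝ}
    (hω : ∀ n : I → ℤ, n ≠ 0 → ∑ i, n i * ω i ≠ 0) (F : C(UnitAddTorus I, ℂ)) :
    Tendsto (fun Y : ℝ => (Y⁻¹ : ℂ) * ∫ y in Set.Ioc 0 Y, F (torusFlow ω y)) atTop
      (𝓝 (∫ x, F x ∂torusMeasure I)) := by
  have hcont : ∀ G : C(UnitAddTorus I, ℂ), ∀ Y : ℝ,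
      IntegrableOn (fun y => G (torusFlow ω y)) (Set.Ioc 0 Y) := fun G Y =>
    (G.continuous.comp (continuous_torusFlow ω)).integrableOn_Ioc
  have hInt : ∀ G : C(UnitAddTorus I, ℂ), Integrable G (torusMeasure I) := fun G =>
    G.continuous.integrable_of_hasCompactSupport (HasCompactSupport.of_compactSpace _)
  have hspan : ∀ G ∈ Submodule.span ℂ (Set.range (UnitAddTorus.mFourier (d := I))),
      Tendsto (fun Y : ℝ => (Y⁻¹ : ℂ) * ∫ y in Set.Ioc 0 Y, G (torusFlow ω y)) atTop
        (𝓝 (∫ x, G x ∂torusMeasure I)) := by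
    intro G hG
    induction hG using Submodule.span_induction with
    | mem G hG =>
      obtain ⟨n, rfl⟩ := hG
      rcases eq_or_ne n 0 with rfl | hn
      · simp only [UnitAddTorus.mFourier_zero, ContinuousMap.one_apply, integral_const,
          probReal_univ, one_smul]
        refine tendsto_const_nhds.congr' ?_
        filter_upwards [eventually_gt_atTop 0] with Y hY
        have : (Y : ℂ) ≠ 0 := by exact_mod_cast hY.ne'
        simp [hY.le, this]
      · rw [integral_mFourier_eq_zero hn]
        simp_rw [mFourier_torusFlow]
        exact tendsto_mean_exp (hω n hn)
    | zero => simp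
    | add G H _ _ hG hH =>
      simp only [ContinuousMap.add_apply]
      rw [integral_add (hInt G) (hInt H)]
      refine (hG.add hH).congr fun Y => ?_
      rw [integral_add (hcont G Y) (hcont H Y), mul_add]
    | smul a G _ hG =>
      simp only [ContinuousMap.smul_apply]
      rw [integral_smul]
      refine (hG.const_smul a).congr fun Y => ?_
      rw [integral_smul, mul_smul_comm]
  rw [Metric.tendsto_atTop]
  intro ε hε
  have hmem : F ∈
      (Submodule.span ℂ (Set.range (UnitAddTorus.mFourier (d := I)))).topologicalClosure := by
    rw [UnitAddTorus.span_mFourier_closure_eq_top]; trivial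
  obtain ⟨G, hG, hFG⟩ := Metric.mem_closure_iff.1 hmem (ε / 3) (by positivity)
  rw [dist_eq_norm] at hFG
  obtain ⟨Y₀, hY₀⟩ := Metric.tendsto_atTop.1 (hspan G hG) (ε / 3) (by positivity)
  refine ⟨max Y₀ 1, fun Y hY => ?_⟩
  have hY1 : 0 < Y := lt_of_lt_of_le zero_lt_one ((le_max_right _ _).trans hY)
  have h1 := hY₀ Y ((le_max_left _ _).trans hY)
  have h2 : dist ((Y⁻¹ : ℂ) * ∫ y in Set.Ioc 0 Y, F (torusFlow ω y))
      ((Y⁻¹ : ℂ) * ∫ y in Set.Ioc 0 Y, G (torusFlow ω y)) ≤ ‖F - G‖ := by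
    rw [dist_eq_norm, ← mul_sub, ← integral_sub (hcont F Y) (hcont G Y), norm_mul, norm_inv,
      Complex.norm_real, Real.norm_eq_abs, abs_of_pos hY1]
    have h3 := norm_setIntegral_le_of_norm_le_const (μ := volume) (C := ‖F - G‖) (s := Set.Ioc 0 Y)
      (f := fun y => F (torusFlow ω y) - G (torusFlow ω y)) measure_Ioc_lt_top
      (fun y _ => (F - G).norm_coe_le_norm _)
    rw [Real.volume_real_Ioc_of_le hY1.le, sub_zero] at h3
    rw [inv_mul_le_iff₀ hY1, mul_comm]
    exact h3
  have h4 : dist (∫ x, G x ∂torusMeasure I) (∫ x, F x ∂torusMeasure I) ≤ ‖F - G‖ := by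
    rw [dist_comm, dist_eq_norm, ← integral_sub (hInt F) (hInt G)]
    have h3 := norm_integral_le_of_norm_le_const (μ := torusMeasure I)
      (ae_of_all _ fun x => (F - G).norm_coe_le_norm x)
    simpa using h3
  have h5 := dist_triangle4 ((Y⁻¹ : ℂ) * ∫ y in Set.Ioc 0 Y, F (torusFlow ω y))
    ((Y⁻¹ : ℂ) * ∫ y in Set.Ioc 0 Y, G (torusFlow ω y)) (∫ x, G x ∂torusMeasure I)
    (∫ x, F x ∂torusMeasure I)
  linarith

/-- Real-valued form of Kronecker–Weyl equidistribution. -/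
theorem tendsto_mean_torusFlow_real {ω : I → ℝ}
    (hω : ∀ n : I → ℤ, n ≠ 0 → ∑ i, n i * ω i ≠ 0) {F : UnitAddTorus I → ℝ} (hF : Continuous F) :
    Tendsto (fun Y : ℝ => Y⁻¹ * ∫ y in Set.Ioc 0 Y, F (torusFlow ω y)) atTop
      (𝓝 (∫ x, F x ∂torusMeasure I)) := by
  have h1 := tendsto_mean_torusFlow hω ⟨fun x => (F x : ℂ), by fun_prop⟩
  simp only [ContinuousMap.coe_mk, integral_complex_ofReal] at h1
  have h2 := (Complex.continuous_re.tendsto _).comp h1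
  rw [Complex.ofReal_re] at h2
  refine h2.congr fun Y => ?_
  rw [Function.comp_apply, ← Complex.ofReal_inv, ← Complex.ofReal_mul, Complex.ofReal_re]

end KroneckerWeyl

section AntiConcentration

theorem sq_le_cos_sub_cos {x y : ℝ} (hy : 0 ≤ y) (hyx : y ≤ x) (hx : x ≤ Real.pi) :
    2 * ((x - y) / Real.pi) ^ 2 ≤ Real.cos y - Real.cos x := by
  have hpi := Real.pi_pos
  have h1 : Real.cos y - Real.cos x = 2 * Real.sin ((x + y) / 2) * Real.sin ((x - y) / 2) := by
    rw [Real.cos_sub_cos, add_comm y x, show (y - x) / 2 = -((x - y) / 2) by ring, Real.sin_neg]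
    ring
  have h2 : Real.sin ((x - y) / 2) ≤ Real.sin ((x + y) / 2) := by
    have h3 : Real.sin ((x + y) / 2) - Real.sin ((x - y) / 2) =
        2 * Real.sin (y / 2) * Real.cos (x / 2) := by
      rw [Real.sin_sub_sin]; ring_nf
    have h4 : 0 ≤ Real.sin (y / 2) := Real.sin_nonneg_of_nonneg_of_le_pi (by linarith) (by linarith)
    have h5 : 0 ≤ Real.cos (x / 2) :=
      Real.cos_nonneg_of_neg_pi_div_two_le_of_le (by linarith) (by linarith)
    have := mul_nonneg (mul_nonneg zero_le_two h4) h5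
    linarith
  have h3 : (x - y) / Real.pi ≤ Real.sin ((x - y) / 2) := by
    have := Real.mul_le_sin (x := (x - y) / 2) (by linarith) (by linarith)
    calc (x - y) / Real.pi = 2 / Real.pi * ((x - y) / 2) := by ring
      _ ≤ _ := this
  have h4 : 0 ≤ (x - y) / Real.pi := div_nonneg (by linarith) hpi.le
  rw [h1]
  nlinarith

theorem sq_le_abs_cos_sub_cos {x y : ℝ} (k : ℤ) (hx0 : k * Real.pi ≤ x)
    (hx1 : x ≤ (k + 1) * Real.pi) (hy0 : k * Real.pi ≤ y) (hy1 : y ≤ (k + 1) * Real.pi) :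
    2 * ((x - y) / Real.pi) ^ 2 ≤ |Real.cos x - Real.cos y| := by
  have h1 : |Real.cos x - Real.cos y| =
      |Real.cos (x - k * Real.pi) - Real.cos (y - k * Real.pi)| := by
    rw [Real.cos_sub_int_mul_pi, Real.cos_sub_int_mul_pi, ← mul_sub, abs_mul, abs_zpow]
    simp
  rw [h1]
  rcases le_total y x with h | h
  · have := sq_le_cos_sub_cos (x := x - k * Real.pi) (y := y - k * Real.pi) (by linarith)
      (by linarith) (by linarith)
    rw [abs_sub_comm]
    refine le_trans (le_of_eq ?_) (this.trans (le_abs_self _))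
    ring_nf
  · have := sq_le_cos_sub_cos (x := y - k * Real.pi) (y := x - k * Real.pi) (by linarith)
      (by linarith) (by linarith)
    refine le_trans (le_of_eq ?_) (this.trans (le_abs_self _))
    ring_nf

theorem volume_abs_cos_add_lt_le {r δ : ℝ} (hr : 0 < r) (α c : ℝ) (hα : -Real.pi ≤ α)
    (hα' : α ≤ Real.pi) :
    volume {u : ℝ | u ∈ Set.Ioc 0 1 ∧ |r * Real.cos (2 * Real.pi * u + α) + c| < δ} ≤
      ENNReal.ofReal (2 * √(δ / r)) := by
  have hpi := Real.pi_pos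
  set A : ℤ → Set ℝ := fun k => {u : ℝ | |r * Real.cos (2 * Real.pi * u + α) + c| < δ ∧
    k * Real.pi ≤ 2 * Real.pi * u + α ∧ 2 * Real.pi * u + α ≤ (k + 1) * Real.pi} with hA
  have hAk : ∀ k, volume (A k) ≤ ENNReal.ofReal (√(δ / r) / 2) := by
    intro k
    refine (Real.volume_le_diam _).trans (Metric.ediam_le fun u hu v hv => ?_)
    rw [edist_dist, Real.dist_eq]
    refine ENNReal.ofReal_le_ofReal ?_
    have h1 := sq_le_abs_cos_sub_cos k hu.2.1 hu.2.2 hv.2.1 hv.2.2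
    have h2 : r * |Real.cos (2 * Real.pi * u + α) - Real.cos (2 * Real.pi * v + α)| ≤ 2 * δ := by
      have h6 := abs_mul r (Real.cos (2 * Real.pi * u + α) - Real.cos (2 * Real.pi * v + α))
      rw [abs_of_pos hr] at h6
      have h3 := abs_sub (r * Real.cos (2 * Real.pi * u + α) + c)
        (r * Real.cos (2 * Real.pi * v + α) + c)
      have h4 := hu.1
      have h5 := hv.1
      rw [← h6, mul_sub]
      rw [add_sub_add_right_eq_sub] at h3
      linarith
    have h3 : 2 * ((2 * Real.pi * u + α - (2 * Real.pi * v + α)) / Real.pi) ^ 2 =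
        8 * (u - v) ^ 2 := by
      field_simp; ring
    rw [h3] at h1
    have h4 : (2 * |u - v|) ^ 2 ≤ δ / r := by
      rw [le_div_iff₀ hr, mul_pow, sq_abs]
      nlinarith
    have := Real.le_sqrt_of_sq_le h4
    linarith
  have hsub : {u : ℝ | u ∈ Set.Ioc 0 1 ∧ |r * Real.cos (2 * Real.pi * u + α) + c| < δ} ⊆
      (A (-1) ∪ A 0) ∪ (A 1 ∪ A 2) := by
    rintro u ⟨⟨hu0, hu1⟩, hu⟩
    have h1 : -Real.pi ≤ 2 * Real.pi * u + α := by nlinarith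
    have h2 : 2 * Real.pi * u + α ≤ 3 * Real.pi := by nlinarith
    simp only [hA, Set.mem_union, Set.mem_ofPred_eq, hu, true_and]
    push_cast
    rcases le_total (2 * Real.pi * u + α) Real.pi with h | h
    · left
      rcases le_total (2 * Real.pi * u + α) 0 with h' | h'
      · left; constructor <;> linarith
      · right; constructor <;> linarith
    · right
      rcases le_total (2 * Real.pi * u + α) (2 * Real.pi) with h' | h'
      · left; constructor <;> linarith
      · right; constructor <;> linarith
  refine (measure_mono hsub).trans ?_
  refine (measure_union_le _ _).trans ((add_le_add (measure_union_le _ _)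
    (measure_union_le _ _)).trans ((add_le_add (add_le_add (hAk _) (hAk _))
    (add_le_add (hAk _) (hAk _))).trans (le_of_eq ?_)))
  have h0 : 0 ≤ √(δ / r) := Real.sqrt_nonneg _
  rw [← ENNReal.ofReal_add (by positivity) (by positivity),
    ← ENNReal.ofReal_add (by positivity) (by positivity)]
  congr 1
  ring

variable {I : Type*} [Fintype I]

/-- A real trigonometric linear form on a torus. -/
noncomputable def torusForm (b : I → ℂ) (x : UnitAddTorus I) : ℝ :=
  ∑ i, (b i * (AddCircle.toCircle (x i) : ℂ)).re

theorem continuous_torusForm (b : I → ℂ) : Continuous (torusForm b) := by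
  unfold torusForm
  refine continuous_finsetSum _ fun i _ => Complex.continuous_re.comp (continuous_const.mul ?_)
  exact continuous_subtype_val.comp (AddCircle.continuous_toCircle.comp (continuous_apply i))

theorem torusForm_sub (b b' : I → ℂ) (x : UnitAddTorus I) :
    torusForm (b - b') x = torusForm b x - torusForm b' x := by
  simp only [torusForm, ← Finset.sum_sub_distrib, Pi.sub_apply, sub_mul, Complex.sub_re]

theorem torusForm_add_right (b : I → ℂ) (x t : UnitAddTorus I) :
    torusForm b (x + t) = torusForm (fun i => b i * (AddCircle.toCircle (t i) : ℂ)) x := by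
  simp only [torusForm, Pi.add_apply, AddCircle.toCircle_add, Circle.coe_mul]
  exact Finset.sum_congr rfl fun i _ => by ring_nf

theorem torusForm_torusFlow (b : I → ℂ) (ω : I → ℝ) (y : ℝ) :
    torusForm b (torusFlow ω y) =
      ∑ i, (b i * Complex.exp (Complex.I * (2 * Real.pi * ω i : ℝ) * y)).re := by
  simp only [torusForm, torusFlow, AddCircle.toCircle_apply_mk, Circle.coe_exp]
  refine Finset.sum_congr rfl fun i _ => ?_
  congr 3
  push_cast
  ring

theorem torusForm_add_single [DecidableEq I] (b : I → ℂ) (i₀ : I) (x : UnitAddTorus I) (u : ℝ) :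
    torusForm b (x + Pi.single i₀ (u : UnitAddCircle)) =
      ‖b i₀‖ * Real.cos (2 * Real.pi * u +
        Complex.arg (b i₀ * (AddCircle.toCircle (x i₀) : ℂ))) +
      ∑ i ∈ Finset.univ.erase i₀, (b i * (AddCircle.toCircle (x i) : ℂ)).re := by
  rw [torusForm, ← Finset.add_sum_erase _ _ (Finset.mem_univ i₀)]
  congr 1
  · rw [Pi.add_apply, Pi.single_eq_same, AddCircle.toCircle_add, Circle.coe_mul, ← mul_assoc,
      AddCircle.toCircle_apply_mk, Circle.coe_exp]
    set z := b i₀ * (AddCircle.toCircle (x i₀) : ℂ) with hz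
    have h1 : ‖z‖ = ‖b i₀‖ := by rw [hz, norm_mul, Circle.norm_coe, mul_one]
    conv_lhs => rw [← Complex.norm_mul_exp_arg_mul_I z]
    rw [h1, mul_assoc, ← Complex.exp_add, Complex.re_ofReal_mul, ← Complex.exp_ofReal_mul_I_re]
    congr 3
    push_cast
    ring
  · refine Finset.sum_congr rfl fun i hi => ?_
    rw [Pi.add_apply, Pi.single_eq_of_ne (Finset.ne_of_mem_erase hi), add_zero]

/-- A trigonometric linear form with a large coefficient is rarely small. -/
theorem torusMeasure_abs_torusForm_lt_le (b : I → ℂ) {i₀ : I} (hb : b i₀ ≠ 0) (δ : ℝ) :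
    (torusMeasure I).real {x | |torusForm b x| < δ} ≤ 2 * √(δ / ‖b i₀‖) := by
  classical
  refine ENNReal.toReal_le_of_le_ofReal (by positivity) ?_
  set B : Set (UnitAddTorus I) := {x | |torusForm b x| < δ} with hB
  have hBo : IsOpen B := isOpen_lt (continuous_torusForm b).abs continuous_const
  set ν : Measure ℝ := volume.restrict (Set.Ioc (0 : ℝ) 1) with hν
  have hν1 : ν Set.univ = 1 := by simp [hν]
  have hcont : Continuous fun p : UnitAddTorus I × ℝ =>
      p.1 + (Pi.single i₀ (p.2 : UnitAddCircle) : UnitAddTorus I) :=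
    continuous_fst.add ((continuous_single i₀).comp
      ((AddCircle.continuous_mk' 1).comp continuous_snd))
  set S : Set (UnitAddTorus I × ℝ) := {p | p.1 + Pi.single i₀ (p.2 : UnitAddCircle) ∈ B} with hS
  have hSm : MeasurableSet S := (hBo.preimage hcont).measurableSet
  have h1 : ((torusMeasure I).prod ν) S = torusMeasure I B := by
    rw [Measure.prod_apply_symm hSm]
    have : ∀ u : ℝ, torusMeasure I ((fun x => (x, u)) ⁻¹' S) = torusMeasure I B := fun u =>
      measure_preimage_add_right (torusMeasure I) (Pi.single i₀ (u : UnitAddCircle)) B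
    simp only [this, lintegral_const, hν1, mul_one]
  rw [← h1, Measure.prod_apply hSm]
  calc ∫⁻ x, ν (Prod.mk x ⁻¹' S) ∂torusMeasure I
      ≤ ∫⁻ x, ENNReal.ofReal (2 * √(δ / ‖b i₀‖)) ∂torusMeasure I := by
        refine lintegral_mono fun x => ?_
        rw [hν, Measure.restrict_apply' measurableSet_Ioc]
        refine (measure_mono fun u hu => ?_).trans (volume_abs_cos_add_lt_le (norm_pos_iff.2 hb)
          (Complex.arg (b i₀ * (AddCircle.toCircle (x i₀) : ℂ)))
          (∑ i ∈ Finset.univ.erase i₀, (b i * (AddCircle.toCircle (x i) : ℂ)).re)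
          (Complex.neg_pi_lt_arg _).le (Complex.arg_le_pi _))
        refine ⟨hu.2, ?_⟩
        have h2 : |torusForm b (x + Pi.single i₀ (u : UnitAddCircle))| < δ := hu.1
        rwa [torusForm_add_single] at h2
    _ = _ := by simp

end AntiConcentration

section Orderings

/-- The ramp function increasing from `0` to `1` on `[0, δ]`. -/
noncomputable def ramp (δ x : ℝ) : ℝ := min 1 (max 0 (x / δ))

theorem ramp_nonneg (δ x : ℝ) : 0 ≤ ramp δ x := le_min zero_le_one (le_max_left _ _)

theorem ramp_le_one (δ x : ℝ) : ramp δ x ≤ 1 := min_le_left _ _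

theorem ramp_eq_zero {δ x : ℝ} (hδ : 0 < δ) (hx : x ≤ 0) : ramp δ x = 0 := by
  rw [ramp, max_eq_left (div_nonpos_of_nonpos_of_nonneg hx hδ.le), min_eq_right zero_le_one]

theorem ramp_eq_one {δ x : ℝ} (hδ : 0 < δ) (hx : δ ≤ x) : ramp δ x = 1 :=
  min_eq_left (le_max_of_le_right ((one_le_div hδ).2 hx))

theorem continuous_ramp (δ : ℝ) : Continuous (ramp δ) := by
  unfold ramp; fun_prop

theorem abs_ramp_sub_le {δ : ℝ} (hδ : 0 < δ) (x y : ℝ) :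
    |ramp δ x - ramp δ y| ≤ |x - y| / δ := by
  have h1 := abs_min_sub_min_le_max 1 (max 0 (x / δ)) 1 (max 0 (y / δ))
  have h2 := abs_max_sub_max_le_max 0 (x / δ) 0 (y / δ)
  have h3 : |x / δ - y / δ| = |x - y| / δ := by rw [← sub_div, abs_div, abs_of_pos hδ]
  simp only [sub_self, abs_zero, abs_nonneg, max_eq_right] at h1 h2
  exact h1.trans (h2.trans h3.le)

theorem abs_ramp_mul_sub_le {δ : ℝ} (hδ : 0 < δ) (x y x' y' : ℝ) :
    |ramp δ x * ramp δ y - ramp δ x' * ramp δ y'| ≤ (|x - x'| + |y - y'|) / δ := by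
  have h1 : ramp δ x * ramp δ y - ramp δ x' * ramp δ y' =
      (ramp δ x - ramp δ x') * ramp δ y + ramp δ x' * (ramp δ y - ramp δ y') := by ring
  rw [h1, add_div]
  refine (abs_add_le _ _).trans (add_le_add ?_ ?_)
  · rw [abs_mul, abs_of_nonneg (ramp_nonneg δ y)]
    exact (mul_le_of_le_one_right (abs_nonneg _) (ramp_le_one _ _)).trans (abs_ramp_sub_le hδ _ _)
  · rw [abs_mul, abs_of_nonneg (ramp_nonneg δ x')]
    exact (mul_le_of_le_one_left (abs_nonneg _) (ramp_le_one _ _)).trans (abs_ramp_sub_le hδ _ _)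

theorem one_le_ramp_add {δ : ℝ} (hδ : 0 < δ) {s : ℝ} (hs : δ ≤ |s|) :
    1 ≤ ramp δ s * ramp δ s + ramp δ (-s) * ramp δ (-s) := by
  rcases le_abs.1 hs with h | h
  · rw [ramp_eq_one hδ h]
    nlinarith [ramp_nonneg δ (-s)]
  · rw [ramp_eq_one hδ h]
    nlinarith [ramp_nonneg δ s]

theorem one_le_ramp_orderings {δ : ℝ} (hδ : 0 < δ) {u v w : ℝ} (h1 : δ ≤ |u - v|)
    (h2 : δ ≤ |v - w|) (h3 : δ ≤ |w - u|) :
    1 ≤ (ramp δ (u - v) * ramp δ (v - w) + ramp δ (v - w) * ramp δ (w - u) +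
      ramp δ (w - u) * ramp δ (u - v)) + (ramp δ (v - u) * ramp δ (w - v) +
      ramp δ (w - v) * ramp δ (u - w) + ramp δ (u - w) * ramp δ (v - u)) := by
  have p := fun x y : ℝ => mul_nonneg (ramp_nonneg δ x) (ramp_nonneg δ y)
  have q1 := p (u - v) (v - w)
  have q2 := p (v - w) (w - u)
  have q3 := p (w - u) (u - v)
  have q4 := p (v - u) (w - v)
  have q5 := p (w - v) (u - w)
  have q6 := p (u - w) (v - u)
  have e : ∀ {x y : ℝ}, δ ≤ x → δ ≤ y → ramp δ x * ramp δ y = 1 := fun hx hy => by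
    rw [ramp_eq_one hδ hx, ramp_eq_one hδ hy, one_mul]
  have l : ∀ {x y : ℝ}, δ ≤ |x - y| → δ ≤ x - y ∨ δ ≤ y - x := fun {x y} h => by
    rw [← neg_sub x y]; exact le_abs.1 h
  rcases l h1 with a | a <;> rcases l h2 with b | b <;> rcases l h3 with c | c <;>
    first
    | linarith [e a b]
    | linarith [e b c]
    | linarith [e c a]

variable {I : Type*} [Fintype I]

theorem integrable_torus {F : UnitAddTorus I → ℝ} (hF : Continuous F) :
    Integrable F (torusMeasure I) :=
  hF.integrable_of_hasCompactSupport (HasCompactSupport.of_compactSpace _)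

theorem toCircle_half : (AddCircle.toCircle ((1 / 2 : ℝ) : UnitAddCircle) : ℂ) = -1 := by
  rw [AddCircle.toCircle_apply_mk, Circle.coe_exp]
  convert Complex.exp_pi_mul_I using 2
  push_cast
  ring

theorem torusForm_add_half (b : I → ℂ) (x : UnitAddTorus I) :
    torusForm b (x + fun _ => ((1 / 2 : ℝ) : UnitAddCircle)) = -torusForm b x := by
  rw [torusForm_add_right]
  simp only [torusForm, toCircle_half, mul_neg, mul_one, neg_mul, Complex.neg_re,
    Finset.sum_neg_distrib]

theorem one_le_integral_ramp (b : I → ℂ) {i₀ : I} (hb : b i₀ ≠ 0) {δ : ℝ} (hδ : 0 < δ) :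
    1 ≤ 2 * ∫ x, ramp δ (torusForm b x) * ramp δ (torusForm b x) ∂torusMeasure I +
      2 * √(δ / ‖b i₀‖) := by
  have hc := continuous_torusForm b
  have hr := continuous_ramp δ
  set B : Set (UnitAddTorus I) := {x | |torusForm b x| < δ} with hB
  have hBm : MeasurableSet B := (isOpen_lt hc.abs continuous_const).measurableSet
  have i1 : Integrable (fun x => ramp δ (torusForm b x) * ramp δ (torusForm b x))
      (torusMeasure I) := integrable_torus ((hr.comp hc).mul (hr.comp hc))
  have i2 : Integrable (fun x => ramp δ (-torusForm b x) * ramp δ (-torusForm b x))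
      (torusMeasure I) := integrable_torus ((hr.comp hc.neg).mul (hr.comp hc.neg))
  have i3 : Integrable (B.indicator fun _ => (1 : ℝ)) (torusMeasure I) :=
    (integrable_const _).indicator hBm
  have h1 : ∫ _x : UnitAddTorus I, (1 : ℝ) ∂torusMeasure I ≤ _ :=
    integral_mono (integrable_const _) ((i1.add i2).add i3) fun x => by
    simp only [Pi.add_apply]
    by_cases hx : x ∈ B
    · simp only [Set.indicator_of_mem hx]
      nlinarith [mul_self_nonneg (ramp δ (torusForm b x)),
        mul_self_nonneg (ramp δ (-torusForm b x))]
    · simp only [Set.indicator_of_notMem hx, add_zero]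
      exact one_le_ramp_add hδ (not_lt.1 hx)
  have h2 : ∫ x, ramp δ (-torusForm b x) * ramp δ (-torusForm b x) ∂torusMeasure I =
      ∫ x, ramp δ (torusForm b x) * ramp δ (torusForm b x) ∂torusMeasure I := by
    rw [← integral_add_right_eq_self _ fun _ => ((1 / 2 : ℝ) : UnitAddCircle)]
    simp only [torusForm_add_half, neg_neg]
  rw [integral_add' (i1.add i2) i3, integral_add' i1 i2, integral_indicator_const _ hBm] at h1
  simp only [integral_const, probReal_univ, smul_eq_mul, mul_one] at h1
  rw [h2] at h1
  have h3 := torusMeasure_abs_torusForm_lt_le b hb δ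
  linarith

theorem one_le_integral_ramp_ramp (b : Fin 3 → I → ℂ) {t : UnitAddTorus I}
    (h01 : ∀ i, b 0 i * (AddCircle.toCircle (t i) : ℂ) = b 1 i)
    (h12 : ∀ i, b 1 i * (AddCircle.toCircle (t i) : ℂ) = b 2 i)
    (h20 : ∀ i, b 2 i * (AddCircle.toCircle (t i) : ℂ) = b 0 i)
    {i₁ i₂ i₃ : I} (hb₁ : (b 0 - b 1) i₁ ≠ 0) (hb₂ : (b 1 - b 2) i₂ ≠ 0)
    (hb₃ : (b 2 - b 0) i₃ ≠ 0) {δ : ℝ} (hδ : 0 < δ) :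
    1 ≤ 6 * ∫ x, ramp δ (torusForm (b 0 - b 1) x) * ramp δ (torusForm (b 1 - b 2) x)
        ∂torusMeasure I +
      (2 * √(δ / ‖(b 0 - b 1) i₁‖) + 2 * √(δ / ‖(b 1 - b 2) i₂‖) +
        2 * √(δ / ‖(b 2 - b 0) i₃‖)) := by
  set f := fun k => torusForm (b k) with hf
  have hc : ∀ k, Continuous (f k) := fun k => continuous_torusForm (b k)
  have hr := continuous_ramp δ
  have hG : ∀ j k l m, Continuous fun x => ramp δ (f j x - f k x) * ramp δ (f l x - f m x) :=
    fun j k l m => (hr.comp ((hc j).sub (hc k))).mul (hr.comp ((hc l).sub (hc m)))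
  set B : Fin 3 → Fin 3 → Set (UnitAddTorus I) := fun j k => {x | |f j x - f k x| < δ} with hB
  have hBm : ∀ j k, MeasurableSet (B j k) := fun j k =>
    (isOpen_lt ((hc j).sub (hc k)).abs continuous_const).measurableSet
  set G : Fin 3 → Fin 3 → Fin 3 → Fin 3 → ℝ := fun j k l m =>
    ∫ x, ramp δ (f j x - f k x) * ramp δ (f l x - f m x) ∂torusMeasure I with hGdef
  have hi := fun j k l m => integrable_torus (hG j k l m)
  have hI : ∀ j k, Integrable ((B j k).indicator fun _ => (1 : ℝ)) (torusMeasure I) := fun j k =>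
    (integrable_const _).indicator (hBm j k)
  have h1 : 1 ≤ ((G 0 1 1 2 + G 1 2 2 0 + G 2 0 0 1) + (G 1 0 2 1 + G 2 1 0 2 + G 0 2 1 0)) +
      ((torusMeasure I).real (B 0 1) + (torusMeasure I).real (B 1 2) +
        (torusMeasure I).real (B 2 0)) := by
    have h2 : ∫ _x : UnitAddTorus I, (1 : ℝ) ∂torusMeasure I ≤ _ :=
      integral_mono (integrable_const _)
        ((((((hi 0 1 1 2).add (hi 1 2 2 0)).add (hi 2 0 0 1)).add
          (((hi 1 0 2 1).add (hi 2 1 0 2)).add (hi 0 2 1 0)))).add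
          (((hI 0 1).add (hI 1 2)).add (hI 2 0))) fun x => by
        have p := fun j k l m =>
          mul_nonneg (ramp_nonneg δ (f j x - f k x)) (ramp_nonneg δ (f l x - f m x))
        have q : ∀ j k, 0 ≤ (B j k).indicator (fun _ => (1 : ℝ)) x := fun j k =>
          Set.indicator_nonneg (fun _ _ => zero_le_one) x
        simp only [Pi.add_apply]
        have p1 := p 0 1 1 2
        have p2 := p 1 2 2 0
        have p3 := p 2 0 0 1
        have p4 := p 1 0 2 1
        have p5 := p 2 1 0 2
        have p6 := p 0 2 1 0
        have q1 := q 0 1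
        have q2 := q 1 2
        have q3 := q 2 0
        by_cases h01 : x ∈ B 0 1
        · rw [Set.indicator_of_mem h01]; linarith
        by_cases h12 : x ∈ B 1 2
        · rw [Set.indicator_of_mem h12]; linarith
        by_cases h20 : x ∈ B 2 0
        · rw [Set.indicator_of_mem h20]; linarith
        have := one_le_ramp_orderings hδ (not_lt.1 h01) (not_lt.1 h12) (not_lt.1 h20)
        linarith
    rw [integral_add' ((((hi 0 1 1 2).add (hi 1 2 2 0)).add (hi 2 0 0 1)).add
      (((hi 1 0 2 1).add (hi 2 1 0 2)).add (hi 0 2 1 0))) (((hI 0 1).add (hI 1 2)).add (hI 2 0)),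
      integral_add' (((hi 0 1 1 2).add (hi 1 2 2 0)).add (hi 2 0 0 1))
        (((hi 1 0 2 1).add (hi 2 1 0 2)).add (hi 0 2 1 0)),
      integral_add' ((hi 0 1 1 2).add (hi 1 2 2 0)) (hi 2 0 0 1),
      integral_add' (hi 0 1 1 2) (hi 1 2 2 0),
      integral_add' ((hi 1 0 2 1).add (hi 2 1 0 2)) (hi 0 2 1 0),
      integral_add' (hi 1 0 2 1) (hi 2 1 0 2),
      integral_add' ((hI 0 1).add (hI 1 2)) (hI 2 0), integral_add' (hI 0 1) (hI 1 2),
      integral_indicator_const _ (hBm 0 1), integral_indicator_const _ (hBm 1 2),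
      integral_indicator_const _ (hBm 2 0)] at h2
    simpa using h2
  have ht0 : ∀ x, f 0 (x + t) = f 1 x := fun x => by
    simp only [hf, torusForm_add_right, h01]
  have ht1 : ∀ x, f 1 (x + t) = f 2 x := fun x => by
    simp only [hf, torusForm_add_right, h12]
  have ht2 : ∀ x, f 2 (x + t) = f 0 x := fun x => by
    simp only [hf, torusForm_add_right, h20]
  have s1 : G 0 1 1 2 = G 1 2 2 0 := by
    simp only [hGdef]
    rw [← integral_add_right_eq_self _ t]
    simp only [ht0, ht1, ht2]
  have s2 : G 1 2 2 0 = G 2 0 0 1 := by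
    simp only [hGdef]
    rw [← integral_add_right_eq_self _ t]
    simp only [ht0, ht1, ht2]
  have hneg : ∀ j k l m, G k j m l = G j k l m := fun j k l m => by
    simp only [hGdef]
    rw [← integral_add_right_eq_self _ fun _ => ((1 / 2 : ℝ) : UnitAddCircle)]
    simp only [hf, torusForm_add_half, neg_sub_neg]
  have n1 := hneg 0 1 1 2
  have n2 := hneg 1 2 2 0
  have n3 := hneg 2 0 0 1
  have hm : ∀ j k i, (b j - b k) i ≠ 0 →
      (torusMeasure I).real (B j k) ≤ 2 * √(δ / ‖(b j - b k) i‖) := fun j k i h => by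
    have := torusMeasure_abs_torusForm_lt_le (b j - b k) h δ
    simpa only [torusForm_sub] using this
  have hGe : ∫ x, ramp δ (torusForm (b 0 - b 1) x) * ramp δ (torusForm (b 1 - b 2) x)
      ∂torusMeasure I = G 0 1 1 2 := by
    simp only [torusForm_sub, hGdef, hf]
  have m1 := hm 0 1 i₁ hb₁
  have m2 := hm 1 2 i₂ hb₂
  have m3 := hm 2 0 i₃ hb₃
  rw [hGe]
  linarith

end Orderings

section LogDensity

theorem integral_inv_inter_Icc {P : Set ℝ} (hP : MeasurableSet P) {X : ℝ} (hX : 2 ≤ X) :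
    ∫ t in P ∩ Set.Icc 2 X, 1 / t =
      volume.real ({y | Real.exp y ∈ P} ∩ Set.Icc (Real.log 2) (Real.log X)) := by
  have hX0 : 0 < X := by linarith
  set s : Set ℝ := {y | Real.exp y ∈ P} ∩ Set.Icc (Real.log 2) (Real.log X) with hs
  have hsm : MeasurableSet s := (Real.measurable_exp hP).inter measurableSet_Icc
  have himg : Real.exp '' s = P ∩ Set.Icc 2 X := by
    ext t
    constructor
    · rintro ⟨y, ⟨hy, hy1, hy2⟩, rfl⟩
      exact ⟨hy, (Real.log_le_iff_le_exp two_pos).1 hy1, (Real.le_log_iff_exp_le hX0).1 hy2⟩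
    · rintro ⟨ht, ht1, ht2⟩
      have ht0 : 0 < t := by linarith
      refine ⟨Real.log t, ⟨?_, Real.log_le_log two_pos ht1, Real.log_le_log ht0 ht2⟩,
        Real.exp_log ht0⟩
      rw [Set.mem_ofPred_eq, Real.exp_log ht0]
      exact ht
  rw [← himg, integral_image_eq_integral_abs_deriv_smul hsm
    (fun x _ => (Real.hasDerivAt_exp x).hasDerivWithinAt) Real.exp_injective.injOn]
  have : ∀ y : ℝ, |Real.exp y| • (1 / Real.exp y) = 1 := fun y => by
    rw [abs_of_pos (Real.exp_pos y), smul_eq_mul, mul_one_div_cancel (Real.exp_pos y).ne']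
  simp only [this, integral_const, smul_eq_mul, mul_one]
  rw [measureReal_restrict_apply_univ]

theorem hasLogDensity_of_tendsto {P : Set ℝ} (hP : MeasurableSet P) {d : ℝ}
    (h : Tendsto (fun Y : ℝ => Y⁻¹ * volume.real ({y | Real.exp y ∈ P} ∩ Set.Ioc 0 Y)) atTop
      (𝓝 d)) : HasLogDensity P d := by
  set B : Set ℝ := {y | Real.exp y ∈ P} with hB
  have hBm : MeasurableSet B := Real.measurable_exp hP
  have hl2 : 0 < Real.log 2 := Real.log_pos one_lt_two
  have h1 : Tendsto (fun Y : ℝ => Y⁻¹ * volume.real (B ∩ Set.Icc (Real.log 2) Y)) atTop (𝓝 d) := by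
    have h2 : Tendsto (fun Y : ℝ => Y⁻¹ * volume.real (B ∩ Set.Ioc 0 Y) -
        Y⁻¹ * volume.real (B ∩ Set.Ioc 0 (Real.log 2))) atTop (𝓝 (d - 0)) :=
      h.sub (by
        simpa using (tendsto_inv_atTop_zero (𝕜 := ℝ)).mul_const
          (volume.real (B ∩ Set.Ioc 0 (Real.log 2))))
    rw [sub_zero] at h2
    refine h2.congr' ?_
    filter_upwards [eventually_ge_atTop (Real.log 2)] with Y hY
    rw [← mul_sub]
    congr 1
    have h3 : B ∩ Set.Ioc 0 Y = (B ∩ Set.Ioc 0 (Real.log 2)) ∪ (B ∩ Set.Ioc (Real.log 2) Y) := by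
      rw [← Set.inter_union_distrib_left, Set.Ioc_union_Ioc_eq_Ioc hl2.le hY]
    have h4 : volume.real (B ∩ Set.Icc (Real.log 2) Y) =
        volume.real (B ∩ Set.Ioc (Real.log 2) Y) :=
      measureReal_congr ((ae_eq_refl B).inter Ioc_ae_eq_Icc.symm)
    rw [h3, h4, measureReal_union _ (hBm.inter measurableSet_Ioc)
      (measure_ne_top_of_subset Set.inter_subset_right measure_Ioc_lt_top.ne)
      (measure_ne_top_of_subset Set.inter_subset_right measure_Ioc_lt_top.ne), add_sub_cancel_left]
    exact (Set.Ioc_disjoint_Ioc_of_le le_rfl).mono Set.inter_subset_right Set.inter_subset_right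
  refine (h1.comp Real.tendsto_log_atTop).congr' ?_
  filter_upwards [eventually_ge_atTop 2] with X hX
  rw [integral_inv_inter_Icc hP hX, Function.comp_apply, one_div]

/-- Disjoint sets whose lower logarithmic densities sum to one have logarithmic densities. -/
theorem hasLogDensity_of_lower {ι : Type*} [Fintype ι] {P : ι → Set ℝ}
    (hP : ∀ j, MeasurableSet (P j)) (hdisj : Pairwise (Function.onFun Disjoint P)) {d : ι → ℝ}
    (hd : ∑ j, d j = 1)
    (hlow : ∀ j, ∀ ε > 0, ∀ᶠ Y in atTop,
      (d j - ε) * Y ≤ volume.real ({y | Real.exp y ∈ P j} ∩ Set.Ioc 0 Y)) (j : ι) :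
    HasLogDensity (P j) (d j) := by
  classical
  refine hasLogDensity_of_tendsto (hP j) ?_
  rw [Metric.tendsto_atTop']
  intro ε hε
  have hn : 0 < (Fintype.card ι : ℝ) := by
    have : Nonempty ι := ⟨j⟩
    exact_mod_cast Fintype.card_pos
  set ε' : ℝ := ε / (2 * Fintype.card ι) with hε'
  have hε'0 : 0 < ε' := by positivity
  have hcard : Fintype.card ι * ε' = ε / 2 := by rw [hε']; field_simp
  have hall : ∀ᶠ Y in atTop, ∀ k, (d k - ε') * Y ≤
      volume.real ({y | Real.exp y ∈ P k} ∩ Set.Ioc 0 Y) :=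
    eventually_all.2 fun k => hlow k ε' hε'0
  obtain ⟨Y₀, hY₀⟩ := eventually_atTop.1 hall
  refine ⟨max Y₀ 0, fun Y hY => ?_⟩
  have hY0 : 0 < Y := (le_max_right _ _).trans_lt hY
  have h1 := hY₀ Y ((le_max_left _ _).trans hY.le)
  set v : ι → ℝ := fun k => volume.real ({y | Real.exp y ∈ P k} ∩ Set.Ioc 0 Y) with hv
  have hsum : ∑ k, v k ≤ Y := by
    have h2 : volume.real (⋃ k, {y | Real.exp y ∈ P k} ∩ Set.Ioc 0 Y) = ∑ k, v k := by
      refine measureReal_iUnion_fintype ?_ (fun k => (Real.measurable_exp (hP k)).inter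
        measurableSet_Ioc)
        fun k => measure_ne_top_of_subset Set.inter_subset_right measure_Ioc_lt_top.ne
      intro k l hkl
      refine Disjoint.mono Set.inter_subset_left Set.inter_subset_left ?_
      exact (hdisj hkl).preimage Real.exp
    rw [← h2]
    calc _ ≤ volume.real (Set.Ioc 0 Y) :=
          measureReal_mono (Set.iUnion_subset fun k => Set.inter_subset_right)
            measure_Ioc_lt_top.ne
      _ = Y := by rw [Real.volume_real_Ioc_of_le hY0.le, sub_zero]
  have hup : v j ≤ (d j + ε / 2) * Y := by
    have h3 : ∑ k ∈ Finset.univ.erase j, (d k - ε') * Y ≤ ∑ k ∈ Finset.univ.erase j, v k :=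
      Finset.sum_le_sum fun k _ => h1 k
    have h4 : d j + ∑ k ∈ Finset.univ.erase j, d k = 1 := by
      rw [Finset.add_sum_erase _ _ (Finset.mem_univ j), hd]
    have h5 : v j + ∑ k ∈ Finset.univ.erase j, v k ≤ Y := by
      rw [Finset.add_sum_erase _ _ (Finset.mem_univ j)]; exact hsum
    rw [← Finset.sum_mul, Finset.sum_sub_distrib, Finset.sum_const, nsmul_eq_mul] at h3
    have h6 : ((Finset.univ.erase j).card : ℝ) * ε' ≤ ε / 2 := by
      rw [← hcard]
      refine mul_le_mul_of_nonneg_right ?_ hε'0.le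
      exact_mod_cast Finset.card_le_univ _
    have h7 : ∑ k ∈ Finset.univ.erase j, d k = 1 - d j := by linarith
    rw [h7] at h3
    nlinarith
  have hlo : (d j - ε / 2) * Y ≤ v j := by
    refine le_trans (mul_le_mul_of_nonneg_right ?_ hY0.le) (h1 j)
    have : 1 ≤ (Fintype.card ι : ℝ) := by
      have h10 : 0 < Fintype.card ι := by exact_mod_cast hn
      exact_mod_cast h10
    nlinarith
  rw [Real.dist_eq, abs_lt]
  have h8 : Y⁻¹ * v j ≤ d j + ε / 2 := by rw [inv_mul_le_iff₀ hY0]; linarith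
  have h9 : d j - ε / 2 ≤ Y⁻¹ * v j := by rw [le_inv_mul_iff₀ hY0]; linarith
  constructor <;> linarith

/-- Transfer of a lower density bound from almost periodic approximants. -/
theorem lower_density_of_approx {D₁ D₂ : ℝ → ℝ} (hD₁ : Measurable D₁) (hD₂ : Measurable D₂)
    (hi₁ : ∀ Y, IntegrableOn D₁ (Set.Ioc 0 Y)) (hi₂ : ∀ Y, IntegrableOn D₂ (Set.Ioc 0 Y)) {d : ℝ}
    (h : ∀ ε > 0, ∃ δ > 0, ∀ η > 0, ∃ F₁ F₂ : ℝ → ℝ, Continuous F₁ ∧ Continuous F₂ ∧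
      (∃ K, ∀ Y, 0 ≤ Y → ∫ y in Set.Ioc 0 Y, |D₁ y - F₁ y| ≤ η * Y + K) ∧
      (∃ K, ∀ Y, 0 ≤ Y → ∫ y in Set.Ioc 0 Y, |D₂ y - F₂ y| ≤ η * Y + K) ∧
      ∃ m, d - ε ≤ m ∧ Tendsto (fun Y : ℝ => Y⁻¹ * ∫ y in Set.Ioc 0 Y,
        ramp δ (F₁ y) * ramp δ (F₂ y)) atTop (𝓝 m)) :
    ∀ ε > 0, ∀ᶠ Y in atTop,
      (d - ε) * Y ≤ volume.real ({y | 0 < D₁ y ∧ 0 < D₂ y} ∩ Set.Ioc 0 Y) := by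
  intro ε hε
  obtain ⟨δ, hδ, h⟩ := h (ε / 4) (by positivity)
  obtain ⟨F₁, F₂, hF₁, hF₂, ⟨K₁, hK₁⟩, ⟨K₂, hK₂⟩, m, hm, hlim⟩ := h (ε * δ / 8) (by positivity)
  set B : Set ℝ := {y | 0 < D₁ y ∧ 0 < D₂ y} with hB
  have hBm : MeasurableSet B :=
    (measurableSet_lt measurable_const hD₁).inter (measurableSet_lt measurable_const hD₂)
  have hev1 := hlim.eventually (lt_mem_nhds (show m - ε / 4 < m by linarith))
  filter_upwards [hev1, eventually_gt_atTop 0, eventually_ge_atTop ((K₁ + K₂) / δ / (ε / 4))]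
    with Y h1 hY0 hYK
  have i₁ : IntegrableOn (fun y => |D₁ y - F₁ y|) (Set.Ioc 0 Y) :=
    ((hi₁ Y).sub hF₁.integrableOn_Ioc).abs
  have i₂ : IntegrableOn (fun y => |D₂ y - F₂ y|) (Set.Ioc 0 Y) :=
    ((hi₂ Y).sub hF₂.integrableOn_Ioc).abs
  have iR : IntegrableOn (fun y => ramp δ (F₁ y) * ramp δ (F₂ y)) (Set.Ioc 0 Y) :=
    (((continuous_ramp δ).comp hF₁).mul ((continuous_ramp δ).comp hF₂)).integrableOn_Ioc
  have iB : IntegrableOn (B.indicator fun _ => (1 : ℝ)) (Set.Ioc 0 Y) := by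
    have hc : Integrable (fun _ : ℝ => (1 : ℝ)) (volume.restrict (Set.Ioc 0 Y)) :=
      integrableOn_const measure_Ioc_lt_top.ne
    exact hc.indicator hBm
  have h2 : ∫ y in Set.Ioc 0 Y, ramp δ (F₁ y) * ramp δ (F₂ y) ≤ ∫ y in Set.Ioc 0 Y,
      (B.indicator (fun _ => (1 : ℝ)) y + (|D₁ y - F₁ y| + |D₂ y - F₂ y|) / δ) := by
    refine integral_mono iR (iB.add ((i₁.add i₂).div_const δ)) fun y => ?_
    have h3 := abs_ramp_mul_sub_le hδ (F₁ y) (F₂ y) (D₁ y) (D₂ y)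
    have h4 : ramp δ (D₁ y) * ramp δ (D₂ y) ≤ B.indicator (fun _ => (1 : ℝ)) y := by
      by_cases hy : y ∈ B
      · rw [Set.indicator_of_mem hy]
        exact mul_le_one₀ (ramp_le_one _ _) (ramp_nonneg _ _) (ramp_le_one _ _)
      · rw [Set.indicator_of_notMem hy]
        rcases not_and_or.1 hy with h | h
        · rw [ramp_eq_zero hδ (not_lt.1 h), zero_mul]
        · rw [ramp_eq_zero hδ (not_lt.1 h), mul_zero]
    rw [abs_sub_comm (F₁ y), abs_sub_comm (F₂ y)] at h3
    have h5 := le_abs_self (ramp δ (F₁ y) * ramp δ (F₂ y) - ramp δ (D₁ y) * ramp δ (D₂ y))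
    show ramp δ (F₁ y) * ramp δ (F₂ y) ≤ _
    linarith
  have i₃ : IntegrableOn (fun y => (|D₁ y - F₁ y| + |D₂ y - F₂ y|) / δ) (Set.Ioc 0 Y) :=
    (i₁.add i₂).div_const δ
  rw [integral_add iB i₃, integral_div, integral_add i₁ i₂,
    integral_indicator_const _ hBm, smul_eq_mul, mul_one,
    measureReal_restrict_apply hBm] at h2
  have h3 := hK₁ Y hY0.le
  have h4 := hK₂ Y hY0.le
  have h5 : (∫ y in Set.Ioc 0 Y, |D₁ y - F₁ y|) + ∫ y in Set.Ioc 0 Y, |D₂ y - F₂ y| ≤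
      ε * δ / 4 * Y + (K₁ + K₂) := by linarith
  have h6 := div_le_div_of_nonneg_right h5 hδ.le
  have h7 : (ε * δ / 4 * Y + (K₁ + K₂)) / δ = ε / 4 * Y + (K₁ + K₂) / δ := by field_simp
  rw [div_le_iff₀ (by positivity)] at hYK
  rw [lt_inv_mul_iff₀ hY0] at h1
  nlinarith

end LogDensity

section Progressions

open ComplexConjugate

variable {q : ℕ}

/-- The normalised summatory function of `μ` over a residue class. -/
noncomputable def progMean (a : ZMod q) (y : ℝ) : ℝ :=
  Real.exp (-y / 2) * Mprog q a (Real.exp y)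

theorem measurable_Mprog (a : ZMod q) : Measurable (Mprog q a) := by
  unfold Mprog
  exact (measurable_from_nat (f := fun N : ℕ =>
    ∑ n ∈ (Finset.Icc 1 N).filter (fun n => (Nat.cast n : ZMod q) = a),
      (ArithmeticFunction.moebius n : ℝ))).comp Nat.measurable_floor

theorem measurable_progMean (a : ZMod q) : Measurable (progMean a) := by
  unfold progMean
  exact (by fun_prop : Measurable fun y : ℝ => Real.exp (-y / 2)).mul
    ((measurable_Mprog a).comp Real.measurable_exp)

variable [NeZero q]

theorem progMean_eq_sum {a : ZMod q} (ha : IsUnit a) (y : ℝ) :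
    (progMean a y : ℂ) =
      (q.totient : ℂ)⁻¹ * ∑ χ : DirichletCharacter ℂ q, χ⁻¹ a * normSum χ y := by
  have hφ : (q.totient : ℂ) ≠ 0 := by
    exact_mod_cast (Nat.totient_pos.2 (Nat.pos_of_ne_zero (NeZero.ne q))).ne'
  have h1 : ∀ n : ℕ, ∑ χ : DirichletCharacter ℂ q, χ⁻¹ a * χ (n : ZMod q) =
      if (n : ZMod q) = a then (q.totient : ℂ) else 0 := fun n => by
    have h2 : ∀ χ : DirichletCharacter ℂ q, χ⁻¹ a = χ a⁻¹ := fun χ => by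
      rw [MulChar.inv_apply_eq_inv']
      refine inv_eq_of_mul_eq_one_left ?_
      rw [← map_mul, ZMod.inv_mul_of_unit a ha, map_one]
    simp only [h2, DirichletCharacter.sum_char_inv_mul_char_eq ℂ ha, eq_comm]
  rw [eq_inv_mul_iff_mul_eq₀ hφ]
  simp only [progMean, normSum, Mprog, mul_left_comm _ (Real.exp (-y / 2) : ℂ),
    ← Finset.mul_sum]
  push_cast
  rw [mul_left_comm]
  congr 1
  simp only [Finset.mul_sum]
  rw [Finset.sum_comm, Finset.sum_filter]
  refine Finset.sum_congr rfl fun n _ => ?_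
  simp only [← mul_assoc, ← Finset.sum_mul, h1]
  split_ifs <;> simp

/-- The zeros, up to height `T` in the upper half plane, of all `L`-functions modulo `q`. -/
def posZeros (q : ℕ) [NeZero q] (T : ℝ) : Set (DirichletCharacter ℂ q × ℂ) :=
  {p | p.2 ∈ stripZeros p.1 ∧ 0 < p.2.im ∧ p.2.im ≤ T}

/-- The coefficients of the trigonometric approximation to `progMean a`. -/
noncomputable def formCoeff (a : ZMod q) (p : DirichletCharacter ℂ q × ℂ) : ℂ :=
  2 * (q.totient : ℂ)⁻¹ * (p.1⁻¹ a * zeroCoeff p.1 p.2)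

/-- The frequencies of the trigonometric approximation to `progMean a`. -/
noncomputable def formFreq (p : DirichletCharacter ℂ q × ℂ) : ℝ := p.2.im / (2 * Real.pi)

theorem finite_posZeros (hG : ∀ χ : DirichletCharacter ℂ q, GoodZeros χ) (T : ℝ) :
    (posZeros q T).Finite := by
  refine (Set.finite_iUnion fun χ : DirichletCharacter ℂ q =>
    ((hG χ).finite_zeros T).image fun ρ => (χ, ρ)).subset ?_
  rintro ⟨χ, ρ⟩ ⟨h1, h2, h3⟩
  exact Set.mem_iUnion.2 ⟨χ, ρ, ⟨h1, abs_le.2 ⟨by simp only at h2 h3; linarith, h3⟩⟩, rfl⟩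

theorem sum_zeros_eq_torusForm (hG : ∀ χ : DirichletCharacter ℂ q, GoodZeros χ) (T : ℝ)
    [Fintype (posZeros q T)] (a : ZMod q) (y : ℝ) :
    (q.totient : ℂ)⁻¹ * ∑ χ : DirichletCharacter ℂ q, χ⁻¹ a *
        ∑ ρ ∈ ((hG χ).finite_zeros T).toFinset,
          zeroCoeff χ ρ * Complex.exp (Complex.I * ρ.im * y) =
      (torusForm (fun p : posZeros q T => formCoeff a p)
        (torusFlow (fun p => formFreq (p : DirichletCharacter ℂ q × ℂ)) y) : ℂ) := by
  classical
  set g : DirichletCharacter ℂ q × ℂ → ℂ := fun p =>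
    p.1⁻¹ a * (zeroCoeff p.1 p.2 * Complex.exp (Complex.I * p.2.im * y)) with hg
  set Z : Finset (DirichletCharacter ℂ q × ℂ) :=
    (Finset.univ : Finset (DirichletCharacter ℂ q)).biUnion fun χ =>
      ((hG χ).finite_zeros T).toFinset.image fun ρ => (χ, ρ) with hZ
  have hZmem : ∀ p, p ∈ Z ↔ p.1 ∈ (Finset.univ : Finset (DirichletCharacter ℂ q)) ∧
      p.2 ∈ ((hG p.1).finite_zeros T).toFinset := by
    rintro ⟨χ, ρ⟩
    simp [hZ]
  have hZmem' : ∀ p, p ∈ Z ↔ p.2 ∈ stripZeros p.1 ∧ |p.2.im| ≤ T := fun p => by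
    rw [hZmem]; simp
  have h1 : ∑ χ : DirichletCharacter ℂ q, χ⁻¹ a * ∑ ρ ∈ ((hG χ).finite_zeros T).toFinset,
      zeroCoeff χ ρ * Complex.exp (Complex.I * ρ.im * y) = ∑ p ∈ Z, g p := by
    rw [Finset.sum_finset_product Z Finset.univ
      (fun χ => ((hG χ).finite_zeros T).toFinset) hZmem]
    exact Finset.sum_congr rfl fun χ _ => Finset.mul_sum _ _ _
  have h2 : ∑ p ∈ Z.filter (fun p => ¬ 0 < p.2.im), g p =
      ∑ p ∈ Z.filter (fun p => 0 < p.2.im), conj (g p) := by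
    refine Finset.sum_nbij' (fun p => (p.1⁻¹, conj p.2)) (fun p => (p.1⁻¹, conj p.2)) ?_ ?_ ?_ ?_ ?_
    · intro p hp
      rw [Finset.mem_filter, hZmem'] at hp ⊢
      refine ⟨⟨conj_mem_stripZeros hp.1.1, by simpa using hp.1.2⟩, ?_⟩
      rw [Complex.conj_im]
      have := (hG p.1).im_ne _ hp.1.1
      have h3 := lt_of_le_of_ne (not_lt.1 hp.2) this
      linarith
    · intro p hp
      rw [Finset.mem_filter, hZmem'] at hp ⊢
      refine ⟨⟨conj_mem_stripZeros hp.1.1, by simpa using hp.1.2⟩, ?_⟩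
      rw [Complex.conj_im]
      linarith [hp.2]
    · intro p _; simp
    · intro p _; simp
    · intro p _
      simp only [hg, map_mul, zeroCoeff_inv, Complex.conj_conj, ← Complex.exp_conj,
        Complex.conj_ofReal, Complex.conj_I, Complex.conj_im, Complex.ofReal_neg, map_neg, inv_inv]
      rw [← MulChar.star_apply', starRingEnd_apply]
      congr 3
      ring
  have h3 : ∑ p ∈ Z.filter (fun p => 0 < p.2.im), (g p + conj (g p)) =
      ∑ p : posZeros q T, ((2 * (g p).re : ℝ) : ℂ) := by
    rw [← Finset.sum_subtype (p := fun p => p ∈ posZeros q T) (Z.filter fun p => 0 < p.2.im)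
      (fun p => ?_) fun p => ((2 * (g p).re : ℝ) : ℂ)]
    · exact Finset.sum_congr rfl fun p _ => by rw [Complex.add_conj]
    · rw [Finset.mem_filter, hZmem']
      constructor
      · rintro ⟨⟨h4, h5⟩, h6⟩
        exact ⟨h4, h6, (le_abs_self _).trans h5⟩
      · rintro ⟨h4, h5, h6⟩
        exact ⟨⟨h4, by rwa [abs_of_pos h5]⟩, h5⟩
  rw [h1, ← Finset.sum_filter_add_sum_filter_not Z (fun p => 0 < p.2.im), h2,
    ← Finset.sum_add_distrib, h3, torusForm_torusFlow, ← Complex.ofReal_sum,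
    ← Complex.ofReal_natCast, ← Complex.ofReal_inv, ← Complex.ofReal_mul, Finset.mul_sum]
  congr 1
  refine Finset.sum_congr rfl fun p _ => ?_
  have h4 : formCoeff a p * Complex.exp
      (Complex.I * (2 * Real.pi * formFreq (p : DirichletCharacter ℂ q × ℂ) : ℝ) * y) =
      ((2 * (q.totient : ℝ)⁻¹ : ℝ) : ℂ) * g p := by
    have h5 : 2 * Real.pi * formFreq (p : DirichletCharacter ℂ q × ℂ) =
        (p : DirichletCharacter ℂ q × ℂ).2.im := by
      rw [formFreq]; field_simp
    rw [h5, formCoeff, hg]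
    push_cast
    ring
  rw [h4, Complex.re_ofReal_mul]
  ring

theorem integrableOn_progMean {a : ZMod q} (ha : IsUnit a) (Y : ℝ) :
    IntegrableOn (progMean a) (Set.Ioc 0 Y) := by
  have h1 : IntegrableOn (fun y => (q.totient : ℂ)⁻¹ *
      ∑ χ : DirichletCharacter ℂ q, χ⁻¹ a * normSum χ y) (Set.Ioc 0 Y) :=
    (integrable_finsetSum _ fun χ _ => (integrableOn_normSum χ 0 Y).const_mul _).const_mul _
  have h2 := h1.re
  refine h2.congr (ae_of_all _ fun y => ?_)
  simp only [← progMean_eq_sum ha, RCLike.re_eq_complex_re, Complex.ofReal_re]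

theorem exists_progMean_approx (hG : ∀ χ : DirichletCharacter ℂ q, GoodZeros χ)
    (hS : ∀ χ : DirichletCharacter ℂ q, Summable fun ρ : stripZeros χ =>
      ‖zeroCoeff χ ρ‖ ^ 2 * Real.log (5 + |(ρ : ℂ).im|))
    {a : ZMod q} (ha : IsUnit a) {η : ℝ} (hη : 0 < η) :
    ∃ T₀ : ℝ, ∀ T, T₀ ≤ T → ∀ [Fintype (posZeros q T)], ∃ K, ∀ Y, 0 ≤ Y →
      ∫ y in Set.Ioc 0 Y, |progMean a y - torusForm (fun p : posZeros q T => formCoeff a p)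
        (torusFlow (fun p => formFreq (p : DirichletCharacter ℂ q × ℂ)) y)| ≤ η * Y + K := by
  have hφ1 : ‖(q.totient : ℂ)⁻¹‖ ≤ 1 := by
    rw [norm_inv, Complex.norm_natCast]
    refine inv_le_one_of_one_le₀ ?_
    exact_mod_cast Nat.totient_pos.2 (Nat.pos_of_ne_zero (NeZero.ne q))
  have hN : 0 < (Fintype.card (DirichletCharacter ℂ q) : ℝ) := by
    exact_mod_cast Fintype.card_pos
  choose S₀ hS₀ K hK using fun χ => (hG χ).exists_integral_error_le (hG χ⁻¹) (hS χ)
    (div_pos hη hN)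
  have hbd : ∃ T₀ : ℝ, ∀ χ, ∀ ρ ∈ S₀ χ, |ρ.im| ≤ T₀ := by
    classical
    obtain ⟨T₀, hT₀⟩ := ((Finset.univ.biUnion S₀).image fun ρ => |ρ.im|).bddAbove
    exact ⟨T₀, fun χ ρ hρ => hT₀ (Finset.mem_coe.2 (Finset.mem_image_of_mem _
      (Finset.mem_biUnion.2 ⟨χ, Finset.mem_univ _, hρ⟩)))⟩
  obtain ⟨T₀, hT₀⟩ := hbd
  refine ⟨T₀, fun T hT _ => ⟨∑ χ, K χ, fun Y hY => ?_⟩⟩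
  set S : DirichletCharacter ℂ q → Finset ℂ := fun χ => ((hG χ).finite_zeros T).toFinset
  have hSmem : ∀ χ ρ, ρ ∈ S χ ↔ ρ ∈ stripZeros χ ∧ |ρ.im| ≤ T := fun χ ρ => by simp [S]
  have hE : ∀ χ, ∫ y in Set.Ioc 0 Y, ‖normSum χ y - ∑ ρ ∈ S χ, zeroCoeff χ ρ *
      Complex.exp (Complex.I * ρ.im * y)‖ ≤
      η / Fintype.card (DirichletCharacter ℂ q) * Y + K χ := fun χ =>
    hK χ (S χ) (fun ρ hρ => (hSmem χ ρ).2 ⟨hS₀ χ ρ hρ, (hT₀ χ ρ hρ).trans hT⟩)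
      (fun ρ hρ => ((hSmem χ ρ).1 hρ).1) Y hY
  have hcont : ∀ χ, Continuous fun y : ℝ => ∑ ρ ∈ S χ, zeroCoeff χ ρ *
      Complex.exp (Complex.I * ρ.im * y) := fun χ => by fun_prop
  have hInt : ∀ χ, IntegrableOn (fun y : ℝ => ‖normSum χ y - ∑ ρ ∈ S χ, zeroCoeff χ ρ *
      Complex.exp (Complex.I * ρ.im * y)‖) (Set.Ioc 0 Y) := fun χ =>
    ((integrableOn_normSum χ 0 Y).sub (hcont χ).integrableOn_Ioc).norm
  have hcF : Continuous fun y => torusForm (fun p : posZeros q T => formCoeff a p)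
      (torusFlow (fun p => formFreq (p : DirichletCharacter ℂ q × ℂ)) y) :=
    (continuous_torusForm _).comp (continuous_torusFlow _)
  calc _ ≤ ∫ y in Set.Ioc 0 Y, ∑ χ, ‖normSum χ y - ∑ ρ ∈ S χ, zeroCoeff χ ρ *
        Complex.exp (Complex.I * ρ.im * y)‖ := by
        refine integral_mono ((integrableOn_progMean ha Y).sub hcF.integrableOn_Ioc).abs
          (integrable_finsetSum _ fun χ _ => hInt χ) fun y => ?_
        show |progMean a y - _| ≤ _
        rw [← Real.norm_eq_abs, ← Complex.norm_real, Complex.ofReal_sub,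
          ← sum_zeros_eq_torusForm hG T a y, progMean_eq_sum ha, ← mul_sub,
          ← Finset.sum_sub_distrib, norm_mul]
        refine (mul_le_of_le_one_left (norm_nonneg _) hφ1).trans ((norm_sum_le _ _).trans
          (Finset.sum_le_sum fun χ _ => ?_))
        rw [← mul_sub, norm_mul]
        exact mul_le_of_le_one_left (norm_nonneg _) (DirichletCharacter.norm_le_one _ _)
    _ = ∑ χ, ∫ y in Set.Ioc 0 Y, ‖normSum χ y - ∑ ρ ∈ S χ, zeroCoeff χ ρ *
        Complex.exp (Complex.I * ρ.im * y)‖ := integral_finsetSum _ fun χ _ => hInt χ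
    _ ≤ ∑ χ, (η / Fintype.card (DirichletCharacter ℂ q) * Y + K χ) :=
        Finset.sum_le_sum fun χ _ => hE χ
    _ = η * Y + ∑ χ, K χ := by
        rw [Finset.sum_add_distrib, Finset.sum_const, Finset.card_univ, nsmul_eq_mul]
        field_simp

end Progressions

section Races

variable {q : ℕ} [NeZero q]

theorem exists_char_inv_apply_ne {a b : ZMod q} (ha : IsUnit a) (hab : a ≠ b) :
    ∃ χ : DirichletCharacter ℂ q, χ⁻¹ a ≠ χ⁻¹ b := by
  by_contra! h
  have h1 := DirichletCharacter.sum_char_inv_mul_char_eq ℂ ha b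
  have h2 := DirichletCharacter.sum_char_inv_mul_char_eq ℂ ha a
  rw [if_neg hab] at h1
  rw [if_pos rfl] at h2
  have h3 : ∀ χ : DirichletCharacter ℂ q, χ a = χ b := fun χ => by
    simpa using h χ⁻¹
  simp only [← h3] at h1
  rw [h1] at h2
  have : (q.totient : ℂ) ≠ 0 := by
    exact_mod_cast (Nat.totient_pos.2 (Nat.pos_of_ne_zero (NeZero.ne q))).ne'
  exact this h2.symm

theorem exists_formCoeff_ne (hG : ∀ χ : DirichletCharacter ℂ q, GoodZeros χ) {a b : ZMod q}
    (ha : IsUnit a) (hab : a ≠ b) : ∃ p : DirichletCharacter ℂ q × ℂ,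
      p.2 ∈ stripZeros p.1 ∧ 0 < p.2.im ∧ formCoeff a p - formCoeff b p ≠ 0 := by
  obtain ⟨χ, hχ⟩ := exists_char_inv_apply_ne ha hab
  have key : ∃ p : DirichletCharacter ℂ q × ℂ, p.2 ∈ stripZeros p.1 ∧ 0 < p.2.im ∧
      p.1⁻¹ a ≠ p.1⁻¹ b := by
    obtain ⟨ρ, hρ⟩ := (hG χ).stripZeros_nonempty (hG χ⁻¹)
    rcases lt_or_gt_of_ne ((hG χ).im_ne ρ hρ) with h | h
    · refine ⟨(χ⁻¹, (starRingEnd ℂ) ρ), conj_mem_stripZeros hρ, by simpa using h, fun h1 => hχ ?_⟩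
      have h2 : ∀ c, (χ⁻¹)⁻¹ c = star (χ⁻¹ c) := fun c => (MulChar.star_apply' χ⁻¹ c).symm
      change (χ⁻¹)⁻¹ a = (χ⁻¹)⁻¹ b at h1
      rw [h2, h2] at h1
      exact star_injective h1
    · exact ⟨(χ, ρ), hρ, h, hχ⟩
  obtain ⟨p, hp, hp0, hpne⟩ := key
  refine ⟨p, hp, hp0, ?_⟩
  have hφ : (q.totient : ℂ) ≠ 0 := by
    exact_mod_cast (Nat.totient_pos.2 (Nat.pos_of_ne_zero (NeZero.ne q))).ne'
  have h0 : p.2 ≠ 0 := fun h => by rw [h] at hp0; simp at hp0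
  have h1 : p.2 - 1 ≠ 0 := fun h => by
    rw [sub_eq_zero.1 h] at hp0; simp at hp0
  rw [formCoeff, formCoeff, ← mul_sub, ← sub_mul]
  refine mul_ne_zero (mul_ne_zero two_ne_zero (inv_ne_zero hφ))
    (mul_ne_zero (sub_ne_zero.2 hpne) ?_)
  exact div_ne_zero (div_ne_zero (pow_ne_zero _ h1) h0) ((hG p.1).deriv_entireL_ne hp)

theorem sum_formFreq_ne_zero
    (hLI : LinearIndependent ℚ (fun p : {p : DirichletCharacter ℂ q × ℂ //
      p.2 ∈ stripZeros p.1 ∧ 0 < p.2.im} => (p : DirichletCharacter ℂ q × ℂ).2.im))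
    (T : ℝ) [Fintype (posZeros q T)] (n : posZeros q T → ℤ) (hn : n ≠ 0) :
    ∑ p : posZeros q T, n p * formFreq (p : DirichletCharacter ℂ q × ℂ) ≠ 0 := by
  intro h
  have h1 := hLI.comp (fun p : posZeros q T => ⟨p, p.2.1, p.2.2.1⟩) fun p p' h => by
    simpa [Subtype.ext_iff] using h
  rw [Fintype.linearIndependent_iff] at h1
  refine hn (funext fun p => ?_)
  have h2 := h1 (fun p => (n p : ℚ)) ?_ p
  · exact_mod_cast h2
  · have h3 : ∑ p : posZeros q T, (n p : ℝ) * (p : DirichletCharacter ℂ q × ℂ).2.im =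
        2 * Real.pi * ∑ p : posZeros q T, n p * formFreq (p : DirichletCharacter ℂ q × ℂ) := by
      rw [Finset.mul_sum]
      refine Finset.sum_congr rfl fun p _ => ?_
      rw [formFreq]; field_simp
    rw [h, mul_zero] at h3
    simpa [Rat.smul_def] using h3

theorem exists_progMean_sub_approx (hG : ∀ χ : DirichletCharacter ℂ q, GoodZeros χ)
    (hS : ∀ χ : DirichletCharacter ℂ q, Summable fun ρ : stripZeros χ =>
      ‖zeroCoeff χ ρ‖ ^ 2 * Real.log (5 + |(ρ : ℂ).im|))
    {a b : ZMod q} (ha : IsUnit a) (hb : IsUnit b) {η : ℝ} (hη : 0 < η) :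
    ∃ T₀ : ℝ, ∀ T, T₀ ≤ T → ∀ [Fintype (posZeros q T)], ∃ K, ∀ Y, 0 ≤ Y →
      ∫ y in Set.Ioc 0 Y, |(progMean a y - progMean b y) -
        torusForm ((fun p : posZeros q T => formCoeff a p) - fun p : posZeros q T => formCoeff b p)
        (torusFlow (fun p => formFreq (p : DirichletCharacter ℂ q × ℂ)) y)| ≤ η * Y + K := by
  obtain ⟨T₁, h₁⟩ := exists_progMean_approx hG hS ha (half_pos hη)
  obtain ⟨T₂, h₂⟩ := exists_progMean_approx hG hS hb (half_pos hη)
  refine ⟨max T₁ T₂, fun T hT _ => ?_⟩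
  obtain ⟨K₁, hK₁⟩ := h₁ T ((le_max_left _ _).trans hT)
  obtain ⟨K₂, hK₂⟩ := h₂ T ((le_max_right _ _).trans hT)
  refine ⟨K₁ + K₂, fun Y hY => ?_⟩
  have hcF : ∀ c : ZMod q, Continuous fun y => torusForm (fun p : posZeros q T => formCoeff c p)
      (torusFlow (fun p => formFreq (p : DirichletCharacter ℂ q × ℂ)) y) := fun c =>
    (continuous_torusForm _).comp (continuous_torusFlow _)
  have i₁ : IntegrableOn (fun y => |progMean a y - torusForm (fun p : posZeros q T => formCoeff a p)
      (torusFlow (fun p => formFreq (p : DirichletCharacter ℂ q × ℂ)) y)|) (Set.Ioc 0 Y) :=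
    ((integrableOn_progMean ha Y).sub (hcF a).integrableOn_Ioc).abs
  have i₂ : IntegrableOn (fun y => |progMean b y - torusForm (fun p : posZeros q T => formCoeff b p)
      (torusFlow (fun p => formFreq (p : DirichletCharacter ℂ q × ℂ)) y)|) (Set.Ioc 0 Y) :=
    ((integrableOn_progMean hb Y).sub (hcF b).integrableOn_Ioc).abs
  simp only [torusForm_sub]
  have h3 := add_le_add (hK₁ Y hY) (hK₂ Y hY)
  rw [← integral_add i₁ i₂] at h3
  refine (integral_mono (((integrableOn_progMean ha Y).sub (integrableOn_progMean hb Y)).sub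
    ((hcF a).integrableOn_Ioc.sub (hcF b).integrableOn_Ioc)).abs (i₁.add i₂) fun y => ?_).trans
    (h3.trans (le_of_eq (by ring)))
  simp only [Pi.sub_apply, Pi.add_apply]
  rw [sub_sub_sub_comm]
  exact abs_sub _ _

/-- The lower density in the race between two residue classes. -/
theorem lower_density_two (hG : ∀ χ : DirichletCharacter ℂ q, GoodZeros χ)
    (hS : ∀ χ : DirichletCharacter ℂ q, Summable fun ρ : stripZeros χ =>
      ‖zeroCoeff χ ρ‖ ^ 2 * Real.log (5 + |(ρ : ℂ).im|))
    (hLI : LinearIndependent ℚ (fun p : {p : DirichletCharacter ℂ q × ℂ //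
      p.2 ∈ stripZeros p.1 ∧ 0 < p.2.im} => (p : DirichletCharacter ℂ q × ℂ).2.im))
    {a b : ZMod q} (ha : IsUnit a) (hb : IsUnit b) (hab : a ≠ b) :
    ∀ ε > 0, ∀ᶠ Y in atTop, (1 / 2 - ε) * Y ≤ volume.real
      ({y | 0 < progMean a y - progMean b y ∧ 0 < progMean a y - progMean b y} ∩
        Set.Ioc 0 Y) := by
  have hm := (measurable_progMean a).sub (measurable_progMean b)
  have hi := fun Y => (integrableOn_progMean ha Y).sub (integrableOn_progMean hb Y)
  obtain ⟨p, hp, hp0, hpne⟩ := exists_formCoeff_ne hG ha hab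
  set κ := ‖formCoeff a p - formCoeff b p‖ with hκ
  have hκ0 : 0 < κ := norm_pos_iff.2 hpne
  refine lower_density_of_approx hm hm hi hi fun ε hε => ⟨κ * ε ^ 2, by positivity, fun η hη => ?_⟩
  obtain ⟨T₀, hT₀⟩ := exists_progMean_sub_approx hG hS ha hb hη
  set T := max T₀ p.2.im with hT
  let := (finite_posZeros hG T).fintype
  obtain ⟨K, hK⟩ := hT₀ T (le_max_left _ _)
  set c := (fun p : posZeros q T => formCoeff a p) - fun p : posZeros q T => formCoeff b p with hc
  have hcF : Continuous fun y => torusForm c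
      (torusFlow (fun p => formFreq (p : DirichletCharacter ℂ q × ℂ)) y) :=
    (continuous_torusForm _).comp (continuous_torusFlow _)
  refine ⟨_, _, hcF, hcF, ⟨K, hK⟩, ⟨K, hK⟩, _, ?_, tendsto_mean_torusFlow_real
    (sum_formFreq_ne_zero hLI T)
    (((continuous_ramp (κ * ε ^ 2)).comp (continuous_torusForm c)).mul
      ((continuous_ramp (κ * ε ^ 2)).comp (continuous_torusForm c)))⟩
  have h1 := one_le_integral_ramp c (i₀ := ⟨p, hp, hp0, le_max_right _ _⟩) hpne
    (δ := κ * ε ^ 2) (by positivity)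
  have h2 : ‖c ⟨p, hp, hp0, le_max_right _ _⟩‖ = κ := rfl
  rw [h2, mul_div_cancel_left₀ _ hκ0.ne', Real.sqrt_sq hε.le] at h1
  simp only [Pi.mul_apply, Function.comp_apply]
  linarith

/-- The lower density in the race between the residue classes `a`, `aρ`, `aρ²` for a cube root
of unity `ρ`. -/
theorem lower_density_three (hG : ∀ χ : DirichletCharacter ℂ q, GoodZeros χ)
    (hS : ∀ χ : DirichletCharacter ℂ q, Summable fun ρ : stripZeros χ =>
      ‖zeroCoeff χ ρ‖ ^ 2 * Real.log (5 + |(ρ : ℂ).im|))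
    (hLI : LinearIndependent ℚ (fun p : {p : DirichletCharacter ℂ q × ℂ //
      p.2 ∈ stripZeros p.1 ∧ 0 < p.2.im} => (p : DirichletCharacter ℂ q × ℂ).2.im))
    {a b c r : ZMod q} (ha : IsUnit a) (hr : r ≠ 1) (hr3 : r ^ 3 = 1) (hb : b = a * r)
    (hc : c = a * r ^ 2) :
    ∀ ε > 0, ∀ᶠ Y in atTop, (1 / 6 - ε) * Y ≤ volume.real
      ({y | 0 < progMean a y - progMean b y ∧ 0 < progMean b y - progMean c y} ∩
        Set.Ioc 0 Y) := by
  have hru : IsUnit r := IsUnit.of_mul_eq_one (r ^ 2) (by rw [← hr3]; ring)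
  have hbu : IsUnit b := hb ▸ ha.mul hru
  have hcu : IsUnit c := hc ▸ ha.mul (hru.pow 2)
  have hbr : b * r = c := by rw [hb, hc]; ring
  have hcr : c * r = a := by rw [hc]; linear_combination a * hr3
  have hne : ∀ {u v : ZMod q}, IsUnit u → u * r = v → u ≠ v := fun {u v} hu h h' => by
    rw [← h'] at h
    exact hr (hu.mul_left_cancel (by rw [h, mul_one]))
  obtain ⟨p₁, hp₁, hp₁0, hp₁ne⟩ := exists_formCoeff_ne hG ha (hne ha hb.symm)
  obtain ⟨p₂, hp₂, hp₂0, hp₂ne⟩ := exists_formCoeff_ne hG hbu (hne hbu hbr)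
  obtain ⟨p₃, hp₃, hp₃0, hp₃ne⟩ := exists_formCoeff_ne hG hcu (hne hcu hcr)
  set κ₁ := ‖formCoeff a p₁ - formCoeff b p₁‖ with hκ₁
  set κ₂ := ‖formCoeff b p₂ - formCoeff c p₂‖ with hκ₂
  set κ₃ := ‖formCoeff c p₃ - formCoeff a p₃‖ with hκ₃
  have hκ₁0 : 0 < κ₁ := norm_pos_iff.2 hp₁ne
  have hκ₂0 : 0 < κ₂ := norm_pos_iff.2 hp₂ne
  have hκ₃0 : 0 < κ₃ := norm_pos_iff.2 hp₃ne
  set κ := min κ₁ (min κ₂ κ₃) with hκ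
  have hκ0 : 0 < κ := lt_min hκ₁0 (lt_min hκ₂0 hκ₃0)
  have hk1 : κ ≤ κ₁ := min_le_left _ _
  have hk2 : κ ≤ κ₂ := (min_le_right _ _).trans (min_le_left _ _)
  have hk3 : κ ≤ κ₃ := (min_le_right _ _).trans (min_le_right _ _)
  refine lower_density_of_approx ((measurable_progMean a).sub (measurable_progMean b))
    ((measurable_progMean b).sub (measurable_progMean c))
    (fun Y => (integrableOn_progMean ha Y).sub (integrableOn_progMean hbu Y))
    (fun Y => (integrableOn_progMean hbu Y).sub (integrableOn_progMean hcu Y))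
    fun ε hε => ⟨κ * ε ^ 2, by positivity, fun η hη => ?_⟩
  have hsq : ∀ κ', κ ≤ κ' → √(κ * ε ^ 2 / κ') ≤ ε := fun κ' h => by
    rw [Real.sqrt_le_left hε.le, div_le_iff₀ (hκ0.trans_le h), mul_comm]
    exact mul_le_mul_of_nonneg_left h (sq_nonneg ε)
  obtain ⟨T₁, hT₁⟩ := exists_progMean_sub_approx hG hS ha hbu hη
  obtain ⟨T₂, hT₂⟩ := exists_progMean_sub_approx hG hS hbu hcu hη
  obtain ⟨T, hT⟩ : ∃ T, T₁ ≤ T ∧ T₂ ≤ T ∧ p₁.2.im ≤ T ∧ p₂.2.im ≤ T ∧ p₃.2.im ≤ T :=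
    ⟨max (max T₁ T₂) (max p₁.2.im (max p₂.2.im p₃.2.im)), by simp⟩
  obtain ⟨ht1, ht2, ht3, ht4, ht5⟩ := hT
  let := (finite_posZeros hG T).fintype
  obtain ⟨K₁, hK₁⟩ := hT₁ T ht1
  obtain ⟨K₂, hK₂⟩ := hT₂ T ht2
  set f : Fin 3 → posZeros q T → ℂ := fun k p => formCoeff (![a, b, c] k) p with hf
  have hcF : ∀ j k, Continuous fun y => torusForm (f j - f k)
      (torusFlow (fun p => formFreq (p : DirichletCharacter ℂ q × ℂ)) y) := fun j k =>
    (continuous_torusForm _).comp (continuous_torusFlow _)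
  refine ⟨_, _, hcF 0 1, hcF 1 2, ⟨K₁, hK₁⟩, ⟨K₂, hK₂⟩, _, ?_, tendsto_mean_torusFlow_real
    (sum_formFreq_ne_zero hLI T)
    (((continuous_ramp (κ * ε ^ 2)).comp (continuous_torusForm (f 0 - f 1))).mul
      ((continuous_ramp (κ * ε ^ 2)).comp (continuous_torusForm (f 1 - f 2))))⟩
  have hphase : ∀ p : posZeros q T, ∃ t : UnitAddCircle,
      (AddCircle.toCircle t : ℂ) = (p : DirichletCharacter ℂ q × ℂ).1⁻¹ r := fun p => by
    have h1 : ‖(p : DirichletCharacter ℂ q × ℂ).1⁻¹ r‖ = 1 := by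
      refine (pow_eq_one_iff_of_nonneg (norm_nonneg _) three_ne_zero).1 ?_
      rw [← norm_pow, ← map_pow, hr3, map_one, norm_one]
    refine ⟨((Complex.arg ((p : DirichletCharacter ℂ q × ℂ).1⁻¹ r) / (2 * Real.pi) : ℝ) :
      UnitAddCircle), ?_⟩
    have h2 := Complex.norm_mul_exp_arg_mul_I ((p : DirichletCharacter ℂ q × ℂ).1⁻¹ r)
    rw [h1, Complex.ofReal_one, one_mul] at h2
    rw [AddCircle.toCircle_apply_mk, Circle.coe_exp, div_one, mul_div_cancel₀ _ (by positivity), h2]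
  choose t ht using hphase
  have hstep : ∀ {u v : ZMod q}, u * r = v → ∀ p : posZeros q T,
      formCoeff u p * (AddCircle.toCircle (t p) : ℂ) = formCoeff v p := fun {u v} h p => by
    rw [ht, formCoeff, formCoeff, ← h, map_mul]
    ring
  have h1 := one_le_integral_ramp_ramp f (t := t) (hstep hb.symm) (hstep hbr) (hstep hcr)
    (i₁ := ⟨p₁, hp₁, hp₁0, ht3⟩) (i₂ := ⟨p₂, hp₂, hp₂0, ht4⟩) (i₃ := ⟨p₃, hp₃, hp₃0, ht5⟩)
    hp₁ne hp₂ne hp₃ne (δ := κ * ε ^ 2) (by positivity)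
  have h2 := hsq κ₁ hk1
  have h3 := hsq κ₂ hk2
  have h4 := hsq κ₃ hk3
  change 1 ≤ _ + (2 * √(κ * ε ^ 2 / κ₁) + 2 * √(κ * ε ^ 2 / κ₂) + 2 * √(κ * ε ^ 2 / κ₃)) at h1
  simp only [Pi.mul_apply, Function.comp_apply]
  linarith

end Races

section Assembly

theorem sum_le_tsum_coe_of_finite {α β : Type*} {s : Set β} (hs : s.Finite) (g : β → ℝ)
    (hg : ∀ b, 0 ≤ g b) {i : α → β} (hi : Function.Injective i) {S : Finset α}
    (hS : ∀ a ∈ S, i a ∈ s) : ∑ a ∈ S, g (i a) ≤ ∑' b : s, g b := by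
  classical
  let := hs.fintype
  rw [tsum_fintype, ← Finset.sum_image (f := g) (hi.injOn (s := S)), Finset.sum_set_coe]
  refine Finset.sum_le_sum_of_subset_of_nonneg (fun b hb => ?_) fun b _ _ => hg b
  obtain ⟨a, ha, rfl⟩ := Finset.mem_image.1 hb
  exact Set.mem_toFinset.2 (hS a ha)

variable {q : ℕ}

theorem exp_mem_race_iff (u v : ZMod q) (y : ℝ) :
    Mprog q v (Real.exp y) < Mprog q u (Real.exp y) ↔ 0 < progMean u y - progMean v y := by
  rw [progMean, progMean, ← mul_sub, mul_pos_iff_of_pos_left (Real.exp_pos _), sub_pos]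

variable [NeZero q]

theorem hasLogDensity_two (hG : ∀ χ : DirichletCharacter ℂ q, GoodZeros χ)
    (hS : ∀ χ : DirichletCharacter ℂ q, Summable fun ρ : stripZeros χ =>
      ‖zeroCoeff χ ρ‖ ^ 2 * Real.log (5 + |(ρ : ℂ).im|))
    (hLI : LinearIndependent ℚ (fun p : {p : DirichletCharacter ℂ q × ℂ //
      p.2 ∈ stripZeros p.1 ∧ 0 < p.2.im} => (p : DirichletCharacter ℂ q × ℂ).2.im))
    {a b : ZMod q} (ha : IsUnit a) (hb : IsUnit b) (hab : a ≠ b) :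
    HasLogDensity {x : ℝ | 0 < x ∧ Mprog q b x < Mprog q a x} (1 / 2) := by
  have key : ∀ u v : ZMod q, IsUnit u → IsUnit v → u ≠ v → ∀ ε > 0, ∀ᶠ Y in atTop,
      (1 / 2 - ε) * Y ≤ volume.real ({y | Real.exp y ∈
        {x : ℝ | 0 < x ∧ Mprog q v x < Mprog q u x}} ∩ Set.Ioc 0 Y) := by
    intro u v hu hv huv
    simpa only [Set.mem_ofPred_eq, Real.exp_pos, true_and, exp_mem_race_iff, and_self] using
      lower_density_two hG hS hLI hu hv huv
  refine hasLogDensity_of_lower (P := ![{x : ℝ | 0 < x ∧ Mprog q b x < Mprog q a x},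
    {x : ℝ | 0 < x ∧ Mprog q a x < Mprog q b x}]) (d := fun _ => 1 / 2) ?_ ?_ (by norm_num) ?_ 0
  · intro j
    fin_cases j <;>
    exact measurableSet_Ioi.inter (measurableSet_lt (measurable_Mprog _) (measurable_Mprog _))
  · have h : Disjoint {x : ℝ | 0 < x ∧ Mprog q b x < Mprog q a x}
        {x : ℝ | 0 < x ∧ Mprog q a x < Mprog q b x} :=
      Set.disjoint_left.2 fun x h h' => lt_asymm h.2 h'.2
    intro i j hij
    fin_cases i <;> fin_cases j
    exacts [absurd rfl hij, h, h.symm, absurd rfl hij]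
  · intro j
    fin_cases j
    exacts [key a b ha hb hab, key b a hb ha hab.symm]

theorem hasLogDensity_three (hG : ∀ χ : DirichletCharacter ℂ q, GoodZeros χ)
    (hS : ∀ χ : DirichletCharacter ℂ q, Summable fun ρ : stripZeros χ =>
      ‖zeroCoeff χ ρ‖ ^ 2 * Real.log (5 + |(ρ : ℂ).im|))
    (hLI : LinearIndependent ℚ (fun p : {p : DirichletCharacter ℂ q × ℂ //
      p.2 ∈ stripZeros p.1 ∧ 0 < p.2.im} => (p : DirichletCharacter ℂ q × ℂ).2.im))
    {a b c r : ZMod q} (ha : IsUnit a) (hr : r ≠ 1) (hr3 : r ^ 3 = 1) (hb : b = a * r)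
    (hc : c = a * r ^ 2) :
    HasLogDensity {x : ℝ | 0 < x ∧ Mprog q c x < Mprog q b x ∧ Mprog q b x < Mprog q a x}
      (1 / 6) := by
  have hru : IsUnit r := IsUnit.of_mul_eq_one (r ^ 2) (by rw [← hr3]; ring)
  have hbu : IsUnit b := hb ▸ ha.mul hru
  have hcu : IsUnit c := hc ▸ ha.mul (hru.pow 2)
  have hr2 : r ^ 2 ≠ 1 := fun h => hr (by linear_combination hr3 - r * h)
  have hr6 : (r ^ 2) ^ 3 = 1 := by linear_combination (r ^ 3 + 1) * hr3
  set Q : ZMod q → ZMod q → ZMod q → Set ℝ := fun u v w =>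
    {x : ℝ | 0 < x ∧ Mprog q w x < Mprog q v x ∧ Mprog q v x < Mprog q u x} with hQ
  have key : ∀ {u v w s : ZMod q}, IsUnit u → s ≠ 1 → s ^ 3 = 1 → v = u * s → w = u * s ^ 2 →
      ∀ ε > 0, ∀ᶠ Y in atTop,
        (1 / 6 - ε) * Y ≤ volume.real ({y | Real.exp y ∈ Q u v w} ∩ Set.Ioc 0 Y) := by
    intro u v w s hu hs hs3 hv hw
    have h := lower_density_three hG hS hLI hu hs hs3 hv hw
    simp only [← exp_mem_race_iff] at h
    simpa only [hQ, Set.mem_ofPred_eq, Real.exp_pos, true_and, and_comm] using h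
  have hmeas : ∀ u v w, MeasurableSet (Q u v w) := fun u v w =>
    measurableSet_Ioi.inter
      ((measurableSet_lt (measurable_Mprog _) (measurable_Mprog _)).inter
        (measurableSet_lt (measurable_Mprog _) (measurable_Mprog _)))
  refine hasLogDensity_of_lower (P := ![Q a b c, Q b c a, Q c a b, Q a c b, Q b a c, Q c b a])
    (d := fun _ => 1 / 6) ?_ ?_ (by norm_num) ?_ 0
  · intro j
    fin_cases j <;> exact hmeas _ _ _
  · intro i j hij
    rw [Function.onFun, Set.disjoint_left]
    fin_cases i <;> fin_cases j <;> first
    | exact absurd rfl hij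
    | exact fun x h h' => by
        obtain ⟨-, h1, h2⟩ := h
        obtain ⟨-, h3, h4⟩ := h'
        linarith
  · intro j
    fin_cases j
    · exact key ha hr hr3 hb hc
    · exact key hbu hr hr3 (by rw [hb, hc]; ring) (by rw [hb]; linear_combination -a * hr3)
    · exact key hcu hr hr3 (by rw [hc]; linear_combination -a * hr3)
        (by rw [hb, hc]; linear_combination -a * r * hr3)
    · exact key ha hr2 hr6 hc (by rw [hb]; linear_combination -a * r * hr3)
    · exact key hbu hr2 hr6 (by rw [hb]; linear_combination -a * hr3)
        (by rw [hb, hc]; linear_combination -a * r ^ 2 * hr3)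
    · exact key hcu hr2 hr6 (by rw [hb, hc]; linear_combination -a * r * hr3)
        (by rw [hc]; linear_combination -a * (r ^ 3 + 1) * hr3)

theorem summable_zeroCoeff_of_tsum_le (hG : ∀ χ : DirichletCharacter ℂ q, GoodZeros χ) {θ C : ℝ}
    (hθ : θ < 2)
    (hJ : ∀ T : ℝ, 1 ≤ T →
      (∑' p : {p : DirichletCharacter ℂ q × ℂ //
          DirichletCharacter.LFunction p.1 p.2 = 0 ∧ 0 < p.2.re ∧ p.2.re < 1 ∧
          0 < |p.2.im| ∧ |p.2.im| ≤ T},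
        1 / ‖deriv (DirichletCharacter.LFunction (p : DirichletCharacter ℂ q × ℂ).1)
          (p : DirichletCharacter ℂ q × ℂ).2‖ ^ 2) ≤ C * T ^ θ)
    (χ : DirichletCharacter ℂ q) : Summable fun ρ : stripZeros χ =>
      ‖zeroCoeff χ ρ‖ ^ 2 * Real.log (5 + |(ρ : ℂ).im|) := by
  refine (hG χ).summable_zeroCoeff (C := C) hθ fun T hT S hS => ?_
  have hfin : {p : DirichletCharacter ℂ q × ℂ |
      DirichletCharacter.LFunction p.1 p.2 = 0 ∧ 0 < p.2.re ∧ p.2.re < 1 ∧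
      0 < |p.2.im| ∧ |p.2.im| ≤ T}.Finite := by
    refine (Set.finite_iUnion fun χ : DirichletCharacter ℂ q =>
      ((hG χ).finite_zeros T).image fun ρ => (χ, ρ)).subset ?_
    rintro ⟨χ, ρ⟩ ⟨h1, h2, h3, -, h5⟩
    exact Set.mem_iUnion.2 ⟨χ, ρ, ⟨⟨h1, h2, h3⟩, h5⟩, rfl⟩
  refine le_trans ?_ (hJ T hT)
  exact sum_le_tsum_coe_of_finite hfin
    (fun p => 1 / ‖deriv (DirichletCharacter.LFunction p.1) p.2‖ ^ 2) (fun _ => by positivity)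
    (Prod.mk_right_injective χ) fun ρ hρ => ⟨(hS ρ hρ).1.1, (hS ρ hρ).1.2.1, (hS ρ hρ).1.2.2,
      abs_pos.2 ((hG χ).im_ne ρ (hS ρ hρ).1), (hS ρ hρ).2⟩

theorem linearIndependent_of_nonneg_im
    (hLI : LinearIndependent ℚ
      (fun p : {p : DirichletCharacter ℂ q × ℂ //
          DirichletCharacter.LFunction p.1 p.2 = 0 ∧ 0 < p.2.re ∧ p.2.re < 1 ∧
          0 ≤ p.2.im} => (p : DirichletCharacter ℂ q × ℂ).2.im)) :
    LinearIndependent ℚ (fun p : {p : DirichletCharacter ℂ q × ℂ //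
      p.2 ∈ stripZeros p.1 ∧ 0 < p.2.im} => (p : DirichletCharacter ℂ q × ℂ).2.im) := by
  have hinj : Function.Injective fun p : {p : DirichletCharacter ℂ q × ℂ //
      p.2 ∈ stripZeros p.1 ∧ 0 < p.2.im} => (⟨p.1, p.2.1.1, p.2.1.2.1, p.2.1.2.2, p.2.2.le⟩ :
      {p : DirichletCharacter ℂ q × ℂ // DirichletCharacter.LFunction p.1 p.2 = 0 ∧
        0 < p.2.re ∧ p.2.re < 1 ∧ 0 ≤ p.2.im}) := fun p p' h =>
    Subtype.ext (congrArg (fun z => z.1) h)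
  have h := hLI.comp _ hinj
  exact h

end Assembly

theorem statement15
    (q : ℕ) (hq : 2 ≤ q) [NeZero q]
    -- GRH for all Dirichlet L-functions mod q
    (hGRH : ∀ χ : DirichletCharacter ℂ q, ∀ ρ : ℂ,
      DirichletCharacter.LFunction χ ρ = 0 → 0 < ρ.re → ρ.re < 1 → ρ.re = 1 / 2)
    -- all nonreal zeros are simple
    (hsimple : ∀ χ : DirichletCharacter ℂ q, ∀ ρ : ℂ,
      DirichletCharacter.LFunction χ ρ = 0 → 0 < ρ.re → ρ.re < 1 → ρ.im ≠ 0 →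
        deriv (DirichletCharacter.LFunction χ) ρ ≠ 0)
    -- the negative second moment bound for L′ at the zeros
    (θ C : ℝ) (hθ1 : 1 ≤ θ) (hθ2 : θ < 3 - Real.sqrt 3)
    (hJ : ∀ T : ℝ, 1 ≤ T →
      (∑' p : {p : DirichletCharacter ℂ q × ℂ //
          DirichletCharacter.LFunction p.1 p.2 = 0 ∧ 0 < p.2.re ∧ p.2.re < 1 ∧
          0 < |p.2.im| ∧ |p.2.im| ≤ T},
        1 / ‖deriv (DirichletCharacter.LFunction (p : DirichletCharacter ℂ q × ℂ).1)
          (p : DirichletCharacter ℂ q × ℂ).2‖ ^ 2) ≤ C * T ^ θ)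
    -- linear independence over ℚ of the multiset of nonnegative imaginary parts of the
    -- nontrivial zeros of the Dirichlet L-functions mod q
    (hLI : LinearIndependent ℚ
      (fun p : {p : DirichletCharacter ℂ q × ℂ //
          DirichletCharacter.LFunction p.1 p.2 = 0 ∧ 0 < p.2.re ∧ p.2.re < 1 ∧
          0 ≤ p.2.im} => (p : DirichletCharacter ℂ q × ℂ).2.im)) :
    (∀ a₁ a₂ : ZMod q, IsUnit a₁ → IsUnit a₂ → a₁ ≠ a₂ →
      HasLogDensity {x : ℝ | 0 < x ∧ Mprog q a₂ x < Mprog q a₁ x} (1 / 2)) ∧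
    (∀ a₁ a₂ a₃ : ZMod q, IsUnit a₁ → IsUnit a₂ → IsUnit a₃ →
      ∀ ρ : ZMod q, ρ ≠ 1 → ρ ^ 3 = 1 → a₂ = a₁ * ρ → a₃ = a₁ * ρ ^ 2 →
      HasLogDensity {x : ℝ | 0 < x ∧ Mprog q a₃ x < Mprog q a₂ x ∧
        Mprog q a₂ x < Mprog q a₁ x} (1 / 6)) := by
  have hLI' : LinearIndependent ℚ (fun p : {p : DirichletCharacter ℂ q × ℂ //
      p.2 ∈ stripZeros p.1 ∧ 0 < p.2.im} => (p : DirichletCharacter ℂ q × ℂ).2.im) :=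
    linearIndependent_of_nonneg_im hLI
  have hG : ∀ χ : DirichletCharacter ℂ q, GoodZeros χ := fun χ => by
    have him : ∀ ρ ∈ stripZeros χ, ρ.im ≠ 0 := fun ρ hρ h =>
      hLI.ne_zero ⟨(χ, ρ), hρ.1, hρ.2.1, hρ.2.2, h.ge⟩ h
    exact ⟨fun ρ hρ => hGRH χ ρ hρ.1 hρ.2.1 hρ.2.2, him,
      fun ρ hρ => hsimple χ ρ hρ.1 hρ.2.1 hρ.2.2 (him ρ hρ)⟩
  have hθ : θ < 2 := by
    have : (1 : ℝ) < √3 := Real.lt_sqrt_of_sq_lt (by norm_num)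
    linarith
  have hS := summable_zeroCoeff_of_tsum_le hG hθ hJ
  exact ⟨fun a b ha hb hab => hasLogDensity_two hG hS hLI' ha hb hab,
    fun a b c ha _ _ r hr hr3 hb hc => hasLogDensity_three hG hS hLI' ha hr hr3 hb hc⟩
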